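/- Every graph on at least nine vertices with minimum degree at least 2 and at most three vertices of degree 2 contains a cycle whose length is divisible by 4. -/

import Mathlib

namespace CycleModFour

open Finset

section

variable {V : Type*}

/-- `Seg G a P b`: the vertices of `P`, read from `a` to `b`, form the interior of a walk. -/
def Seg (G : SimpleGraph V) : V → List V → V → Prop
  | a, [], b => G.Adj a b
  | a, p :: P, b => G.Adj a p ∧ Seg G p P b

section Seg

variable {G : SimpleGraph V} {a b c : V} {P Q : List V}

@[simp] theorem seg_nil : Seg G a [] b ↔ G.Adj a b := Iff.rfl

@[simp] theorem seg_cons : Seg G a (c :: P) b ↔ G.Adj a c ∧ Seg G c P b := Iff.rfl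

@[simp] theorem seg_append : Seg G a (P ++ c :: Q) b ↔ Seg G a P c ∧ Seg G c Q b := by
  induction P generalizing a with
  | nil => simp
  | cons p P ih => simp [ih, and_assoc]

theorem Seg.reverse (h : Seg G a P b) : Seg G b P.reverse a := by
  induction P generalizing a with
  | nil => exact h.symm
  | cons p P ih => simp only [List.reverse_cons, seg_append, seg_nil]; exact ⟨ih h.2, h.1.symm⟩

theorem seg_reverse : Seg G b P.reverse a ↔ Seg G a P b :=
  ⟨fun h => by simpa using h.reverse, Seg.reverse⟩

theorem Seg.imp {H : SimpleGraph V} (h : Seg G a P b)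
    (hGH : ∀ u ∈ a :: (P ++ [b]), ∀ v ∈ a :: (P ++ [b]), G.Adj u v → H.Adj u v) : Seg H a P b := by
  induction P generalizing a with
  | nil => exact hGH _ (by simp) _ (by simp) h
  | cons p P ih =>
    exact ⟨hGH _ (by simp) _ (by simp) h.1,
      ih h.2 fun u hu v hv => hGH u (List.mem_cons_of_mem _ hu) v (List.mem_cons_of_mem _ hv)⟩

end Seg

/-- No cycle of `G` has length divisible by four. -/
def Free (G : SimpleGraph V) : Prop :=
  ∀ x L, Seg G x L x → (x :: L).Nodup → L.length % 4 ≠ 3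

/-- `G` has a cycle of length divisible by four with all its vertices in `S`. -/
def HasCycleIn (G : SimpleGraph V) (S : Finset V) : Prop :=
  ∃ x L, Seg G x L x ∧ (x :: L).Nodup ∧ L.length % 4 = 3 ∧ ∀ y ∈ x :: L, y ∈ S

/-- At least two neighbours in `S`. -/
def D2 (G : SimpleGraph V) (S : Finset V) (v : V) : Prop :=
  ∃ a b, a ≠ b ∧ a ∈ S ∧ b ∈ S ∧ G.Adj v a ∧ G.Adj v b

/-- At least three neighbours in `S`. -/
def D3 (G : SimpleGraph V) (S : Finset V) (v : V) : Prop :=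
  ∃ a b c, a ≠ b ∧ a ≠ c ∧ b ≠ c ∧ a ∈ S ∧ b ∈ S ∧ c ∈ S ∧ G.Adj v a ∧ G.Adj v b ∧ G.Adj v c

section Free

variable {G : SimpleGraph V}

theorem Free.two_paths (hf : Free G) {a b : V} {P Q : List V} (hP : Seg G a P b)
    (hQ : Seg G b Q a) (hn : (a :: (P ++ b :: Q)).Nodup) : (P.length + Q.length) % 4 ≠ 2 := by
  have := hf a (P ++ b :: Q) (by simp [hP, hQ]) hn
  simp only [List.length_append, List.length_cons] at this
  omega

theorem Free.no_square (hf : Free G) {a b c d : V} (hab : G.Adj a b) (hbc : G.Adj b c)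
    (hcd : G.Adj c d) (hda : G.Adj d a) (hac : a ≠ c) (hbd : b ≠ d) : False := by
  refine hf a [b, c, d] (by simp [*]) ?_ (by simp)
  have := hab.ne; have := hbc.ne; have := hcd.ne; have := hda.ne
  simp; grind

end Free

/-- A minimal counterexample: `W` is the set of vertices of degree two, and every smaller graph
satisfying the hypotheses has a cycle of length divisible by four. -/
structure Crit [Fintype V] (G : SimpleGraph V) (W : Finset V) : Prop where
  free : Free G
  d2 : ∀ v, D2 G univ v
  d3 : ∀ v, v ∉ W → D3 G univ v
  wdeg : ∀ w ∈ W, ∃ a b, a ≠ b ∧ ∀ x, G.Adj w x ↔ x = a ∨ x = b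
  card_le : #W ≤ 3
  big : #W ≤ 2 ∨ 9 ≤ Fintype.card V
  red : ∀ (H : SimpleGraph V) (S W' : Finset V), #S < Fintype.card V → S.Nonempty →
    (∀ v ∈ S, D2 H S v) → (∀ v ∈ S, v ∉ W' → D3 H S v) → #W' ≤ 3 → (#W' ≤ 2 ∨ 9 ≤ #S) →
    HasCycleIn H S

theorem D3.d2 {G : SimpleGraph V} {S : Finset V} {v : V} (h : D3 G S v) : D2 G S v := by
  obtain ⟨a, b, c, h⟩ := h
  exact ⟨a, b, h.1, h.2.2.2.1, h.2.2.2.2.1, h.2.2.2.2.2.2.1, h.2.2.2.2.2.2.2.1⟩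

theorem D2.mono {G H : SimpleGraph V} {S T : Finset V} {v : V} (h : D2 G S v)
    (hG : ∀ u ∈ S, G.Adj v u → H.Adj v u ∧ u ∈ T) : D2 H T v := by
  obtain ⟨a, b, hab, ha, hb, h1, h2⟩ := h
  exact ⟨a, b, hab, (hG a ha h1).2, (hG b hb h2).2, (hG a ha h1).1, (hG b hb h2).1⟩

theorem D3.mono {G H : SimpleGraph V} {S T : Finset V} {v : V} (h : D3 G S v)
    (hG : ∀ u ∈ S, G.Adj v u → H.Adj v u ∧ u ∈ T) : D3 H T v := by
  obtain ⟨a, b, c, hab, hac, hbc, ha, hb, hc, h1, h2, h3⟩ := h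
  exact ⟨a, b, c, hab, hac, hbc, (hG a ha h1).2, (hG b hb h2).2, (hG c hc h3).2,
    (hG a ha h1).1, (hG b hb h2).1, (hG c hc h3).1⟩

/-- Losing one neighbour `r`. -/
theorem D3.erase {G H : SimpleGraph V} {S T : Finset V} {v : V} (r : V) (h : D3 G S v)
    (hG : ∀ u ∈ S, G.Adj v u → u ≠ r → H.Adj v u ∧ u ∈ T) : D2 H T v := by
  obtain ⟨a, b, c, hab, hac, hbc, ha, hb, hc, h1, h2, h3⟩ := h
  by_cases har : a = r
  · exact ⟨b, c, hbc, (hG b hb h2 (by grind)).2, (hG c hc h3 (by grind)).2,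
      (hG b hb h2 (by grind)).1, (hG c hc h3 (by grind)).1⟩
  by_cases hbr : b = r
  · exact ⟨a, c, hac, (hG a ha h1 (by grind)).2, (hG c hc h3 (by grind)).2,
      (hG a ha h1 (by grind)).1, (hG c hc h3 (by grind)).1⟩
  · exact ⟨a, b, hab, (hG a ha h1 har).2, (hG b hb h2 hbr).2, (hG a ha h1 har).1,
      (hG b hb h2 hbr).1⟩

end

section

variable {V : Type*} [Fintype V] [DecidableEq V] {G : SimpleGraph V} {W : Finset V}

theorem Free.not_hasCycleIn {V : Type*} {G : SimpleGraph V} (hf : Free G) (S : Finset V) :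
    ¬ HasCycleIn G S :=
  fun ⟨x, L, h1, h2, h3, _⟩ => hf x L h1 h2 h3

/-- Deleting vertices from a minimal counterexample. -/
theorem Crit.delete (h : Crit G W) (S W' : Finset V) (hS : S ≠ univ) (hne : S.Nonempty)
    (h2 : ∀ v ∈ S, D2 G S v) (h3 : ∀ v ∈ S, v ∉ W' → D3 G S v) (hc : #W' ≤ 3)
    (hb : #W' ≤ 2 ∨ 9 ≤ #S) : False :=
  h.free.not_hasCycleIn S (h.red G S W' ((card_lt_iff_ne_univ S).2 hS) hne h2 h3 hc hb)

theorem Crit.sep1 (h : Crit G W) (O : Finset V) (x : V) (hx : x ∉ O) (hO : O.Nonempty)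
    (hy : ∃ y, y ∉ O ∧ y ≠ x) (hN : ∀ u ∈ O, ∀ v, G.Adj u v → v ∈ O ∨ v = x)
    (hw : #(O ∩ W) ≤ 1) : False := by
  induction hn : #O using Nat.strong_induction_on generalizing O x with
  | _ n ih =>
  subst hn
  by_cases h2 : D2 G O x
  · obtain ⟨y, hyO, hyx⟩ := hy
    refine h.delete (insert x O) (insert x (O ∩ W)) ?_ (insert_nonempty _ _) ?_ ?_ ?_ ?_
    · intro hu
      have := mem_univ y
      grind
    · intro v hv
      rcases mem_insert.1 hv with rfl | hv
      · exact h2.mono fun u hu ha => ⟨ha, by grind⟩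
      · exact (h.d2 v).mono fun u _ ha => ⟨ha, by grind⟩
    · intro v hv hv'
      exact (h.d3 v (by grind)).mono fun u _ ha => ⟨ha, by grind⟩
    · grind [card_insert_le]
    · grind [card_insert_le]
  by_cases h1 : ∃ x' ∈ O, G.Adj x x'
  · obtain ⟨x', hx', ha⟩ := h1
    have huniq : ∀ u ∈ O, G.Adj x u → u = x' := fun u hu hau => by
      by_contra hne
      exact h2 ⟨u, x', hne, hu, hx', hau, ha⟩
    refine ih _ (card_erase_lt_of_mem hx') (O.erase x') x' (by simp) ?_ ⟨x, by grind, ha.ne⟩ ?_ ?_ rfl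
    · obtain ⟨a, b, hab, -, -, h1, h2⟩ := h.d2 x'
      have := hN x' hx' a h1
      have := hN x' hx' b h2
      by_cases hax : a = x
      · exact ⟨b, by grind [h2.ne]⟩
      · exact ⟨a, by grind [h1.ne]⟩
    · intro u hu v huv
      rcases hN u (by grind) v huv with hv | rfl
      · grind
      · have := huniq u (by grind) huv.symm
        grind
    · exact (card_le_card (by grind)).trans hw
  · refine h.delete O (O ∩ W) (fun hu => by simp [hu] at hx) hO ?_ ?_ (by omega) (by omega)
    · intro v hv
      refine (h.d2 v).mono fun u _ ha => ⟨ha, ?_⟩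
      rcases hN v hv u ha with hu | rfl
      · exact hu
      · exact (h1 ⟨v, hv, ha.symm⟩).elim
    · intro v hv hv'
      refine (h.d3 v (by grind)).mono fun u _ ha => ⟨ha, ?_⟩
      rcases hN v hv u ha with hu | rfl
      · exact hu
      · exact (h1 ⟨v, hv, ha.symm⟩).elim

/-- A vertex set closed under adjacency is empty or everything. -/
theorem Crit.closed_eq_univ (h : Crit G W) (O : Finset V) (hO : O.Nonempty)
    (hN : ∀ u ∈ O, ∀ v, G.Adj u v → v ∈ O) : O = univ := by
  by_contra hne
  have hne' : Oᶜ.Nonempty := by rwa [nonempty_iff_ne_empty, ne_eq, compl_eq_empty_iff]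
  have hNc : ∀ u ∈ Oᶜ, ∀ v, G.Adj u v → v ∈ Oᶜ := fun u hu v huv => by
    by_contra hv
    exact mem_compl.1 hu (hN v (by simpa using hv) u huv.symm)
  have key : ∀ O : Finset V, O.Nonempty → Oᶜ.Nonempty → (∀ u ∈ O, ∀ v, G.Adj u v → v ∈ O) →
      (∀ u ∈ Oᶜ, ∀ v, G.Adj u v → v ∈ Oᶜ) → ¬ #(O ∩ W) ≤ 1 := by
    rintro O hO ⟨x, hx⟩ hN hNc hw
    obtain ⟨a, -, -, -, -, h1, -⟩ := h.d2 x
    exact h.sep1 O x (by simpa using hx) hO ⟨a, by simpa using hNc x hx a h1, h1.ne'⟩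
      (fun u hu v huv => Or.inl (hN u hu v huv)) hw
  have h1 := key O hO hne' hN hNc
  have h2 := key Oᶜ hne' (by simpa using hO) hNc (by simpa using hN)
  have h3 : #(O ∩ W) + #(Oᶜ ∩ W) ≤ 3 := by
    rw [← card_union_of_disjoint, ← union_inter_distrib_right, union_compl, univ_inter]
    · exact h.card_le
    · exact disjoint_left.2 fun v hv hv' => by simp at hv hv'; exact hv'.1 hv.1
  omega

end

section

/-! ### A search over small graphs, written with bare recursors so that the kernel runs it fast -/

section Search

/-- Row `i` of an adjacency list. -/
def row (R : List (List ℕ)) : ℕ → List ℕ :=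
  List.rec (fun _ => []) (fun r _ ih i => Nat.rec r (fun i _ => ih i) i) R

/-- Add the entry `j` to row `i`. -/
def put (R : List (List ℕ)) (j : ℕ) : ℕ → List (List ℕ) :=
  List.rec (fun _ => []) (fun r R ih i => Nat.rec ((j :: r) :: R) (fun i _ => r :: ih i) i) R

/-- Add the edge `ij` to an adjacency list. -/
def link (R : List (List ℕ)) (i j : ℕ) : List (List ℕ) := put (put R j i) i j

/-- Evaluate a list before passing it on. -/
def forceRow (r : List ℕ) : (List ℕ → Bool) → Bool :=
  List.rec (fun k => k []) (fun a _ ih k => ih fun r' => k (a :: r')) r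

/-- Evaluate an adjacency list before passing it on. -/
def force (R : List (List ℕ)) : (List (List ℕ) → Bool) → Bool :=
  List.rec (fun k => k []) (fun r _ ih k => forceRow r fun r' => ih fun R' => k (r' :: R')) R

/-- Boolean list membership. -/
def mem (u : ℕ) (l : List ℕ) : Bool :=
  List.rec false (fun a _ ih => bif Nat.beq u a then true else ih) l

/-- Depth-first search for a path from `v` to `s` that avoids `vis`, in which the number of
inner vertices plus `l` is `2` modulo four. -/
def pathTo (R : List (List ℕ)) (s : ℕ) (k : ℕ) : List ℕ → ℕ → ℕ → Bool :=
  Nat.rec (fun _ _ _ => false) (fun _ ih vis v l =>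
    List.rec false (fun u _ ih' => bif
      (bif Nat.beq u s then Nat.beq (Nat.mod l 4) 2
      else bif mem u vis then false else ih (u :: vis) u (Nat.succ l)) then true else ih')
      (row R v)) k

/-- Make the first open vertex the current one. -/
def next (done : Bool) (R : List (List ℕ)) (op : List ℕ) (cont : List ℕ → ℕ → List ℕ → Bool) :
    Bool :=
  List.rec done (fun i op _ =>
    forceRow (op.filter fun j => !(mem j (row R i))) fun js => cont op i js) op

/-- Is the first fresh label at most eight? -/
def small (fr : List ℕ) : Bool := List.rec false (fun m _ _ => Nat.ble m 8) fr

/-- Exhaustive search through the graphs without cycles of length divisible by four that extend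
the labelled graph `R`. The labels in `fr` are available for further vertices, at most `t` of the
vertices not yet complete may get degree two, the vertices in `op` and the current vertex `i` may
still get neighbours, and `js` lists the candidates for neighbours of `i`. The result is `true` if
only graphs on at most eight vertices turn up. -/
def search (k : ℕ) : List ℕ → List (List ℕ) → List ℕ → ℕ → ℕ → List ℕ → Bool :=
  Nat.rec (fun _ _ _ _ _ _ => false) (fun _ ih fr R op t i js =>
    List.rec
      (bif (List.rec true (fun _ r _ => List.rec true (fun _ r _ => List.rec
          (Nat.rec true (fun t _ => next (small fr) R op fun op i js => ih fr R op t i js) t)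
          (fun _ _ _ => next (small fr) R op fun op i js => ih fr R op t i js) r) r) (row R i)) then
        List.rec true (fun m fr _ =>
          force (link (R ++ [[]]) i m) fun R' => ih fr R' (m :: op) t i []) fr
      else false)
      (fun j js _ => bif ih fr R op t i js then
          (bif pathTo R j 12 [i] i 0 then true
            else force (link R i j) fun R' => ih fr R' op t i js)
          else false) js) k

/-- Adjacency list on `m` vertices with the given edges. -/
def ofEdges (m : ℕ) (E : List (ℕ × ℕ)) : List (List ℕ) :=
  E.foldr (fun e R => link R e.1 e.2) (List.replicate m [])

/-- The search started from the graph with edges `E`. -/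
def refute (m : ℕ) (fr : List ℕ) (E : List (ℕ × ℕ)) (op : List ℕ) (t : ℕ) : Bool :=
  force (ofEdges m E) fun R => next false R op fun op i js => search 200 fr R op t i js

@[simp] theorem row_nil (i : ℕ) : row [] i = [] := rfl

@[simp] theorem row_cons_zero (r : List ℕ) (R : List (List ℕ)) : row (r :: R) 0 = r := rfl

@[simp] theorem row_cons_succ (r : List ℕ) (R : List (List ℕ)) (i : ℕ) :
    row (r :: R) (i + 1) = row R i := rfl

theorem put_cons_zero (r : List ℕ) (R : List (List ℕ)) (j : ℕ) :
    put (r :: R) j 0 = (j :: r) :: R := rfl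

theorem put_cons_succ (r : List ℕ) (R : List (List ℕ)) (i j : ℕ) :
    put (r :: R) j (i + 1) = r :: put R j i := rfl

theorem length_put (R : List (List ℕ)) (i j : ℕ) : (put R j i).length = R.length := by
  induction R generalizing i with
  | nil => rfl
  | cons r R ih => cases i with
    | zero => rfl
    | succ i => simp [put_cons_succ, ih]

theorem length_link (R : List (List ℕ)) (i j : ℕ) : (link R i j).length = R.length := by
  simp [link, length_put]

theorem mem_row_put {R : List (List ℕ)} {i j a b : ℕ} :
    b ∈ row (put R j i) a ↔ b ∈ row R a ∨ (a = i ∧ b = j ∧ i < R.length) := by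
  induction R generalizing i a with
  | nil => simp [put]
  | cons r R ih =>
    cases i <;> cases a <;> simp [put_cons_zero, put_cons_succ, ih]
    tauto

theorem mem_row_link {R : List (List ℕ)} {i j a b : ℕ} (hi : i < R.length) (hj : j < R.length) :
    b ∈ row (link R i j) a ↔ b ∈ row R a ∨ (a = i ∧ b = j) ∨ (a = j ∧ b = i) := by
  simp [link, mem_row_put, length_put, hi, hj, or_assoc]

theorem row_append (R : List (List ℕ)) (a : ℕ) : row (R ++ [[]]) a = row R a := by
  induction R generalizing a with
  | nil => cases a <;> rfl
  | cons r R ih => cases a <;> simp [ih]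

theorem forceRow_eq (r : List ℕ) (k : List ℕ → Bool) : forceRow r k = k r := by
  induction r generalizing k with
  | nil => rfl
  | cons a r ih => exact ih _

theorem force_eq (R : List (List ℕ)) (k : List (List ℕ) → Bool) : force R k = k R := by
  induction R generalizing k with
  | nil => rfl
  | cons a R ih => exact (forceRow_eq _ _).trans (ih _)

theorem mem_iff {u : ℕ} {l : List ℕ} : mem u l = true ↔ u ∈ l := by
  induction l with
  | nil => simp [mem]
  | cons a l ih =>
    have : mem u (a :: l) = bif Nat.beq u a then true else mem u l := rfl
    rw [this]
    cases h : Nat.beq u a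
    · have := Nat.ne_of_beq_eq_false h
      simp [ih, this]
    · simp [Nat.eq_of_beq_eq_true h]

theorem next_eq_true {done : Bool} {R : List (List ℕ)} {op : List ℕ}
    {cont : List ℕ → ℕ → List ℕ → Bool} (h : next done R op cont = true) :
    (op = [] ∧ done = true) ∨
      ∃ i op', op = i :: op' ∧ cont op' i (op'.filter fun j => !(mem j (row R i))) = true := by
  cases op with
  | nil => exact Or.inl ⟨rfl, h⟩
  | cons i op =>
    right
    refine ⟨i, op, rfl, ?_⟩
    exact (forceRow_eq _ fun js => cont op i js).symm.trans h

theorem exists_of_rec (g : ℕ → Bool) (r : List ℕ)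
    (h : List.rec (motive := fun _ => Bool) false (fun u _ ih => bif g u then true else ih) r =
      true) : ∃ u ∈ r, g u = true := by
  induction r with
  | nil => simp at h
  | cons u r ih =>
    cases hu : g u
    · simp only [hu, cond_false] at h
      obtain ⟨v, hv, hv'⟩ := ih h
      exact ⟨v, by simp [hv], hv'⟩
    · exact ⟨u, by simp, hu⟩

variable {V : Type*} {G : SimpleGraph V}

theorem pathTo_sound {R : List (List ℕ)} {s : ℕ} {f : ℕ → V}
    (hR : ∀ a, ∀ b ∈ row R a, G.Adj (f a) (f b)) {k : ℕ} {vis : List ℕ} {v l : ℕ}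
    (h : pathTo R s k vis v l = true) :
    ∃ P : List ℕ, P.Nodup ∧ (∀ a ∈ P, a ∉ vis ∧ a ≠ s ∧ ∃ b, a ∈ row R b) ∧
      Seg G (f v) (P.map f) (f s) ∧ (l + P.length) % 4 = 2 := by
  induction k generalizing vis v l with
  | zero => simp [pathTo] at h
  | succ k ih =>
    obtain ⟨u, hu, h⟩ := exists_of_rec _ (row R v) h
    cases hb : Nat.beq u s
    · rw [hb] at h
      cases hm : mem u vis
      · rw [hm] at h
        obtain ⟨P, hP, hP', hS, hl⟩ := ih h
        have hne := Nat.ne_of_beq_eq_false hb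
        refine ⟨u :: P, ?_, ?_, ?_, ?_⟩
        · refine List.nodup_cons.2 ⟨fun hu' => (hP' u hu').1 (by simp), hP⟩
        · intro a ha
          rcases List.mem_cons.1 ha with rfl | ha
          · exact ⟨fun h' => by simp [mem_iff.2 h'] at hm, hne, v, hu⟩
          · exact ⟨fun h' => (hP' a ha).1 (by simp [h']), (hP' a ha).2⟩
        · exact ⟨hR v u hu, hS⟩
        · simp only [List.length_cons]; omega
      · rw [hm] at h
        simp at h
    · rw [hb] at h
      obtain rfl := Nat.eq_of_beq_eq_true hb
      exact ⟨[], by simp, by simp, hR v u hu, Nat.eq_of_beq_eq_true h⟩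

end Search

variable {V : Type*} [Fintype V] [DecidableEq V] {G : SimpleGraph V} {W : Finset V}

/-- The labelled graph `R` on the labels below `m` sits in `G` via `f`; all neighbours of the
labels outside `op` are labelled, at least `3 - t` of these labels belong to `W`. -/
structure Emb (G : SimpleGraph V) (W : Finset V) (f : ℕ → V) (m : ℕ) (R : List (List ℕ))
    (op : List ℕ) (t : ℕ) : Prop where
  inj : ∀ a < m, ∀ b < m, f a = f b → a = b
  adj : ∀ a, ∀ b ∈ row R a, a < m ∧ b < m ∧ a ∈ row R b ∧ G.Adj (f a) (f b)
  len : R.length = m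
  nodup : op.Nodup
  lt : ∀ a ∈ op, a < m
  closed : ∀ a < m, a ∉ op → ∀ v, G.Adj (f a) v → ∃ b ∈ row R a, f b = v
  ws : ∃ T ⊆ W, 3 ≤ #T + t ∧ ∀ v ∈ T, ∃ a < m, a ∉ op ∧ f a = v

theorem Emb.link {f : ℕ → V} {m : ℕ} {R : List (List ℕ)} {op : List ℕ} {t i j : ℕ}
    (h : Emb G W f m R op t) (hi : i ∈ op) (hj : j ∈ op) (ha : G.Adj (f i) (f j)) :
    Emb G W f m (link R i j) op t where
  inj := h.inj
  adj a b hb := by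
    have hil := h.len ▸ h.lt i hi
    have hjl := h.len ▸ h.lt j hj
    rw [mem_row_link hil hjl] at hb
    rw [mem_row_link hil hjl]
    rcases hb with hb | ⟨rfl, rfl⟩ | ⟨rfl, rfl⟩
    · have := h.adj a b hb
      tauto
    · exact ⟨h.lt _ hi, h.lt _ hj, by simp, ha⟩
    · exact ⟨h.lt _ hj, h.lt _ hi, by simp, ha.symm⟩
  len := by rw [length_link, h.len]
  nodup := h.nodup
  lt := h.lt
  closed a ham ha v hv := by
    obtain ⟨b, hb, rfl⟩ := h.closed a ham ha v hv
    exact ⟨b, (mem_row_link (h.len ▸ h.lt i hi) (h.len ▸ h.lt j hj)).2 (Or.inl hb), rfl⟩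
  ws := h.ws

theorem search_sound (hC : Crit G W) (hn : 9 ≤ Fintype.card V) {k : ℕ} {fr : List ℕ} {m N : ℕ}
    (hN : Fintype.card V ≤ N) (hfr : fr = List.range' m (N - m))
    {R : List (List ℕ)} {op : List ℕ} {t i : ℕ} {js : List ℕ} {f : ℕ → V}
    (h : search k fr R op t i js = true) (hE : Emb G W f m R (i :: op) t) (hjs : ∀ j ∈ js, j ∈ op)
    (hcur : ∀ v, G.Adj (f i) v → (∃ b ∈ row R i, f b = v) ∨ (∃ b ∈ js, f b = v) ∨
      ∀ b < m, f b ≠ v) : False := by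
  induction k generalizing fr m R op t i js f with
  | zero => simp [search] at h
  | succ k ih =>
  cases js with
  | cons j js =>
    have e : search (k + 1) fr R op t i (j :: js) =
      (bif search k fr R op t i js then
          (bif pathTo R j 12 [i] i 0 then true
            else force (link R i j) fun R' => search k fr R' op t i js)
          else false) := rfl
    rw [e, force_eq] at h
    simp at h
    obtain ⟨h1, h2⟩ := h
    have hj : j ∈ op := hjs j (by simp)
    have hij : i ≠ j := by rintro rfl; exact (List.nodup_cons.1 hE.nodup).1 hj
    by_cases ha : G.Adj (f i) (f j)
    · rcases h2 with h2 | h2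
      · obtain ⟨P, hP, hP', hS, hl⟩ := pathTo_sound (G := G) (f := f)
          (fun a b hb => (hE.adj a b hb).2.2.2) h2
        refine hC.free (f i) ((P ++ [j]).map f) ?_ ?_ ?_
        · rw [List.map_append, List.map_singleton, seg_append]
          exact ⟨hS, ha.symm⟩
        · have hlt : ∀ a ∈ i :: (P ++ [j]), a < m := by
            intro a ha
            simp only [List.mem_cons, List.mem_append, List.not_mem_nil, or_false] at ha
            rcases ha with rfl | ha | rfl
            · exact hE.lt _ (by simp)
            · obtain ⟨b, hb⟩ := (hP' a ha).2.2
              exact (hE.adj b a hb).2.1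
            · exact hE.lt _ (by simp [hj])
          have hnd : (i :: (P ++ [j])).Nodup := by
            rw [List.nodup_cons, List.nodup_append]
            refine ⟨?_, hP, by simp, ?_⟩
            · simp only [List.mem_append, List.mem_singleton, not_or]
              exact ⟨fun hi => (hP' i hi).1 (by simp), hij⟩
            · rintro a ha b hb rfl
              exact (hP' a ha).2.1 (by simpa using hb)
          rw [← List.map_cons]
          exact hnd.map_on fun a ha b hb => hE.inj a (hlt a ha) b (hlt b hb)
        · simp; omega
      · refine ih hfr h2 (hE.link (by simp) (by simp [hj]) ha)
          (fun j hj => hjs j (by simp [hj])) ?_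
        intro v hv
        have hl := fun b => mem_row_link (a := i) (b := b) (hE.len ▸ hE.lt i (by simp))
          (hE.len ▸ hE.lt j (by simp [hj]))
        rcases hcur v hv with ⟨b, hb, rfl⟩ | ⟨b, hb, rfl⟩ | hb
        · exact Or.inl ⟨b, (hl b).2 (Or.inl hb), rfl⟩
        · rcases List.mem_cons.1 hb with rfl | hb
          · exact Or.inl ⟨b, (hl b).2 (by simp), rfl⟩
          · exact Or.inr (Or.inl ⟨b, hb, rfl⟩)
        · exact Or.inr (Or.inr hb)
    · refine ih hfr h1 hE (fun j hj => hjs j (by simp [hj])) ?_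
      intro v hv
      rcases hcur v hv with hb | ⟨b, hb, rfl⟩ | hb
      · exact Or.inl hb
      · rcases List.mem_cons.1 hb with rfl | hb
        · exact (ha hv).elim
        · exact Or.inr (Or.inl ⟨b, hb, rfl⟩)
      · exact Or.inr (Or.inr hb)
  | nil =>
    have e : search (k + 1) fr R op t i [] =
      (bif (List.rec true (fun _ r _ => List.rec true (fun _ r _ => List.rec
          (Nat.rec true (fun t _ => next (small fr) R op fun op i js => search k fr R op t i js) t)
          (fun _ _ _ => next (small fr) R op fun op i js => search k fr R op t i js) r) r)
          (row R i)) then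
        List.rec true (fun m fr _ =>
          force (link (R ++ [[]]) i m) fun R' => search k fr R' (m :: op) t i []) fr
      else false) := rfl
    rw [e] at h
    simp only [Bool.cond_false_right, Bool.and_eq_true] at h
    obtain ⟨h1, h2⟩ := h
    have him : i < m := hE.lt i (by simp)
    by_cases hall : ∀ v, G.Adj (f i) v → ∃ b ∈ row R i, f b = v
    · have close : ∀ t', Emb G W f m R op t' →
          next (small fr) R op (fun op i js => search k fr R op t' i js) = true → False := by
        intro t' hE' h
        rcases next_eq_true h with ⟨rfl, hs⟩ | ⟨i', op', rfl, hs⟩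
        · have hm : m ≤ 8 := by
            rw [hfr] at hs
            cases hk : N - m with
            | zero => simp [hk, small] at hs
            | succ q =>
              rw [hk, List.range'_succ] at hs
              exact Nat.le_of_ble_eq_true hs
          have hu := hC.closed_eq_univ ((range m).image f) ⟨f i, by simp; exact ⟨i, him, rfl⟩⟩ (by
            intro u hu v huv
            obtain ⟨a, ha, rfl⟩ := mem_image.1 hu
            obtain ⟨b, hb, rfl⟩ := hE'.closed a (by simpa using ha) (by simp) v huv
            exact mem_image_of_mem _ (by simpa using (hE'.adj a b hb).2.1))
          have := card_image_le (s := range m) (f := f)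
          rw [hu, card_univ, card_range] at this
          omega
        · refine ih hfr hs hE' (fun j hj => (List.mem_filter.1 hj).1) ?_
          intro v hv
          by_cases hl : ∃ b < m, f b = v
          · obtain ⟨b, hb, rfl⟩ := hl
            by_cases hbr : b ∈ row R i'
            · exact Or.inl ⟨b, hbr, rfl⟩
            · refine Or.inr (Or.inl ⟨b, List.mem_filter.2 ⟨?_, ?_⟩, rfl⟩)
              · by_contra hbo
                have hbi : b ≠ i' := by rintro rfl; exact hv.ne rfl
                obtain ⟨c, hc, hcv⟩ := hE'.closed b hb (by simp [hbo, hbi]) _ hv.symm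
                obtain rfl := hE'.inj c (hE'.adj b c hc).2.1 i' (hE'.lt i' (by simp)) hcv
                exact hbr (hE'.adj b c hc).2.2.1
              · simpa [← mem_iff] using hbr
          · exact Or.inr (Or.inr fun b hb hv => hl ⟨b, hb, hv⟩)
      have hEc : Emb G W f m R op t := by
        refine ⟨hE.inj, hE.adj, hE.len, (List.nodup_cons.1 hE.nodup).2,
          fun a ha => hE.lt a (by simp [ha]), ?_, ?_⟩
        · intro a ha hao v hv
          by_cases hai : a = i
          · subst hai; exact hall v hv
          · exact hE.closed a ha (by simp [hao, hai]) v hv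
        · obtain ⟨T, hT, hc, hT'⟩ := hE.ws
          refine ⟨T, hT, hc, fun v hv => ?_⟩
          obtain ⟨a, ha, hao, rfl⟩ := hT' v hv
          exact ⟨a, ha, fun h => hao (by simp [h]), rfl⟩
      have two : ∀ r : List ℕ, r = row R i → r.length < 2 → False := by
        intro r hr hlen
        obtain ⟨a, b, hab, -, -, ha, hb⟩ := hC.d2 (f i)
        obtain ⟨a', ha', rfl⟩ := hall a ha
        obtain ⟨b', hb', rfl⟩ := hall b hb
        rw [← hr] at ha' hb'
        match r, hlen with
        | [], _ => simp at ha'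
        | [c], _ => simp at ha' hb'; subst ha'; subst hb'; exact hab rfl
      match hr : row R i, h1 with
      | [], _ => exact two _ hr.symm (by simp)
      | [_], _ => exact two _ hr.symm (by simp)
      | _ :: _ :: _ :: _, h1 => exact close t hEc h1
      | [x, y], h1 =>
        have hiW : f i ∈ W := by
          by_contra hiW
          obtain ⟨a, b, c, hab, hac, hbc, -, -, -, ha, hb, hc⟩ := hC.d3 (f i) hiW
          obtain ⟨a', ha', rfl⟩ := hall a ha
          obtain ⟨b', hb', rfl⟩ := hall b hb
          obtain ⟨c', hc', rfl⟩ := hall c hc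
          rw [hr] at ha' hb' hc'
          simp at ha' hb' hc'
          grind
        obtain ⟨T, hT, hc, hT'⟩ := hE.ws
        have hiT : f i ∉ T := by
          intro hi
          obtain ⟨a, ha, hao, hfa⟩ := hT' _ hi
          obtain rfl := hE.inj a ha i him hfa
          simp at hao
        have hc' : #(insert (f i) T) = #T + 1 := card_insert_of_notMem hiT
        have hsub : insert (f i) T ⊆ W := insert_subset hiW hT
        have hle := (card_le_card hsub).trans hC.card_le
        cases t with
        | zero => omega
        | succ t =>
          refine close t ⟨hEc.inj, hEc.adj, hEc.len, hEc.nodup, hEc.lt, hEc.closed,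
            insert (f i) T, hsub, by omega, ?_⟩ h1
          intro v hv
          rcases mem_insert.1 hv with rfl | hv
          · exact ⟨i, him, (List.nodup_cons.1 hE.nodup).1, rfl⟩
          · obtain ⟨a, ha, hao, rfl⟩ := hT' v hv
            exact ⟨a, ha, fun h => hao (by simp [h]), rfl⟩
    · push Not at hall
      obtain ⟨v, hv, hv'⟩ := hall
      have hnew : ∀ b < m, f b ≠ v := by
        rcases hcur v hv with ⟨b, hb, rfl⟩ | ⟨b, hb, rfl⟩ | hb
        · exact (hv' b hb rfl).elim
        · simp at hb
        · exact hb
      have hmN : m < N := by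
        have h3 : #(insert v ((range m).image f)) ≤ Fintype.card V := card_le_univ _
        rw [card_insert_of_notMem (by simpa using hnew), card_image_of_injOn (by
          intro a ha b hb; exact hE.inj a (by simpa using ha) b (by simpa using hb)),
          card_range] at h3
        omega
      obtain ⟨q, hq⟩ : ∃ q, N - m = q + 1 := ⟨N - m - 1, by omega⟩
      rw [hfr, hq, List.range'_succ] at h2
      simp only [force_eq] at h2
      let f' : ℕ → V := fun a => if a = m then v else f a
      have hf' : ∀ a, a < m → f' a = f a := fun a ha => if_neg (by omega)
      have hfm : f' m = v := if_pos rfl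
      have hE1 : Emb G W f' (m + 1) (R ++ [[]]) (m :: i :: op) t := by
        refine ⟨?_, ?_, by simp [hE.len], ?_, ?_, ?_, ?_⟩
        · intro a ha b hb hab
          by_cases ham : a = m <;> by_cases hbm : b = m
          · omega
          · subst ham; rw [hfm, hf' b (by omega)] at hab; exact (hnew b (by omega) hab.symm).elim
          · subst hbm; rw [hfm, hf' a (by omega)] at hab; exact (hnew a (by omega) hab).elim
          · rw [hf' a (by omega), hf' b (by omega)] at hab
            exact hE.inj a (by omega) b (by omega) hab
        · intro a b hb
          rw [row_append] at hb ⊢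
          obtain ⟨h1, h2, h3, h4⟩ := hE.adj a b hb
          rw [hf' a h1, hf' b h2]
          exact ⟨by omega, by omega, h3, h4⟩
        · exact List.nodup_cons.2 ⟨fun h => absurd (hE.lt m h) (by omega), hE.nodup⟩
        · intro a ha
          rcases List.mem_cons.1 ha with rfl | ha
          · omega
          · have := hE.lt a ha; omega
        · intro a ha hao u hu
          simp only [List.mem_cons, not_or] at hao
          rw [hf' a (by omega)] at hu
          obtain ⟨b, hb, rfl⟩ := hE.closed a (by omega) (by simp [hao]) u hu
          exact ⟨b, by rwa [row_append], hf' b (hE.adj a b hb).2.1⟩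
        · obtain ⟨T, hT, hc, hT'⟩ := hE.ws
          refine ⟨T, hT, hc, fun v hv => ?_⟩
          obtain ⟨a, ha, hao, rfl⟩ := hT' v hv
          exact ⟨a, by omega, by simp only [List.mem_cons, not_or] at hao ⊢; exact ⟨by omega, hao⟩,
            hf' a ha⟩
      have hE2 := hE1.link (i := i) (j := m) (by simp) (by simp) (by rwa [hf' i him, hfm])
      have hE3 : Emb G W f' (m + 1) (CycleModFour.link (R ++ [[]]) i m) (i :: m :: op) t := by
        have hp : ∀ a, a ∈ i :: m :: op ↔ a ∈ m :: i :: op := fun a => by simp; tauto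
        refine ⟨hE2.inj, hE2.adj, hE2.len, (List.Perm.swap i m op).nodup hE2.nodup, ?_, ?_, ?_⟩
        · exact fun a ha => hE2.lt a ((hp a).1 ha)
        · exact fun a ha hao => hE2.closed a ha (fun h => hao ((hp a).2 h))
        · simpa only [hp] using hE2.ws
      refine ih (m := m + 1) (by rw [Nat.sub_add_eq, hq]; simp) h2 hE3 (by simp) ?_
      intro u hu
      rw [hf' i him] at hu
      have hl := fun b => mem_row_link (R := R ++ [[]]) (a := i) (i := i) (j := m) (b := b)
        (by simp [hE.len]; omega) (by simp [hE.len])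
      rcases hcur u hu with ⟨b, hb, rfl⟩ | ⟨b, hb, rfl⟩ | hb
      · refine Or.inl ⟨b, (hl b).2 (Or.inl (by rwa [row_append])), hf' b (hE.adj i b hb).2.1⟩
      · simp at hb
      · by_cases huv : u = v
        · exact Or.inl ⟨m, (hl m).2 (by simp), by rw [hfm, huv]⟩
        · refine Or.inr (Or.inr fun b hb' => ?_)
          by_cases hbm : b = m
          · rw [hbm, hfm]; exact Ne.symm huv
          · rw [hf' b (by omega)]; exact hb b (by omega)

end

section

variable {V : Type*} [Fintype V] [DecidableEq V] {G : SimpleGraph V} {W : Finset V}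

theorem length_ofEdges (m : ℕ) (E : List (ℕ × ℕ)) : (ofEdges m E).length = m := by
  induction E with
  | nil => simp [ofEdges]
  | cons e E ih => exact (length_link _ _ _).trans ih

theorem mem_row_ofEdges {m : ℕ} {E : List (ℕ × ℕ)} (hE : ∀ e ∈ E, e.1 < m ∧ e.2 < m) {a b : ℕ} :
    b ∈ row (ofEdges m E) a ↔ (a, b) ∈ E ∨ (b, a) ∈ E := by
  induction E with
  | nil =>
    suffices ∀ m a, row (List.replicate m []) a = [] by simp [ofEdges, this]
    intro m
    induction m with
    | zero => simp
    | succ m ih => rintro (_ | a) <;> simp [List.replicate_succ, ih]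
  | cons e E ih =>
    have e1 : ofEdges m (e :: E) = link (ofEdges m E) e.1 e.2 := rfl
    rw [e1, mem_row_link (by rw [length_ofEdges]; exact (hE e (by simp)).1)
      (by rw [length_ofEdges]; exact (hE e (by simp)).2), ih fun e he => hE e (by simp [he])]
    obtain ⟨c, d⟩ := e
    simp only [List.mem_cons, Prod.mk.injEq]
    tauto

/-- The vertices `vs` span the edges `E`; the labels in `cl` are listed with all their neighbours,
the labels in `tw` are vertices of degree two, and the labels in `op` may have further
neighbours. -/
theorem Crit.not_refute (hC : Crit G W) (hn : 9 ≤ Fintype.card V) {N : ℕ}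
    (hN : Fintype.card V ≤ N) (v₀ : V) (vs : List V) {m : ℕ} (hm : vs.length = m) {E : List (ℕ × ℕ)} {op : List ℕ}
    {cl : List (ℕ × List ℕ)} {tw : List ℕ}
    (hR : refute m (List.range' m (N - m)) E op (3 - tw.length) = true)
    (hd : (∀ e ∈ E, e.1 < m ∧ e.2 < m) ∧ op.Nodup ∧ tw.Nodup ∧
      (∀ a ∈ op, a < m) ∧ (∀ a ∈ List.range m, a ∈ op ∨ ∃ p ∈ cl, p.1 = a) ∧
      (∀ p ∈ cl, ∀ b ∈ p.2, (p.1, b) ∈ E ∨ (b, p.1) ∈ E) ∧ ∀ a ∈ tw, a ∉ op ∧ a < m)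
    (hvs : vs.Nodup) (hE : ∀ e ∈ E, G.Adj (vs.getD e.1 v₀) (vs.getD e.2 v₀))
    (hcl : ∀ p ∈ cl, ∀ v, G.Adj (vs.getD p.1 v₀) v → ∃ b ∈ p.2, v = vs.getD b v₀)
    (htw : ∀ a ∈ tw, vs.getD a v₀ ∈ W) : False := by
  subst hm
  obtain ⟨hlt, hop, htwn, hopl, hcov, hrow, htwl⟩ := hd
  have hinj : ∀ a < vs.length, ∀ b < vs.length, vs.getD a v₀ = vs.getD b v₀ → a = b := by
    intro a ha b hb hab
    rw [List.getD_eq_getElem _ _ ha, List.getD_eq_getElem _ _ hb] at hab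
    exact (hvs.getElem_inj_iff).1 hab
  have hEmb : Emb G W (fun a => vs.getD a v₀) vs.length (ofEdges vs.length E) op
      (3 - tw.length) := by
    refine ⟨hinj, ?_, length_ofEdges _ _, hop, hopl, ?_, ?_⟩
    · intro a b hb
      rw [mem_row_ofEdges hlt] at hb ⊢
      rcases hb with hb | hb
      · exact ⟨(hlt _ hb).1, (hlt _ hb).2, Or.inr hb, hE _ hb⟩
      · exact ⟨(hlt _ hb).2, (hlt _ hb).1, Or.inl hb, (hE _ hb).symm⟩
    · intro a ha hao v hv
      rcases hcov a (by simpa using ha) with h | ⟨p, hp, rfl⟩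
      · exact (hao h).elim
      · obtain ⟨b, hb, rfl⟩ := hcl p hp v hv
        exact ⟨b, (mem_row_ofEdges hlt).2 (hrow p hp b hb), rfl⟩
    · refine ⟨(tw.map fun a => vs.getD a v₀).toFinset, ?_, ?_, ?_⟩
      · intro v hv
        obtain ⟨a, ha, rfl⟩ := List.mem_map.1 (List.mem_toFinset.1 hv)
        exact htw a ha
      · rw [List.toFinset_card_of_nodup, List.length_map]
        · omega
        · exact htwn.map_on fun a ha b hb => hinj a (htwl a ha).2 b (htwl b hb).2
      · intro v hv
        obtain ⟨a, ha, rfl⟩ := List.mem_map.1 (List.mem_toFinset.1 hv)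
        exact ⟨a, (htwl a ha).2, (htwl a ha).1, rfl⟩
  rw [refute, force_eq] at hR
  rcases next_eq_true hR with ⟨-, h⟩ | ⟨i, op', rfl, hs⟩
  · simp at h
  refine search_sound hC hn hN rfl hs hEmb (fun j hj => (List.mem_filter.1 hj).1) ?_
  intro v hv
  by_cases hl : ∃ b < vs.length, vs.getD b v₀ = v
  · obtain ⟨b, hb, rfl⟩ := hl
    by_cases hbr : b ∈ row (ofEdges vs.length E) i
    · exact Or.inl ⟨b, hbr, rfl⟩
    · refine Or.inr (Or.inl ⟨b, List.mem_filter.2 ⟨?_, ?_⟩, rfl⟩)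
      · by_contra hbo
        have hbi : b ≠ i := by rintro rfl; exact hv.ne rfl
        obtain ⟨c, hc, hcv⟩ := hEmb.closed b hb (by simp [hbo, hbi]) _ hv.symm
        obtain rfl := hEmb.inj c (hEmb.adj b c hc).2.1 i (hEmb.lt i (by simp)) hcv
        exact hbr (hEmb.adj b c hc).2.2.1
      · simpa [← mem_iff] using hbr
  · exact Or.inr (Or.inr fun b hb hv => hl ⟨b, hb, hv⟩)

end

theorem refute_triangle : refute 7 (List.range' 7 (12 - 7))
    [(0, 1), (0, 2), (1, 2), (1, 3), (2, 4), (3, 5), (4, 5), (5, 6)] [6, 4, 3] 2 = true := by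
  decide +kernel

theorem refute_star : refute 7 (List.range' 7 (12 - 7))
    [(0, 1), (0, 2), (0, 3), (1, 4), (2, 5), (3, 6)] [6, 5, 4] 0 = true := by
  decide +kernel

theorem refute_path_common : refute 9 (List.range' 9 (12 - 9))
    [(0, 1), (1, 2), (2, 3), (3, 4), (2, 5), (0, 6), (4, 6), (0, 7), (4, 8)] [8, 7, 6, 5] 1
      = true := by
  decide +kernel

theorem refute_path_adj : refute 8 (List.range' 8 (12 - 8))
    [(0, 1), (1, 2), (2, 3), (3, 4), (2, 5), (0, 4), (0, 6), (4, 7)] [7, 6, 5] 1 = true := by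
  decide +kernel

theorem refute_hex : refute 10 (List.range' 10 (12 - 10))
    [(0, 1), (1, 2), (2, 3), (3, 4), (4, 5), (0, 5), (1, 6), (2, 7), (4, 8), (5, 9)] [9, 8, 7, 6] 1
      = true := by
  decide +kernel

theorem refute_hex_near : refute 9 (List.range' 9 (12 - 9))
    [(0, 1), (1, 2), (2, 3), (3, 4), (4, 5), (0, 5), (1, 6), (2, 6), (4, 7), (5, 8)] [8, 7, 6] 1
      = true := by
  decide +kernel

theorem refute_hex_far : refute 9 (List.range' 9 (12 - 9))
    [(0, 1), (1, 2), (2, 3), (3, 4), (4, 5), (0, 5), (1, 6), (2, 7), (4, 6), (5, 8)] [8, 7, 6] 1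
      = true := by
  decide +kernel

theorem refute_hex_near_near : refute 8 (List.range' 8 (12 - 8))
    [(0, 1), (1, 2), (2, 3), (3, 4), (4, 5), (0, 5), (1, 6), (2, 6), (4, 7), (5, 7)] [7, 6] 1
      = true := by
  decide +kernel

theorem refute_hex_far_far : refute 8 (List.range' 8 (12 - 8))
    [(0, 1), (1, 2), (2, 3), (3, 4), (4, 5), (0, 5), (1, 6), (2, 7), (4, 6), (5, 7)] [7, 6] 1
      = true := by
  decide +kernel

section

variable {V : Type*} [Fintype V] [DecidableEq V] {G : SimpleGraph V} {W : Finset V}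

/-- Exactly three neighbours. -/
def Cubic (G : SimpleGraph V) (v a b c : V) : Prop :=
  a ≠ b ∧ a ≠ c ∧ b ≠ c ∧ ∀ u, G.Adj v u ↔ u = a ∨ u = b ∨ u = c

theorem Crit.nbr_of_mem (h : Crit G W) {w x : V} (hw : w ∈ W) (hx : G.Adj w x) :
    ∃ y, y ≠ x ∧ ∀ u, G.Adj w u ↔ u = x ∨ u = y := by
  obtain ⟨a, b, hab, hN⟩ := h.wdeg w hw
  rcases (hN x).1 hx with rfl | rfl
  · exact ⟨b, hab.symm, hN⟩
  · exact ⟨a, hab, fun u => by rw [hN]; tauto⟩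

theorem Crit.adj_iff (h : Crit G W) {w x y : V} (hw : w ∈ W) (hx : G.Adj w x) (hy : G.Adj w y)
    (hxy : x ≠ y) : ∀ u, G.Adj w u ↔ u = x ∨ u = y := by
  obtain ⟨z, -, hN⟩ := h.nbr_of_mem hw hx
  obtain rfl : y = z := ((hN y).1 hy).resolve_left hxy.symm
  exact hN

theorem Crit.two_more (h : Crit G W) {v : V} (hv : v ∉ W) (r : V) :
    ∃ a b, a ≠ b ∧ a ≠ r ∧ b ≠ r ∧ G.Adj v a ∧ G.Adj v b := by
  obtain ⟨a, b, hab, ha, hb, h1, h2⟩ := (h.d3 v hv).erase (H := G) (T := univ.erase r) r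
    fun u _ hu hr => ⟨hu, by simp [hr]⟩
  exact ⟨a, b, hab, (mem_erase.1 ha).1, (mem_erase.1 hb).1, h1, h2⟩

theorem Crit.one_more (h : Crit G W) (v r : V) : ∃ a, a ≠ r ∧ G.Adj v a := by
  obtain ⟨a, b, hab, -, -, h1, h2⟩ := h.d2 v
  by_cases har : a = r
  · exact ⟨b, fun hb => hab (har.trans hb.symm), h2⟩
  · exact ⟨a, har, h1⟩

theorem Crit.cubic_or (h : Crit G W) {v : V} (hv : v ∉ W) :
    (∃ a b c, Cubic G v a b c) ∨ ∀ r, D3 G (univ.erase r) v := by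
  obtain ⟨a, b, c, hab, hac, hbc, -, -, -, h1, h2, h3⟩ := h.d3 v hv
  by_cases hd : ∃ d, G.Adj v d ∧ d ≠ a ∧ d ≠ b ∧ d ≠ c
  · right
    obtain ⟨d, h4, hda, hdb, hdc⟩ := hd
    intro r
    by_cases har : a = r
    · exact ⟨b, c, d, by grind⟩
    by_cases hbr : b = r
    · exact ⟨a, c, d, by grind⟩
    by_cases hcr : c = r
    · exact ⟨a, b, d, by grind⟩
    · exact ⟨a, b, c, by grind⟩
  · left
    push Not at hd
    refine ⟨a, b, c, hab, hac, hbc, fun u => ⟨fun hu => ?_, ?_⟩⟩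
    · by_contra hne
      grind
    · rintro (rfl | rfl | rfl) <;> assumption

theorem Cubic.adj {v a b c : V} (h : Cubic G v a b c) : G.Adj v a ∧ G.Adj v b ∧ G.Adj v c :=
  ⟨(h.2.2.2 a).2 (by simp), (h.2.2.2 b).2 (by simp), (h.2.2.2 c).2 (by simp)⟩

theorem Cubic.exists_of_adj {v a b c x : V} (h : Cubic G v a b c) (hx : G.Adj v x) :
    ∃ p q, Cubic G v x p q := by
  obtain ⟨hab, hac, hbc, hN⟩ := h
  rcases (hN x).1 hx with rfl | rfl | rfl
  · exact ⟨b, c, hab, hac, hbc, hN⟩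
  · exact ⟨a, c, hab.symm, hbc, hac, fun u => by rw [hN]; tauto⟩
  · exact ⟨a, b, hac.symm, hbc.symm, hab, fun u => by rw [hN]; tauto⟩

theorem Cubic.swap {v a b c : V} (h : Cubic G v a b c) : Cubic G v a c b :=
  ⟨h.2.1, h.1, h.2.2.1.symm, fun u => by rw [h.2.2.2]; tauto⟩

theorem Cubic.rotate {v a b c : V} (h : Cubic G v a b c) : Cubic G v b c a :=
  ⟨h.2.2.1, h.1.symm, h.2.1.symm, fun u => by rw [h.2.2.2]; tauto⟩

theorem Crit.cubic_of_not_d3 (h : Crit G W) {v x : V} (hv : v ∉ W) (hx : G.Adj v x)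
    (hD : ¬ D3 G (univ.erase x) v) : ∃ p q, Cubic G v x p q := by
  rcases h.cubic_or hv with ⟨a, b, c, h⟩ | h
  · exact h.exists_of_adj hx
  · exact (hD (h x)).elim

/-- The vertices of degree two are independent. -/
theorem Crit.not_adj (h : Crit G W) {w w' : V} (hw : w ∈ W) (hw' : w' ∈ W) : ¬ G.Adj w w' := by
  intro hww
  obtain ⟨x, hxw', hNw⟩ := h.nbr_of_mem hw hww
  obtain ⟨y, hyw, hNw'⟩ := h.nbr_of_mem hw' hww.symm
  have hax : G.Adj w x := (hNw x).2 (by simp)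
  have hay : G.Adj w' y := (hNw' y).2 (by simp)
  have three : ∀ {w w' x y : V}, w ∈ W → w' ∈ W → G.Adj w w' → x ≠ w' → y ≠ w →
      (∀ u, G.Adj w u ↔ u = w' ∨ u = x) → (∀ u, G.Adj w' u ↔ u = w ∨ u = y) → x ∉ W := by
    intro w w' x y hw hw' hww hxw' hyw hNw hNw' hx
    have hax : G.Adj w x := (hNw x).2 (by simp)
    have hay : G.Adj w' y := (hNw' y).2 (by simp)
    obtain ⟨p, hpw, hNx⟩ := h.nbr_of_mem hx hax.symm
    have hap : G.Adj x p := (hNx p).2 (by simp)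
    have hWeq : {w, w', x} = W := eq_of_subset_of_card_le (by grind) (by
      rw [card_eq_three.2 ⟨w, w', x, hww.ne, hax.ne, hxw'.symm, rfl⟩]; exact h.card_le)
    have h9 : 9 ≤ Fintype.card V := by
      have := h.big
      rw [← hWeq, card_eq_three.2 ⟨w, w', x, hww.ne, hax.ne, hxw'.symm, rfl⟩] at this
      omega
    by_cases hpw' : p = w'
    · have := h.closed_eq_univ {w, w', x} (by simp) (by
        have := (hNw' x).1 (hpw' ▸ hap.symm)
        have := hax.ne
        intro u hu v huv
        simp only [mem_insert, mem_singleton] at hu ⊢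
        rcases hu with rfl | rfl | rfl
        · have := (hNw v).1 huv; tauto
        · have := (hNw' v).1 huv; grind
        · have := (hNx v).1 huv; grind)
      have hc := card_le_three (a := w) (b := w') (c := x)
      rw [this, card_univ] at hc
      omega
    have hyx : y ≠ x := by
      rintro rfl
      have := (hNx w').1 hay.symm
      have := hww.ne
      grind
    have hpy : p ≠ y := by
      rintro rfl
      exact h.free.no_square hww hay hap.symm hax.symm hpw.symm hxw'.symm
    refine h.delete {w, w', x}ᶜ {p, y} ?_ ⟨p, by have := hap.ne; simp; grind⟩ ?_ ?_ ?_ ?_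
    · intro hu
      have := mem_univ w
      rw [← hu] at this
      simp at this
    · intro v hv
      have hvW : v ∉ W := by rw [← hWeq]; simpa using hv
      by_cases hvp : v = p
      · subst hvp
        refine (h.d3 v hvW).erase x fun u _ hu hux => ⟨hu, ?_⟩
        have := hNw v; have := hNw' v
        have := hu.symm
        have := hap.ne
        simp
        grind
      · refine (h.d3 v hvW).erase w' fun u _ hu hux => ⟨hu, ?_⟩
        have := hNx v; have := hNw v; have := hu.symm
        simp at hv ⊢
        grind
    · intro v hv hv'
      have hvW : v ∉ W := by rw [← hWeq]; simpa using hv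
      refine (h.d3 v hvW).mono fun u _ hu => ⟨hu, ?_⟩
      have := hNx v; have := hNw v; have := hNw' v; have := hu.symm
      simp at hv hv' ⊢
      grind
    · grind [card_le_two]
    · grind [card_le_two]
  have hxW := three hw hw' hww hxw' hyw hNw hNw'
  have hyW := three hw' hw hww.symm hyw hxw' hNw' hNw
  by_cases hxy : x = y
  · subst hxy
    obtain ⟨a, b, hab, haw, hbw, ha, hb⟩ := h.two_more hxW w
    have hO : ({w, w', x} : Finset V)ᶜ.Nonempty := by
      by_cases haw' : a = w'
      · exact ⟨b, by have := hb.ne; simp; grind⟩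
      · exact ⟨a, by have := ha.ne; simp; grind⟩
    refine h.sep1 {w, w', x}ᶜ x (by simp) hO ⟨w, by simp, hax.ne⟩ ?_ ?_
    · intro u hu v hv
      have := hNw u; have := hNw' u; have := hv.symm
      simp at hu ⊢
      grind
    · have h1 : {w, w', x}ᶜ ∩ W ⊆ (W.erase w).erase w' := by intro v hv; simp at hv ⊢; grind
      have := card_le_card h1
      have := h.card_le
      have := hww.ne
      grind
  · have hxy' : ¬ G.Adj x y := fun ha =>
      h.free.no_square hww hay ha.symm hax.symm hyw.symm hxw'.symm
    have hc : #(insert x (insert y ((W.erase w).erase w'))) ≤ #W := by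
      have := card_insert_le x (insert y ((W.erase w).erase w'))
      have := card_insert_le y ((W.erase w).erase w')
      have := hww.ne
      grind
    have hS : ({w, w'} : Finset V)ᶜ ≠ univ := by
      intro hu
      have := mem_univ w
      rw [← hu] at this
      simp at this
    have hS' : ({w, w'} : Finset V)ᶜ.Nonempty := ⟨x, by have := hax.ne; simp; grind⟩
    have hcS : #({w, w'} : Finset V)ᶜ = Fintype.card V - 2 := by
      rw [card_compl, card_eq_two.2 ⟨w, w', hww.ne, rfl⟩]
    have hD2 : ∀ v ∈ ({w, w'} : Finset V)ᶜ, D2 G ({w, w'} : Finset V)ᶜ v := by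
      intro v hv
      by_cases hvx : v = x
      · subst hvx
        refine (h.d3 v hxW).erase w fun u _ hu huw => ⟨hu, ?_⟩
        have := hNw' v; have := hu.symm
        simp at hv ⊢
        grind
      by_cases hvy : v = y
      · subst hvy
        refine (h.d3 v hyW).erase w' fun u _ hu huw => ⟨hu, ?_⟩
        have := hNw v; have := hu.symm
        simp at hv ⊢
        grind
      · refine (h.d2 v).mono fun u _ hu => ⟨hu, ?_⟩
        have := hNw v; have := hNw' v; have := hu.symm
        simp at hv ⊢
        grind
    have hD3 : ∀ v ∈ ({w, w'} : Finset V)ᶜ, v ∉ W → v ≠ x → v ≠ y →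
        D3 G ({w, w'} : Finset V)ᶜ v := by
      intro v hv hvW hvx hvy
      refine (h.d3 v hvW).mono fun u _ hu => ⟨hu, ?_⟩
      have := hNw v; have := hNw' v; have := hu.symm
      simp at hv ⊢
      grind
    have hc3 := h.card_le
    have hbig : 9 ≤ Fintype.card V ∧ Fintype.card V ≤ 10 := by
      by_contra hcon
      refine h.delete _ (insert x (insert y ((W.erase w).erase w'))) hS hS' hD2 ?_ (by omega) ?_
      · intro v hv hv'
        refine hD3 v hv ?_ ?_ ?_ <;> simp at hv hv' ⊢ <;> grind
      · have := h.big
        omega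
    have side : ∀ {x y w w'}, x ∉ W → G.Adj x w → ¬ G.Adj x w' → 
        #(insert y ((W.erase w).erase w')) ≤ 2 → 
        (∀ v ∈ ({w, w'} : Finset V)ᶜ, D2 G ({w, w'} : Finset V)ᶜ v) →
        (∀ v ∈ ({w, w'} : Finset V)ᶜ, v ∉ W → v ≠ x → v ≠ y → D3 G ({w, w'} : Finset V)ᶜ v) →
        ({w, w'} : Finset V)ᶜ ≠ univ → ({w, w'} : Finset V)ᶜ.Nonempty → 
        ∃ p q, Cubic G x w p q := by
      intro x y w w' hxW hax hxw' hc hD2 hD3 hS hS'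
      refine h.cubic_of_not_d3 hxW hax fun hD => ?_
      refine h.delete _ (insert y ((W.erase w).erase w')) hS hS' hD2 ?_ (by omega) (by omega)
      intro v hv hv'
      by_cases hvx : v = x
      · subst hvx
        refine hD.mono fun u hu ha => ⟨ha, ?_⟩
        simp at hu ⊢
        exact ⟨hu, by rintro rfl; exact hxw' ha⟩
      · refine hD3 v hv ?_ hvx ?_ <;> simp at hv hv' ⊢ <;> grind
    obtain ⟨p, q, hCx⟩ := side hxW hax.symm
      (fun ha => by have := (hNw' x).1 ha.symm; have := hax.ne; grind) (by
        have := card_insert_le y ((W.erase w).erase w')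
        have := hww.ne
        grind) hD2 hD3 hS hS'
    obtain ⟨r, s, hCy⟩ := side (y := x) hyW hay.symm
      (fun ha => by have := (hNw y).1 ha.symm; have := hay.ne; grind) (by
        have := card_insert_le x ((W.erase w').erase w)
        have := hww.ne
        grind) (by rwa [pair_comm]) (by rw [pair_comm]; intros; apply hD3 <;> assumption)
        (by rwa [pair_comm]) (by rwa [pair_comm])
    have final : ∀ p q r s, Cubic G x w p q → Cubic G y w' r s → r ≠ p → r ≠ q → s ≠ p → False := by
      intro p q r s hCx hCy hrp hrq hsp
      have hp := hCx.adj
      have hr := hCy.adj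
      have hclx := hCx.2.2.2
      have hcly := hCy.2.2.2
      have hirr : ∀ a b, G.Adj a b → a ≠ b := fun a b hab => hab.ne
      have hsymm : ∀ a b, G.Adj a b → G.Adj b a := fun a b hab => hab.symm
      obtain ⟨d1, d2, d3, -⟩ := hCx
      obtain ⟨e1, e2, e3, -⟩ := hCy
      by_cases hsq : s = q
      · subst hsq
        refine h.not_refute hbig.1 hbig.2 x [x, w, w', y, s, p, r] (m := 7) rfl
          (E := [(0, 1), (1, 2), (2, 3), (0, 4), (0, 5), (3, 6), (3, 4)]) (op := [6, 5, 4])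
          (cl := [(0, [1, 5, 4]), (1, [0, 2]), (2, [1, 3]), (3, [2, 6, 4])]) (tw := [1, 2])
          (by decide +kernel) (by decide +kernel) ?_ ?_ ?_ ?_
        · simp; grind
        · simp [*]
        · simp [*]
        · simp [*]
      · refine h.not_refute hbig.1 hbig.2 x [x, w, w', y, p, q, r, s] (m := 8) rfl
          (E := [(0, 1), (1, 2), (2, 3), (0, 4), (0, 5), (3, 6), (3, 7)]) (op := [7, 6, 5, 4])
          (cl := [(0, [1, 4, 5]), (1, [0, 2]), (2, [1, 3]), (3, [2, 6, 7])]) (tw := [1, 2])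
          (by decide +kernel) (by decide +kernel) ?_ ?_ ?_ ?_
        · simp; grind
        · simp [*]
        · simp [*]
        · simp [*]
    have hsq : ∀ c d, c ≠ d → G.Adj x c → G.Adj x d → G.Adj y c → G.Adj y d → False :=
      fun c d hcd h1 h2 h3 h4 => h.free.no_square h1.symm h2 h4.symm h3 hcd hxy
    obtain ⟨-, hxp, hxq⟩ := hCx.adj
    obtain ⟨-, hyr, hys⟩ := hCy.adj
    obtain ⟨d1, d2, d3, -⟩ := id hCx
    obtain ⟨e1, e2, e3, -⟩ := id hCy
    by_cases h1 : r = p ∨ r = q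
    · by_cases h2 : r = p
      · exact final q p s r hCx.swap hCy.swap (by grind) (by grind) (by grind)
      · exact final p q s r hCx hCy.swap (by grind) (by grind) (by grind)
    · by_cases h2 : s = p
      · exact final q p r s hCx.swap hCy (by grind) (by grind) (by grind)
      · exact final p q r s hCx hCy (by grind) (by grind) (by grind)

end

section

variable {V : Type*} [Fintype V] [DecidableEq V] {G : SimpleGraph V} {W : Finset V}

/-- Neighbours of vertices of degree two are cubic. -/
theorem Crit.cubic_of_adj_mem (h : Crit G W) {w x : V} (hw : w ∈ W) (hax : G.Adj w x) :
    ∃ p q, Cubic G x w p q := by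
  obtain ⟨y, hyx, hNw⟩ := h.nbr_of_mem hw hax
  have hay : G.Adj w y := (hNw y).2 (by simp)
  have hxW : x ∉ W := fun hx => h.not_adj hw hx hax
  have hyW : y ∉ W := fun hy => h.not_adj hw hy hay
  refine h.cubic_of_not_d3 hxW hax.symm fun hD => ?_
  have hS : (univ.erase w : Finset V) ≠ univ := fun hu => by
    have := mem_univ w; rw [← hu] at this; simp at this
  have hS' : (univ.erase w : Finset V).Nonempty := ⟨x, by simpa using hax.ne.symm⟩
  have hcS : #(univ.erase w : Finset V) = Fintype.card V - 1 := by
    rw [card_erase_of_mem (mem_univ w), card_univ]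
  have hcW : #(W.erase w) = #W - 1 := card_erase_of_mem hw
  have hWpos := card_pos.2 ⟨w, hw⟩
  have hc3 := h.card_le
  have hD2 : ∀ v ∈ (univ.erase w : Finset V), D2 G (univ.erase w) v := by
    intro v hv
    by_cases hvx : v = x
    · exact hvx ▸ hD.d2
    by_cases hvy : v = y
    · exact hvy ▸ (h.d3 y hyW).erase w fun u _ hu hr => ⟨hu, by simpa using hr⟩
    · refine (h.d2 v).mono fun u _ hu => ⟨hu, ?_⟩
      have := (hNw v).not.2 (by tauto)
      simp only [mem_erase, mem_univ, and_true]
      rintro rfl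
      exact this hu.symm
  have hD3 : ∀ v ∈ (univ.erase w : Finset V), v ∉ W.erase w → v ≠ y → D3 G (univ.erase w) v := by
    intro v hv hvW hvy
    by_cases hvx : v = x
    · exact hvx ▸ hD
    · refine (h.d3 v (by simp at hv hvW; tauto)).mono fun u _ hu => ⟨hu, ?_⟩
      have := (hNw v).not.2 (by tauto)
      simp only [mem_erase, mem_univ, and_true]
      rintro rfl
      exact this hu.symm
  have hbig : 9 ≤ Fintype.card V ∧ Fintype.card V ≤ 9 := by
    by_contra hcon
    have := card_insert_le y (W.erase w)
    refine h.delete _ (insert y (W.erase w)) hS hS' hD2 ?_ (by omega) ?_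
    · intro v hv hv'
      exact hD3 v hv (by simp at hv' ⊢; tauto) (by simp at hv'; tauto)
    · have := h.big
      omega
  obtain ⟨r, s, hCy⟩ := h.cubic_of_not_d3 hyW hay.symm fun hDy => by
    refine h.delete _ (W.erase w) hS hS' hD2 ?_ (by omega) (by omega)
    intro v hv hv'
    by_cases hvy : v = y
    · exact hvy ▸ hDy
    · exact hD3 v hv hv' hvy
  have hcl : ∀ u, u ≠ w → G.Adj x u → ¬ G.Adj y u := fun u huw h1 h2 =>
    h.free.no_square hax h1 h2.symm hay.symm huw.symm hyx.symm
  obtain ⟨a, b, c, hab, hac, hbc, ha, hb, hc, h1, h2, h3⟩ := hD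
  have hirr : ∀ a b, G.Adj a b → a ≠ b := fun a b hab => hab.ne
  have hadj : ∀ a b, a ≠ b → a ≠ w → b ≠ w → G.Adj x y → G.Adj x a → G.Adj x b → a ≠ y →
      b ≠ y → False := by
    intro a b hab haw hbw hxy ha hb hay' hby
    obtain ⟨s, hCy⟩ : ∃ s, Cubic G y w x s := by
      obtain ⟨p, q, hC⟩ := hCy.exists_of_adj hxy.symm
      have hwy := (hC.2.2.2 w).1 hay.symm
      rcases hwy with rfl | rfl | rfl
      · exact absurd rfl hax.ne
      · exact ⟨q, hC.rotate.swap⟩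
      · exact ⟨p, hC.rotate.rotate⟩
    have hclw := hNw
    have hcly := hCy.2.2.2
    have hys := hCy.adj.2.2
    obtain ⟨d1, d2, d3, -⟩ := hCy
    have := hcl a haw ha; have := hcl b hbw hb
    refine h.not_refute hbig.1 hbig.2 x [w, x, y, a, b, s] (m := 6) rfl
      (E := [(0, 1), (0, 2), (1, 2), (1, 3), (1, 4), (2, 5)]) (op := [5, 4, 3, 1])
      (cl := [(0, [1, 2]), (2, [0, 1, 5])]) (tw := [0])
      (by decide +kernel) (by decide +kernel) ?_ ?_ ?_ ?_
    · simp; grind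
    · simp [*]
    · simp [*]
    · simp [*]
  simp only [mem_erase, mem_univ, and_true] at ha hb hc
  by_cases hay' : a = y
  · exact hadj b c hbc hb hc (hay' ▸ h1) h2 h3 (by grind) (by grind)
  by_cases hby' : b = y
  · exact hadj a c hac ha hc (hby' ▸ h2) h1 h3 (by grind) (by grind)
  by_cases hcy' : c = y
  · exact hadj a b hab ha hb (hcy' ▸ h3) h1 h2 (by grind) (by grind)
  by_cases hxy : G.Adj x y
  · exact hadj a b hab ha hb hxy h1 h2 hay' hby'
  have hyx' : ¬ G.Adj y x := fun ha => hxy ha.symm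
  have hcly := hCy.2.2.2
  have hys := hCy.adj
  obtain ⟨d1, d2, d3, -⟩ := hCy
  have := hcl a ha h1; have := hcl b hb h2; have := hcl c hc h3
  refine h.not_refute hbig.1 hbig.2 x [w, x, y, a, b, c, r, s] (m := 8) rfl
    (E := [(0, 1), (0, 2), (1, 3), (1, 4), (1, 5), (2, 6), (2, 7)]) (op := [7, 6, 5, 4, 3, 1])
    (cl := [(0, [1, 2]), (2, [0, 6, 7])]) (tw := [0])
    (by decide +kernel) (by decide +kernel) ?_ ?_ ?_ ?_
  · simp; grind
  · simp [*]
  · simp [*]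
  · simp [*]

end

section

variable {V : Type*} {G : SimpleGraph V}

theorem Seg.exists_rotate {x a : V} {L : List V} (h : Seg G x L x) (hn : (x :: L).Nodup)
    (ha : a ∈ x :: L) : ∃ L', Seg G a L' a ∧ (a :: L').Perm (x :: L) ∧ L'.length = L.length := by
  rcases List.mem_cons.1 ha with rfl | ha
  · exact ⟨L, h, .refl _, rfl⟩
  obtain ⟨P, Q, rfl⟩ := List.append_of_mem ha
  rw [seg_append] at h
  refine ⟨Q ++ x :: P, by simp [h], ?_, by simp; omega⟩
  rw [← List.cons_append, ← List.cons_append]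
  exact List.perm_append_comm

/-- The graph `G` with `b` merged into `a`. -/
def ident (G : SimpleGraph V) (a b : V) : SimpleGraph V where
  Adj u v := u ≠ v ∧ (G.Adj u v ∨ (u = a ∧ G.Adj b v) ∨ (v = a ∧ G.Adj u b))
  symm := ⟨fun u v => by
    rintro ⟨h, h1 | h1 | h1⟩
    · exact ⟨h.symm, .inl h1.symm⟩
    · exact ⟨h.symm, .inr (.inr ⟨h1.1, h1.2.symm⟩)⟩
    · exact ⟨h.symm, .inr (.inl ⟨h1.1, h1.2.symm⟩)⟩⟩
  loopless := ⟨fun u h => h.1 rfl⟩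

theorem Free.exists_path_of_ident (hf : Free G) {a b : V} {S : Finset V} (hb : b ∉ S)
    (hc : HasCycleIn (ident G a b) S) :
    ∃ l, Seg G a l b ∧ (a :: (l ++ [b])).Nodup ∧ l.length % 4 = 3 ∧ ∀ y ∈ l, y ∈ S ∧ y ≠ a := by
  obtain ⟨x, L, hL, hn, hlen, hS⟩ := hc
  by_cases ha : a ∈ x :: L
  · obtain ⟨L', hL', hp, hl⟩ := hL.exists_rotate hn ha
    rw [← hl] at hlen
    replace hS : ∀ y ∈ a :: L', y ∈ S := fun y hy => hS y (hp.subset hy)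
    replace hn := hp.nodup_iff.2 hn
    have hnb : (b :: L').Nodup :=
      List.nodup_cons.2 ⟨fun hbL => hb (hS b (by simp [hbL])), (List.nodup_cons.1 hn).2⟩
    have hab : a ≠ b := fun hab => hb (hab ▸ hS a (by simp))
    have hnab : (a :: (L' ++ [b])).Nodup := by
      rw [List.nodup_cons] at hn hnb ⊢
      refine ⟨by simp [hn.1, hab], ?_⟩
      rw [List.nodup_append]
      exact ⟨hn.2, by simp, by simp; rintro c hc rfl; exact hnb.1 hc⟩
    have hyS : ∀ y ∈ L', y ∈ S ∧ y ≠ a := fun y hy =>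
      ⟨hS y (by simp [hy]), by rintro rfl; exact (List.nodup_cons.1 hn).1 hy⟩
    rcases L' with _ | ⟨u, M⟩
    · simp at hlen
    rcases List.eq_nil_or_concat M with rfl | ⟨M, v, rfl⟩
    · simp at hlen
    rw [List.concat_eq_append] at *
    rw [seg_cons, seg_append, seg_nil] at hL'
    obtain ⟨h1, h2, h3⟩ := hL'
    have h2 : Seg G u M v := by
      refine h2.imp fun p hp q hq h => ?_
      have := (hyS p (by simpa using hp)).2
      have := (hyS q (by simpa using hq)).2
      exact h.2.resolve_right (by tauto)
    have h1 : G.Adj a u ∨ G.Adj b u := by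
      have := (hyS u (by simp)).2
      rcases h1.2 with h | h | h <;> tauto
    have h3 : G.Adj v a ∨ G.Adj v b := by
      have := (hyS v (by simp)).2
      rcases h3.2 with h | h | h <;> tauto
    rcases h1 with h1 | h1 <;> rcases h3 with h3 | h3
    · exact (hf a _ (by simp [h1, h2, h3]) hn hlen).elim
    · exact ⟨_, by simp [h1, h2, h3], hnab, hlen, hyS⟩
    · refine ⟨(u :: (M ++ [v])).reverse, ?_, ?_, by simpa using hlen,
        fun y hy => hyS y (List.mem_reverse.1 hy)⟩
      · rw [seg_reverse]; simp [h1, h2, h3]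
      · refine List.Perm.nodup_iff ?_ |>.2 hnab
        exact .cons _ (.append_right _ (List.reverse_perm _))
    · exact (hf b _ (by simp [h1, h2, h3]) hnb hlen).elim
  · refine (hf x L (hL.imp fun u hu v hv h => ?_) hn hlen).elim
    have hu : u ≠ a := by rintro rfl; simp at hu ha; tauto
    have hv : v ≠ a := by rintro rfl; simp at hv ha; tauto
    exact h.2.resolve_right (by tauto)

section

variable {a b v : V} {S : Finset V}

theorem ident_adj (h : G.Adj a v) : (ident G a b).Adj a v := ⟨h.ne, .inl h⟩

theorem ident_adj' (h : G.Adj b v) (hv : v ≠ a) : (ident G a b).Adj a v :=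
  ⟨hv.symm, .inr (.inl ⟨rfl, h⟩)⟩

theorem D2.map {H : SimpleGraph V} {T : Finset V} (f : V → V) (h : D2 G S v)
    (hf : ∀ u ∈ S, G.Adj v u → H.Adj v (f u) ∧ f u ∈ T)
    (hi : ∀ u u', G.Adj v u → G.Adj v u' → f u = f u' → u = u') : D2 H T v := by
  obtain ⟨a, b, hab, ha, hb, h1, h2⟩ := h
  exact ⟨f a, f b, fun h => hab (hi _ _ h1 h2 h), (hf a ha h1).2, (hf b hb h2).2,
    (hf a ha h1).1, (hf b hb h2).1⟩

theorem D3.map {H : SimpleGraph V} {T : Finset V} (f : V → V) (h : D3 G S v)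
    (hf : ∀ u ∈ S, G.Adj v u → H.Adj v (f u) ∧ f u ∈ T)
    (hi : ∀ u u', G.Adj v u → G.Adj v u' → f u = f u' → u = u') : D3 H T v := by
  obtain ⟨a, b, c, hab, hac, hbc, ha, hb, hc, h1, h2, h3⟩ := h
  exact ⟨f a, f b, f c, fun h => hab (hi _ _ h1 h2 h), fun h => hac (hi _ _ h1 h3 h),
    fun h => hbc (hi _ _ h2 h3 h), (hf a ha h1).2, (hf b hb h2).2, (hf c hc h3).2,
    (hf a ha h1).1, (hf b hb h2).1, (hf c hc h3).1⟩

theorem merge_mem [DecidableEq V] (ha : a ∈ S) (hva : v ≠ a)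
    (hN : ∀ u, G.Adj v u → u ∈ S ∨ u = b) (u : V) (hu : G.Adj v u) :
    (ident G a b).Adj v (if u = b then a else u) ∧ (if u = b then a else u) ∈ S := by
  split_ifs with h
  · exact ⟨⟨hva, .inr (.inr ⟨rfl, h ▸ hu⟩)⟩, ha⟩
  · exact ⟨⟨hu.ne, .inl hu⟩, (hN u hu).resolve_right h⟩

theorem merge_inj [DecidableEq V] (hab : ¬ (G.Adj v a ∧ G.Adj v b)) (u u' : V) (hu : G.Adj v u)
    (hu' : G.Adj v u') (h : (if u = b then a else u) = if u' = b then a else u') : u = u' := by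
  split_ifs at h <;> subst_vars <;> tauto

theorem D2.ident [DecidableEq V] [Fintype V] (h : D2 G univ v) (ha : a ∈ S) (hva : v ≠ a)
    (hN : ∀ u, G.Adj v u → u ∈ S ∨ u = b) (hab : ¬ (G.Adj v a ∧ G.Adj v b)) :
    D2 (ident G a b) S v :=
  h.map _ (fun u _ => merge_mem ha hva hN u) (merge_inj hab)

theorem D3.ident [DecidableEq V] [Fintype V] (h : D3 G univ v) (ha : a ∈ S) (hva : v ≠ a)
    (hN : ∀ u, G.Adj v u → u ∈ S ∨ u = b) (hab : ¬ (G.Adj v a ∧ G.Adj v b)) :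
    D3 (ident G a b) S v :=
  h.map _ (fun u _ => merge_mem ha hva hN u) (merge_inj hab)

theorem D3.ident_d2 [DecidableEq V] [Fintype V] (h : D3 G univ v)
    (hN : ∀ u, G.Adj v u → u ∈ S ∨ u = b) : D2 (CycleModFour.ident G a b) S v :=
  h.erase b fun u _ hu hub => ⟨⟨hu.ne, .inl hu⟩, (hN u hu).resolve_right hub⟩

end

variable [Fintype V] [DecidableEq V] {W : Finset V}

theorem Crit.ident_path (h : Crit G W) {a b : V} (S W' : Finset V) (ha : a ∈ S) (hb : b ∉ S)
    (h2 : ∀ v ∈ S, D2 (ident G a b) S v) (h3 : ∀ v ∈ S, v ∉ W' → D3 (ident G a b) S v)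
    (hc : #W' ≤ 3) (hbig : #W' ≤ 2 ∨ 9 ≤ #S) :
    ∃ l, Seg G a l b ∧ (a :: (l ++ [b])).Nodup ∧ l.length % 4 = 3 ∧ ∀ y ∈ l, y ∈ S ∧ y ≠ a :=
  h.free.exists_path_of_ident hb (h.red _ S W'
    ((card_lt_iff_ne_univ S).2 fun hS => hb (hS ▸ mem_univ b)) ⟨a, ha⟩ h2 h3 hc hbig)

/-- Merging the ends of a path with three interior vertices. -/
theorem Crit.ident_false (h : Crit G W) {a b p q r : V} (S W' : Finset V) (ha : a ∈ S) (hb : b ∉ S)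
    (hp : Seg G a [p, q, r] b) (hpn : [p, q, r].Nodup) (hpS : ∀ u ∈ [p, q, r], u ∉ S ∧ u ≠ b)
    (h2 : ∀ v ∈ S, D2 (ident G a b) S v) (h3 : ∀ v ∈ S, v ∉ W' → D3 (ident G a b) S v)
    (hc : #W' ≤ 3) (hbig : #W' ≤ 2 ∨ 9 ≤ #S) : False := by
  obtain ⟨l, hl, hn, hlen, hS⟩ := h.ident_path S W' ha hb h2 h3 hc hbig
  refine h.free.two_paths hl hp.reverse ?_ (by simp; omega)
  have : (a :: (l ++ b :: [p, q, r].reverse)) = (a :: (l ++ [b])) ++ [p, q, r].reverse := by simp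
  rw [this, List.nodup_append]
  refine ⟨hn, List.nodup_reverse.2 hpn, fun u hu v hv => ?_⟩
  rintro rfl
  have hu' := hpS u (List.mem_reverse.1 hv)
  simp only [List.mem_cons, List.mem_append, List.not_mem_nil, or_false] at hu
  rcases hu with rfl | hu | rfl
  · exact hu'.1 ha
  · exact hu'.1 (hS u hu).1
  · exact hu'.2 rfl

end

section

variable {V : Type*} [Fintype V] [DecidableEq V] {G : SimpleGraph V} {W : Finset V}

theorem Crit.triangle_facts (h : Crit G W) {w x y x' y' : V} (hw : w ∈ W) (hwx : G.Adj w x)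
    (hwy : G.Adj w y) (hxy : G.Adj x y) (hCx : Cubic G x w y x') (hCy : Cubic G y w x y') :
    x' ≠ y' ∧ ¬ G.Adj x' y' ∧ x' ≠ x ∧ y' ≠ y ∧ x ≠ y ∧ w ≠ x ∧ w ≠ y ∧
      w ≠ x' ∧ y ≠ x' ∧ w ≠ y' ∧ x ≠ y' ∧ G.Adj x x' ∧ G.Adj y y' ∧ ∀ S : Finset V,
      S = {x, w, y, y'}ᶜ → ∀ v ∈ S, v ≠ x' → ∀ u, G.Adj v u → u ∈ S ∨ u = y' := by
  have hNw := h.adj_iff hw hwx hwy hxy.ne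
  have hxx' := hCx.adj.2.2
  have hyy' := hCy.adj.2.2
  refine ⟨?_, fun hadj => h.free.no_square hxx' hadj hyy'.symm hxy.symm hCy.2.2.1
    hCx.2.2.1.symm, hxx'.ne.symm, hyy'.ne.symm, hxy.ne, hwx.ne, hwy.ne, hCx.2.1, hCx.2.2.1,
    hCy.2.1, hCy.2.2.1, hxx', hyy', ?_⟩
  · rintro rfl
    exact h.free.no_square hwx hxx' hyy'.symm hwy.symm hCx.2.1 hxy.ne
  · rintro S rfl v hv hvx' u hvu
    have h1 := hNw v; have h2 := hCx.2.2.2 v; have h3 := hCy.2.2.2 v; have h4 := hvu.symm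
    simp only [mem_compl, mem_insert, mem_singleton, not_or] at hv ⊢
    by_contra hcon
    grind

theorem Crit.triangle_common (h : Crit G W) {w x y x' y' c : V} (hw : w ∈ W) (hwx : G.Adj w x)
    (hwy : G.Adj w y) (hxy : G.Adj x y) (hCx : Cubic G x w y x') (hCy : Cubic G y w x y')
    (hy'W : y' ∉ W) (hcW' : c ∉ W) (hx'c : G.Adj x' c) (hy'c : G.Adj y' c) : False := by
  have hWpos := card_pos.2 ⟨w, hw⟩
  have hcW : #(W.erase w) = #W - 1 := card_erase_of_mem hw
  have hc3 := h.card_le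
  obtain ⟨f1, f2, f3, f4, f5, f6, f7, f8, f9, f10, f11, hxx', hyy', hN⟩ :=
    h.triangle_facts hw hwx hwy hxy hCx hCy
  have hNw := h.adj_iff hw hwx hwy hxy.ne
  have hNx := hCx.2.2.2
  have hNy := hCy.2.2.2
  obtain ⟨S, hS⟩ : ∃ S : Finset V, S = {x, w, y, y'}ᶜ := ⟨_, rfl⟩
  replace hN := hN S hS
  have mem : ∀ v, v ∈ S ↔ v ≠ x ∧ v ≠ w ∧ v ≠ y ∧ v ≠ y' := by intro v; simp [hS]
  have hx'S : x' ∈ S := by rw [mem]; grind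
  have hy'S : y' ∉ S := by rw [mem]; grind
  have nbS : ∀ u, u ≠ y → G.Adj y' u → u ∈ S ∧ u ≠ x' := by
    intro u huy hu
    have h1 := hNw y'; have h2 := hNx y'; have h3 := hu.symm; have h4 := hu.ne
    have h5 : ¬ G.Adj y' x' := fun h => f2 h.symm
    rw [mem]
    clear hN
    grind
  have nbS' : ∀ u, u ≠ x → G.Adj x' u → u ∈ S := by
    intro u huy hu
    have h1 := hNw x'; have h2 := hNy x'; have h3 := hu.symm; have h4 := hu.ne
    rw [mem]
    clear hN
    grind
  have hcy : c ≠ y := by rintro rfl; have := (hNy x').1 hx'c.symm; grind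
  have hcx : c ≠ x := by rintro rfl; have := (hNx y').1 hy'c.symm; grind
  have uniq : ∀ v, G.Adj v x' → G.Adj v y' → v = c := fun v h1 h2 => by
    by_contra hne
    exact h.free.no_square hx'c hy'c.symm h2.symm h1 f1 (Ne.symm hne)
  obtain ⟨q, hqc, hqy, hy'q⟩ : ∃ q, q ≠ c ∧ q ≠ y ∧ G.Adj y' q := by
    obtain ⟨q1, q2, h12, h1, h2, ha1, ha2⟩ := h.two_more hy'W y
    by_cases hq : q1 = c
    · exact ⟨q2, by grind⟩
    · exact ⟨q1, hq, h1, ha1⟩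
  have hcS := nbS c hcy hy'c
  have hqS := nbS q hqy hy'q
  have hD2 : ∀ v ∈ S, D2 (ident G x' y') S v := by
    intro v hv
    by_cases hvx' : v = x'
    · subst hvx'
      exact ⟨c, q, hqc.symm, hcS.1, hqS.1, ident_adj hx'c, ident_adj' hy'q hqS.2⟩
    by_cases hvc : v = c
    · exact (h.d3 v (hvc ▸ hcW')).ident_d2 (hN v hv hvx')
    · exact (h.d2 v).ident hx'S hvx' (hN v hv hvx') fun hh => hvc (uniq v hh.1 hh.2)
  have hD3 : ∀ v ∈ S, v ∉ W.erase w → v ≠ c → D3 (ident G x' y') S v := by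
    intro v hv hv' hvc
    have hvW : v ∉ W := by have := (mem v).1 hv; simp at hv'; tauto
    by_cases hvx' : v = x'
    · subst hvx'
      obtain ⟨p, hpc, hpx, hp⟩ : ∃ q, q ≠ c ∧ q ≠ x ∧ G.Adj v q := by
        obtain ⟨q1, q2, h12, h1, h2, ha1, ha2⟩ := h.two_more hvW x
        by_cases hq : q1 = c
        · exact ⟨q2, by grind⟩
        · exact ⟨q1, hq, h1, ha1⟩
      refine ⟨c, p, q, hpc.symm, hqc.symm, ?_, hcS.1, nbS' p hpx hp, hqS.1, ident_adj hx'c,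
        ident_adj hp, ident_adj' hy'q hqS.2⟩
      rintro rfl
      exact hpc (uniq p hp.symm hy'q.symm)
    · exact (h.d3 v hvW).ident hx'S hvx' (hN v hv hvx') fun hh => hvc (uniq v hh.1 hh.2)
  have hcard : #S = Fintype.card V - 4 := by
    rw [hS, card_compl]
    congr 1
    rw [card_insert_of_notMem (by simp; grind), card_insert_of_notMem (by simp; grind),
      card_insert_of_notMem (by simp; grind), card_singleton]
  have hpath : Seg G x' [x, w, y] y' := by simp [hxx'.symm, hwx.symm, hwy, hyy']
  have hpn : [x, w, y].Nodup := by simp; grind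
  have hpS : ∀ u ∈ [x, w, y], u ∉ S ∧ u ≠ y' := by
    intro u hu
    rw [mem]
    simp at hu
    grind
  have hbig : 9 ≤ Fintype.card V ∧ Fintype.card V ≤ 12 := by
    by_contra hcon
    have := card_insert_le c (W.erase w)
    refine h.ident_false S (insert c (W.erase w)) hx'S hy'S hpath hpn hpS hD2 ?_ (by omega) ?_
    · intro v hv hv'
      exact hD3 v hv (by simp at hv' ⊢; tauto) (by simp at hv'; tauto)
    · have := h.big
      omega
  obtain ⟨d, hCc⟩ : ∃ d, Cubic G c y' x' d := by
    obtain ⟨p, q, hC⟩ := h.cubic_of_not_d3 hcW' hy'c.symm fun hD => by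
      refine h.ident_false S (W.erase w) hx'S hy'S hpath hpn hpS hD2 ?_ (by omega) (by omega)
      intro v hv hv'
      by_cases hvc : v = c
      · subst hvc
        refine hD.mono fun u hu hvu => ⟨⟨hvu.ne, .inl hvu⟩, ?_⟩
        exact (hN v hv hx'c.ne.symm u hvu).resolve_right (by simpa using hu)
      · exact hD3 v hv hv' hvc
    rcases (hC.2.2.2 x').1 hx'c.symm with h1 | rfl | rfl
    · exact absurd h1 f1
    · exact ⟨q, hC⟩
    · exact ⟨p, hC.swap⟩
  have hNc := hCc.2.2.2
  have hcd := hCc.adj.2.2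
  obtain ⟨d1, d2, d3, -⟩ := hCc
  have e1 := hx'c.ne; have e2 := hy'c.ne; have e3 := hcd.ne
  have e4 : c ≠ w := ((mem c).1 hcS.1).2.1
  have e5 : d ≠ x := by rintro rfl; have := (hNx c).1 hcd.symm; grind
  have e6 : d ≠ y := by rintro rfl; have := (hNy c).1 hcd.symm; grind
  have e7 : d ≠ w := by rintro rfl; have := (hNw c).1 hcd.symm; grind
  refine h.not_refute hbig.1 hbig.2 x [w, x, y, x', y', c, d] (m := 7) rfl
    (E := [(0, 1), (0, 2), (1, 2), (1, 3), (2, 4), (3, 5), (4, 5), (5, 6)]) (op := [6, 4, 3])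
    (cl := [(0, [1, 2]), (1, [0, 2, 3]), (2, [0, 1, 4]), (5, [4, 3, 6])]) (tw := [0])
    refute_triangle (by decide +kernel) ?_ ?_ ?_ ?_
  · simp; grind
  · simp [hwx, hwy, hxy, hxx', hyy', hx'c, hy'c, hcd]
  · simp [hNw, hNx, hNy, hNc]
  · simp [hw]

theorem Crit.triangle_no_common (h : Crit G W) {w x y x' y' : V} (hw : w ∈ W) (hwx : G.Adj w x)
    (hwy : G.Adj w y) (hxy : G.Adj x y) (hCx : Cubic G x w y x') (hCy : Cubic G y w x y')
    (hcom : ∀ v, G.Adj v x' → ¬ G.Adj v y') : False := by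
  have hWpos := card_pos.2 ⟨w, hw⟩
  have hcW : #(W.erase w) = #W - 1 := card_erase_of_mem hw
  have hc3 := h.card_le
  obtain ⟨f1, f2, f3, f4, f5, f6, f7, f8, f9, f10, f11, hxx', hyy', hN⟩ :=
    h.triangle_facts hw hwx hwy hxy hCx hCy
  have hNw := h.adj_iff hw hwx hwy hxy.ne
  have hNx := hCx.2.2.2
  have hNy := hCy.2.2.2
  obtain ⟨S, hS⟩ : ∃ S : Finset V, S = {x, w, y, y'}ᶜ := ⟨_, rfl⟩
  replace hN := hN S hS
  have mem : ∀ v, v ∈ S ↔ v ≠ x ∧ v ≠ w ∧ v ≠ y ∧ v ≠ y' := by intro v; simp [hS]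
  have hx'S : x' ∈ S := by rw [mem]; grind
  have hy'S : y' ∉ S := by rw [mem]; grind
  have nbS : ∀ u, u ≠ y → G.Adj y' u → u ∈ S ∧ u ≠ x' := by
    intro u huy hu
    have h1 := hNw y'; have h2 := hNx y'; have h3 := hu.symm; have h4 := hu.ne
    have h5 : ¬ G.Adj y' x' := fun h => f2 h.symm
    rw [mem]
    clear hN
    grind
  have nbS' : ∀ u, u ≠ x → G.Adj x' u → u ∈ S := by
    intro u huy hu
    have h1 := hNw x'; have h2 := hNy x'; have h3 := hu.symm; have h4 := hu.ne
    rw [mem]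
    clear hN
    grind
  have cross : ∀ {p q}, G.Adj x' p → G.Adj y' q → p ≠ q := fun {p q} hp hq hpq =>
    hcom p hp.symm (hpq ▸ hq.symm)
  refine h.ident_false S (W.erase w) hx'S hy'S (p := x) (q := w) (r := y)
    (by simp [hxx'.symm, hwx.symm, hwy, hyy']) (by simp; grind) ?_ ?_ ?_ (by omega) (by omega)
  · intro u hu
    rw [mem]
    simp at hu
    grind
  · intro v hv
    by_cases hvx' : v = x'
    · subst hvx'
      obtain ⟨p, hpx, hp⟩ := h.one_more v x
      obtain ⟨q, hqy, hq⟩ := h.one_more y' y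
      have hqS := nbS q hqy hq
      exact ⟨p, q, cross hp hq, nbS' p hpx hp, hqS.1, ident_adj hp, ident_adj' hq hqS.2⟩
    · exact (h.d2 v).ident hx'S hvx' (hN v hv hvx') fun hh => hcom v hh.1 hh.2
  · intro v hv hv'
    have hvW : v ∉ W := by have := (mem v).1 hv; simp at hv'; tauto
    by_cases hvx' : v = x'
    · subst hvx'
      obtain ⟨p, p', hpp, hpx, hpx', hp, hp'⟩ := h.two_more hvW x
      obtain ⟨q, hqy, hq⟩ := h.one_more y' y
      have hqS := nbS q hqy hq
      exact ⟨p, p', q, hpp, cross hp hq, cross hp' hq, nbS' p hpx hp, nbS' p' hpx' hp', hqS.1,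
        ident_adj hp, ident_adj hp', ident_adj' hq hqS.2⟩
    · exact (h.d3 v hvW).ident hx'S hvx' (hN v hv hvx') fun hh => hcom v hh.1 hh.2

theorem Crit.triangle_common_mem (h : Crit G W) {w x y x' y' c : V} (hw : w ∈ W)
    (hwx : G.Adj w x) (hwy : G.Adj w y) (hxy : G.Adj x y) (hCx : Cubic G x w y x')
    (hCy : Cubic G y w x y') (hc : c ∈ W) (hx'c : G.Adj x' c) (hy'c : G.Adj y' c) : False := by
  have hc3 := h.card_le
  obtain ⟨f1, f2, f3, f4, f5, f6, f7, f8, f9, f10, f11, hxx', hyy', hN'⟩ :=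
    h.triangle_facts hw hwx hwy hxy hCx hCy
  replace hN' := hN' _ rfl
  have hNw := h.adj_iff hw hwx hwy hxy.ne
  have hNc := h.adj_iff hc hx'c.symm hy'c.symm f1
  have hNx := hCx.2.2.2
  have hNy := hCy.2.2.2
  have hcx : c ≠ x := by rintro rfl; exact h.not_adj hw hc hwx
  have hcy : c ≠ y := by rintro rfl; exact h.not_adj hw hc hwy
  have hcw : c ≠ w := by rintro rfl; have := (hNw x').1 hx'c.symm; grind
  have hx'W : x' ∉ W := fun hh => h.not_adj hh hc hx'c
  have hy'W : y' ∉ W := fun hh => h.not_adj hh hc hy'c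
  obtain ⟨S, hS⟩ : ∃ S : Finset V, S = {x, w, y, y', c}ᶜ := ⟨_, rfl⟩
  have mem : ∀ v, v ∈ S ↔ v ≠ x ∧ v ≠ w ∧ v ≠ y ∧ v ≠ y' ∧ v ≠ c := by intro v; simp [hS]
  have hx'S : x' ∈ S := by have := hx'c.ne; rw [mem]; clear hN'; grind
  have hy'S : y' ∉ S := by rw [mem]; clear hN'; grind
  have hN : ∀ v ∈ S, v ≠ x' → ∀ u, G.Adj v u → u ∈ S ∨ u = y' := by
    intro v hv hvx' u hu
    have hv' := (mem v).1 hv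
    have h1 := hN' v (by simp; tauto) hvx' u hu
    have h2 : u ≠ c := by
      rintro rfl
      have := (hNc v).1 hu.symm
      tauto
    rw [mem]
    simp only [mem_compl, mem_insert, mem_singleton] at h1
    tauto
  have nbS : ∀ u, u ≠ y → u ≠ c → G.Adj y' u → u ∈ S ∧ u ≠ x' := by
    intro u huy huc hu
    have h1 := hNw y'; have h2 := hNx y'; have h3 := hu.symm; have h4 := hu.ne
    have h5 : ¬ G.Adj y' x' := fun h => f2 h.symm
    rw [mem]
    clear hN hN'
    grind
  have nbS' : ∀ u, u ≠ x → u ≠ c → G.Adj x' u → u ∈ S := by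
    intro u huy huc hu
    have h1 := hNw x'; have h2 := hNy x'; have h3 := hu.symm; have h4 := hu.ne
    rw [mem]
    clear hN hN'
    grind
  have hcom : ∀ v, v ≠ c → G.Adj v x' → G.Adj v y' → False := fun v hv h1 h2 =>
    h.free.no_square hx'c hy'c.symm h2.symm h1 f1 (Ne.symm hv)
  have hcard : #(insert x' ((W.erase w).erase c)) ≤ 2 := by
    have := card_insert_le x' ((W.erase w).erase c)
    rw [card_erase_of_mem (mem_erase.2 ⟨hcw, hc⟩), card_erase_of_mem hw] at this
    omega
  refine h.ident_false S (insert x' ((W.erase w).erase c)) hx'S hy'S (p := x) (q := w) (r := y)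
    (by simp [hxx'.symm, hwx.symm, hwy, hyy']) (by simp; clear hN'; grind) ?_ ?_ ?_
    (by omega) (by omega)
  · intro u hu
    rw [mem]
    simp at hu
    clear hN hN'
    grind
  · intro v hv
    by_cases hvx' : v = x'
    · subst hvx'
      obtain ⟨p, hpx, hpc, hp⟩ : ∃ q, q ≠ x ∧ q ≠ c ∧ G.Adj v q := by
        obtain ⟨q1, q2, h12, h1, h2, ha1, ha2⟩ := h.two_more hx'W x
        by_cases hq : q1 = c
        · exact ⟨q2, h2, fun h => h12 (hq.trans h.symm), ha2⟩
        · exact ⟨q1, h1, hq, ha1⟩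
      obtain ⟨q, hqy, hqc, hq⟩ : ∃ q, q ≠ y ∧ q ≠ c ∧ G.Adj y' q := by
        obtain ⟨q1, q2, h12, h1, h2, ha1, ha2⟩ := h.two_more hy'W y
        by_cases hq : q1 = c
        · exact ⟨q2, h2, fun h => h12 (hq.trans h.symm), ha2⟩
        · exact ⟨q1, h1, hq, ha1⟩
      have hqS := nbS q hqy hqc hq
      exact ⟨p, q, fun hpq => hcom p hpc hp.symm (hpq ▸ hq.symm), nbS' p hpx hpc hp, hqS.1,
        ident_adj hp, ident_adj' hq hqS.2⟩
    · exact (h.d2 v).ident hx'S hvx' (hN v hv hvx') fun hh =>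
        hcom v ((mem v).1 hv).2.2.2.2 hh.1 hh.2
  · intro v hv hv'
    have hm := (mem v).1 hv
    simp only [mem_insert, mem_erase, not_or] at hv'
    exact (h.d3 v (by tauto)).ident hx'S hv'.1 (hN v hv hv'.1) fun hh =>
      hcom v hm.2.2.2.2 hh.1 hh.2

/-- Vertices of degree two are in no triangle. -/
theorem Crit.no_triangle (h : Crit G W) {w x y : V} (hw : w ∈ W) (hwx : G.Adj w x)
    (hwy : G.Adj w y) (hxy : G.Adj x y) : False := by
  have hNw := h.adj_iff hw hwx hwy hxy.ne
  have third : ∀ {x y}, G.Adj w x → G.Adj w y → G.Adj x y → ∃ x', Cubic G x w y x' := by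
    intro x y hwx hwy hxy
    obtain ⟨p, q, hC⟩ := h.cubic_of_adj_mem hw hwx
    rcases (hC.2.2.2 y).1 hxy with rfl | rfl | rfl
    · exact absurd rfl hwy.ne
    · exact ⟨q, hC⟩
    · exact ⟨p, hC.swap⟩
  obtain ⟨x', hCx⟩ := third hwx hwy hxy
  obtain ⟨y', hCy⟩ := third hwy hwx hxy.symm
  obtain ⟨f1, f2, f3, f4, f5, f6, f7, f8, f9, f10, f11, hxx', hyy', hN⟩ :=
    h.triangle_facts hw hwx hwy hxy hCx hCy
  by_cases hcom : ∃ c, G.Adj x' c ∧ G.Adj y' c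
  swap
  · exact h.triangle_no_common hw hwx hwy hxy hCx hCy fun v h1 h2 => hcom ⟨v, h1.symm, h2.symm⟩
  obtain ⟨c, hx'c, hy'c⟩ := hcom
  by_cases hc : c ∈ W
  · exact h.triangle_common_mem hw hwx hwy hxy hCx hCy hc hx'c hy'c
  by_cases hy' : y' ∈ W
  swap
  · exact h.triangle_common hw hwx hwy hxy hCx hCy hy' hc hx'c hy'c
  by_cases hx' : x' ∈ W
  swap
  · exact h.triangle_common hw hwy hwx hxy.symm hCy hCx hx' hc hy'c hx'c
  have hcx : c ≠ x := by rintro rfl; have := (hCx.2.2.2 y').1 hy'c.symm; clear hN; grind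
  have hcy : c ≠ y := by rintro rfl; have := (hCy.2.2.2 x').1 hx'c.symm; clear hN; grind
  have hNx' := h.adj_iff hx' hxx'.symm hx'c hcx.symm
  have hNy' := h.adj_iff hy' hyy'.symm hy'c hcy.symm
  have hNx := hCx.2.2.2
  have hNy := hCy.2.2.2
  obtain ⟨d, d1, d2, hd⟩ : ∃ d, d ≠ x' ∧ d ≠ y' ∧ G.Adj c d := by
    obtain ⟨q1, q2, h12, h1, h2, ha1, ha2⟩ := h.two_more hc x'
    by_cases hq : q1 = y'
    · exact ⟨q2, h2, fun h => h12 (hq.trans h.symm), ha2⟩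
    · exact ⟨q1, h1, hq, ha1⟩
  have hcw : c ≠ w := by rintro rfl; exact hc hw
  have e1 := hx'c.ne; have e2 := hy'c.ne; have e3 := hd.ne; have e4 := hd.symm
  clear hN hCx hCy
  refine h.sep1 {x, w, y, x', y', c}ᶜ c (by simp) ⟨d, ?_⟩ ⟨x, by simp, hcx.symm⟩ ?_ ?_
  · have h1 := hNw c; have h2 := hNx c; have h3 := hNy c
    simp
    grind
  · intro u hu v huv
    have h1 := hNw u; have h2 := hNx u; have h3 := hNy u; have h4 := hNx' u; have h5 := hNy' u
    have h6 := huv.symm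
    simp at hu ⊢
    grind
  · have hsub : {x, w, y, x', y', c}ᶜ ∩ W ⊆ ((W.erase w).erase x').erase y' := by
      intro v hv
      simp at hv ⊢
      tauto
    have := card_le_card hsub
    rw [card_erase_of_mem (by simp [hy', f1.symm, f10.symm]),
      card_erase_of_mem (by simp [hx', f8.symm]), card_erase_of_mem hw] at this
    have := h.card_le
    omega

end

section

variable {V : Type*} [Fintype V] [DecidableEq V] {G : SimpleGraph V} {W : Finset V}

theorem nodup_two_paths {α : Type*} {a b : α} {P Q : List α} (hP : P.Nodup) (hQ : Q.Nodup)
    (hab : a ≠ b) (haP : a ∉ P) (haQ : a ∉ Q) (hbP : b ∉ P) (hbQ : b ∉ Q)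
    (hPQ : ∀ u ∈ P, u ∉ Q) : (a :: (P ++ b :: Q)).Nodup := by
  simp only [List.nodup_cons, List.nodup_append, List.mem_append, List.mem_cons]
  grind

/-- Both sides of a separating pair contain paths; the other side is then reducible. -/
theorem Crit.no_even_paths (h : Crit G W) (B : Finset V) (x y : V) (hx : x ∉ B) (hy : y ∉ B)
    (hxy : x ≠ y) (hN : ∀ u ∈ B, ∀ v, G.Adj u v → v ∈ B ∨ v = x ∨ v = y) (M₁ M₃ : List V)
    (h1 : Seg G x M₁ y) (h1n : M₁.Nodup) (h1B : ∀ u ∈ M₁, u ∈ B) (h1l : M₁.length % 4 = 1)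
    (h3 : Seg G x M₃ y) (h3n : M₃.Nodup) (h3B : ∀ u ∈ M₃, u ∈ B) (h3l : M₃.length % 4 = 3)
    (hO : (insert x (insert y B))ᶜ.Nonempty) (hw : #((insert x (insert y B))ᶜ ∩ W) ≤ 2) :
    False := by
  induction hn : #(insert x (insert y B))ᶜ using Nat.strong_induction_on
    generalizing B x y M₁ M₃ with
  | _ n ih =>
  subst hn
  obtain ⟨O, hOdef⟩ : ∃ O, O = (insert x (insert y B))ᶜ := ⟨_, rfl⟩
  rw [← hOdef] at hO hw
  have mem : ∀ v, v ∈ O ↔ v ≠ x ∧ v ≠ y ∧ v ∉ B := by intro v; simp [hOdef]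
  have hNO : ∀ u ∈ O, ∀ v, G.Adj u v → v ∈ O ∨ v = x ∨ v = y := by
    intro u hu v huv
    have := hN v
    have := (mem u).1 hu
    rw [mem]
    by_contra hcon
    have hv : v ∈ B := by tauto
    have := hN v hv u huv.symm
    tauto
  have hcomm : ∀ v ∈ O, G.Adj v x → G.Adj v y → False := by
    intro v hv hvx hvy
    have hv' := (mem v).1 hv
    refine h.free.two_paths h1 (Q := [v]) (by simp [hvx, hvy.symm]) ?_ (by simp; omega)
    refine nodup_two_paths h1n (by simp) hxy (fun h => hx (h1B _ h)) (by simpa using hv'.1.symm)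
      (fun h => hy (h1B _ h)) (by simpa using hv'.2.1.symm) ?_
    intro u hu
    have := h1B u hu
    simp
    rintro rfl
    exact hv'.2.2 this
  -- each of `x` and `y` has a neighbour in `O`
  have key : ∀ x y, x ∉ B → y ∉ B → x ≠ y →
      (∀ u ∈ B, ∀ v, G.Adj u v → v ∈ B ∨ v = x ∨ v = y) →
      (∀ u ∈ O, ∀ v, G.Adj u v → v ∈ O ∨ v = x ∨ v = y) →
      (∀ v, v ∈ O ↔ v ≠ x ∧ v ≠ y ∧ v ∉ B) → ∃ u ∈ O, G.Adj x u := by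
    intro x y hx hy hxy hN hNO mem
    by_contra hcon
    push Not at hcon
    by_cases hw1 : #(O ∩ W) ≤ 1
    · refine h.sep1 O y (by simp [mem]) hO ⟨x, by simp [mem], hxy⟩ ?_ hw1
      intro u hu v huv
      rcases hNO u hu v huv with h | rfl | h
      · exact .inl h
      · exact absurd huv.symm (hcon u hu)
      · exact .inr h
    · obtain ⟨o, ho⟩ := hO
      have ho' := (mem o).1 ho
      refine h.sep1 (insert x B) y (by simp [hy, hxy.symm]) (by simp)
        ⟨o, by simp; tauto, by tauto⟩ ?_ ?_
      · intro u hu v huv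
        rcases mem_insert.1 hu with rfl | hu
        · have := (mem v).not.1 fun hv => hcon v hv huv
          have := huv.ne
          simp
          grind
        · have := hN u hu v huv
          simp
          tauto
      · have hd : Disjoint (O ∩ W) (insert x B ∩ W) := by
          rw [disjoint_left]
          intro v hv hv'
          have := (mem v).1 (mem_inter.1 hv).1
          simp at hv'
          tauto
        have := card_union_of_disjoint hd
        have h4 : #((O ∩ W) ∪ (insert x B ∩ W)) ≤ #W := card_le_card (by
          intro v; simp; tauto)
        have := h.card_le
        omega
  obtain ⟨x', hx', hxx'⟩ := key x y hx hy hxy hN hNO mem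
  obtain ⟨y', hy', hyy'⟩ := key y x hy hx hxy.symm (fun u hu v huv => by have := hN u hu v huv; tauto)
    (fun u hu v huv => by have := hNO u hu v huv; tauto) (fun v => by rw [mem]; tauto)
  have hx'' := (mem x').1 hx'
  have hy'' := (mem y').1 hy'
  have hxy' : x' ≠ y' := by
    rintro rfl
    exact hcomm _ hx' hxx'.symm hyy'.symm
  by_cases huniq : (∀ v ∈ O, G.Adj x v → v = x') ∧ ∀ v ∈ O, G.Adj y v → v = y'
  · have hNB : ∀ u ∈ insert x (insert y B), ∀ v, G.Adj u v →
        v ∈ insert x (insert y B) ∨ v = x' ∨ v = y' := by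
      intro u hu v huv
      by_cases hv : v ∈ O
      · have hv' := (mem v).1 hv
        simp only [mem_insert] at hu
        rcases hu with rfl | rfl | hu
        · exact .inr (.inl (huniq.1 v hv huv))
        · exact .inr (.inr (huniq.2 v hv huv))
        · have := hN u hu v huv
          tauto
      · left
        have := (mem v).not.1 hv
        simp only [mem_insert]
        tauto
    by_cases hO' : ∀ v ∈ O, v = x' ∨ v = y'
    · have inW : ∀ x x' y y', x' ∈ O → x' ≠ y' → (∀ v ∈ O, v = x' ∨ v = y') →
          (∀ u ∈ O, ∀ v, G.Adj u v → v ∈ O ∨ v = x ∨ v = y) →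
          (∀ v ∈ O, G.Adj y v → v = y') → x' ∈ W ∧ G.Adj x' y' := by
        intro x x' y y' hx' hxy' hO' hNO hu
        have hsub : ∀ v, G.Adj x' v → v = x ∨ v = y' := by
          intro v hv
          rcases hNO x' hx' v hv with h | h | rfl
          · rcases hO' v h with rfl | rfl
            · exact absurd rfl hv.ne
            · exact .inr rfl
          · exact .inl h
          · exact absurd (hu x' hx' hv.symm) hxy'
        constructor
        · by_contra hW
          obtain ⟨a, b, hab, ha, hb, h1, h2⟩ := h.two_more hW x
          have := hsub a h1; have := hsub b h2
          grind
        · obtain ⟨a, ha, h1⟩ := h.one_more x' x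
          rcases hsub a h1 with rfl | rfl
          · exact absurd rfl ha
          · exact h1
      have h1 := inW x x' y y' hx' hxy' hO' hNO huniq.2
      have h2 := inW y y' x x' hy' hxy'.symm (fun v hv => (hO' v hv).symm)
        (fun u hu v huv => by have := hNO u hu v huv; tauto) huniq.1
      exact h.not_adj h1.1 h2.1 h1.2
    · push Not at hO'
      obtain ⟨o, ho, hox, hoy⟩ := hO'
      have ho' := (mem o).1 ho
      have hsub : (insert x' (insert y' (insert x (insert y B))))ᶜ ⊆ O := by
        intro v
        rw [mem]
        simp
      refine ih _ ?_ (insert x (insert y B)) x' y' (by simp; tauto) (by simp; tauto) hxy' hNB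
        (x :: (M₃ ++ [y])) (x :: (M₁ ++ [y])) ?_ ?_ ?_ ?_ ?_ ?_ ?_ ?_ ⟨o, by simp; tauto⟩ ?_ rfl
      · rw [← hOdef]
        exact card_lt_card ⟨hsub, fun hs => by simpa using hs hx'⟩
      · simp [hxx'.symm, h3, hyy']
      · have := nodup_two_paths (Q := []) h3n (by simp) hxy (fun h => hx (h3B _ h)) (by simp)
          (fun h => hy (h3B _ h)) (by simp) (by simp)
        exact this
      · simp; grind
      · simp; omega
      · simp [hxx'.symm, h1, hyy']
      · have := nodup_two_paths (Q := []) h1n (by simp) hxy (fun h => hx (h1B _ h)) (by simp)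
          (fun h => hy (h1B _ h)) (by simp) (by simp)
        exact this
      · simp; grind
      · simp; omega
      · exact (card_le_card (inter_subset_inter_right hsub)).trans hw
  · have hD3 : D3 (ident G x y) (insert x O) x := by
      by_cases hu : ∀ v ∈ O, G.Adj x v → v = x'
      · have : ∃ v ∈ O, G.Adj y v ∧ v ≠ y' := by
          by_contra hcon
          push Not at hcon
          exact huniq ⟨hu, hcon⟩
        obtain ⟨v, hv, hyv, hvy'⟩ := this
        refine ⟨x', y', v, hxy', ?_, hvy'.symm, by simp [hx'], by simp [hy'], by simp [hv],
          ident_adj hxx', ident_adj' hyy' hy''.1, ident_adj' hyv ((mem v).1 hv).1⟩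
        rintro rfl
        exact hcomm _ hx' hxx'.symm hyv.symm
      · push Not at hu
        obtain ⟨v, hv, hxv, hvx'⟩ := hu
        refine ⟨x', v, y', hvx'.symm, hxy', ?_, by simp [hx'], by simp [hv], by simp [hy'],
          ident_adj hxx', ident_adj hxv, ident_adj' hyy' hy''.1⟩
        rintro rfl
        exact hcomm _ hy' hxv.symm hyy'.symm
    have hN' : ∀ v ∈ O, ∀ u, G.Adj v u → u ∈ insert x O ∨ u = y := by
      intro v hv u huv
      have := hNO v hv u huv
      simp
      tauto
    obtain ⟨l, hl, hln, hll, hlS⟩ := h.ident_path (a := x) (b := y) (insert x O) (O ∩ W) (by simp)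
      (by simp [mem, hxy.symm]) (fun v hv => by
        by_cases hvx : v = x
        · exact hvx ▸ hD3.d2
        · have hvO := (mem_insert.1 hv).resolve_left hvx
          exact (h.d2 v).ident (by simp) hvx (hN' v hvO) fun hh => hcomm v hvO hh.1 hh.2)
      (fun v hv hv' => by
        by_cases hvx : v = x
        · exact hvx ▸ hD3
        · have hvO := (mem_insert.1 hv).resolve_left hvx
          exact (h.d3 v (fun h => hv' (mem_inter.2 ⟨hvO, h⟩))).ident (by simp) hvx (hN' v hvO)
            fun hh => hcomm v hvO hh.1 hh.2)
      (by omega) (by omega)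
    have hlO : ∀ u ∈ l, u ∈ O := fun u hu => (mem_insert.1 (hlS u hu).1).resolve_left (hlS u hu).2
    refine h.free.two_paths h3 hl.reverse ?_ (by simp; omega)
    have hln' : l.Nodup := by
      rw [List.nodup_cons, List.nodup_append] at hln
      exact hln.2.1
    refine nodup_two_paths h3n (List.nodup_reverse.2 hln') hxy (fun h => hx (h3B _ h)) ?_
      (fun h => hy (h3B _ h)) ?_ ?_
    · simp
      intro hh
      have := (mem x).1 (hlO x hh)
      tauto
    · simp
      intro hh
      have := (mem y).1 (hlO y hh)
      tauto
    · intro u hu hu'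
      have := (mem u).1 (hlO u (by simpa using hu'))
      exact this.2.2 (h3B u hu)

end

section

section handle

variable {V : Type*} {G : SimpleGraph V}

/-- The graph obtained from `G` by making `x` and `y` the only neighbours of `z`. -/
def handle (G : SimpleGraph V) (x y z : V) : SimpleGraph V where
  Adj u v := u ≠ v ∧ ((u ≠ z ∧ v ≠ z ∧ G.Adj u v) ∨ (u = z ∧ (v = x ∨ v = y)) ∨
    (v = z ∧ (u = x ∨ u = y)))
  symm := ⟨fun u v h => ⟨h.1.symm, by have := G.adj_comm u v; tauto⟩⟩
  loopless := ⟨fun u h => h.1 rfl⟩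

theorem Free.exists_path_of_handle (hf : Free G) {x y z : V} {S : Finset V}
    (hc : HasCycleIn (handle G x y z) S) :
    ∃ l, Seg G x l y ∧ l.Nodup ∧ l.length % 4 = 1 ∧
      ∀ u ∈ l, u ∈ S ∧ u ≠ x ∧ u ≠ y ∧ u ≠ z := by
  obtain ⟨r, L, hL, hn, hlen, hS⟩ := hc
  by_cases hz : z ∈ r :: L
  · obtain ⟨L', hL', hp, hl⟩ := hL.exists_rotate hn hz
    rw [← hl] at hlen
    replace hS : ∀ u ∈ z :: L', u ∈ S := fun y hy => hS y (hp.subset hy)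
    replace hn := hp.nodup_iff.2 hn
    rcases L' with _ | ⟨u, M⟩
    · simp at hlen
    rcases List.eq_nil_or_concat M with rfl | ⟨M, v, rfl⟩
    · simp at hlen
    rw [List.concat_eq_append] at *
    rw [seg_cons, seg_append, seg_nil] at hL'
    obtain ⟨h1, h2, h3⟩ := hL'
    have hzL : ∀ p, p = u ∨ p ∈ M ∨ p = v → p ≠ z := by
      rintro p hp rfl
      simp at hn
      tauto
    have h4 : Seg G u M v := by
      refine h2.imp fun p hp q hq h => ?_
      have h1 := hzL p (by simpa using hp)
      have h2 := hzL q (by simpa using hq)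
      rcases h.2 with h | h | h <;> tauto
    have hu := hzL u (by simp)
    have hv := hzL v (by simp)
    have h1 : u = x ∨ u = y := by rcases h1.2 with h | h | h <;> tauto
    have h3 : v = x ∨ v = y := by rcases h3.2 with h | h | h <;> tauto
    have hM : M.Nodup ∧ u ∉ M ∧ v ∉ M ∧ u ≠ v := by
      simp [List.nodup_append] at hn
      grind
    have hMS : ∀ p ∈ M, p ∈ S := fun p hp => hS p (by simp [hp])
    simp only [List.length_cons, List.length_append, List.length_nil] at hlen
    rcases h1 with rfl | rfl <;> rcases h3 with rfl | rfl
    · exact absurd rfl hM.2.2.2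
    · exact ⟨M, h4, hM.1, by omega, by grind⟩
    · exact ⟨M.reverse, h4.reverse, List.nodup_reverse.2 hM.1, by simp; omega, by
        simp only [List.mem_reverse]; grind⟩
    · exact absurd rfl hM.2.2.2
  · refine (hf r L (hL.imp fun u hu v hv h => ?_) hn hlen).elim
    have hu : u ≠ z := by rintro rfl; simp at hu hz; tauto
    have hv : v ≠ z := by rintro rfl; simp at hv hz; tauto
    rcases h.2 with h | h | h <;> tauto

end handle

variable {V : Type*} [Fintype V] [DecidableEq V] {G : SimpleGraph V} {W : Finset V}

/-- A set of at least two vertices with at most one vertex of degree two is not separated from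
at least two further vertices by a pair. -/
theorem Crit.sep2 (h : Crit G W) (B : Finset V) (x y : V) (hx : x ∉ B) (hy : y ∉ B)
    (hB : 2 ≤ #B) (hO : 2 ≤ #(insert x (insert y B))ᶜ)
    (hN : ∀ u ∈ B, ∀ v, G.Adj u v → v ∈ B ∨ v = x ∨ v = y) (hw : #(B ∩ W) ≤ 1) : False := by
  induction hn : #B using Nat.strong_induction_on generalizing B x y with
  | _ n ih =>
  subst hn
  have hBne : B.Nonempty := card_pos.1 (by omega)
  have hOne : (insert x (insert y B))ᶜ.Nonempty := card_pos.1 (by omega)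
  by_cases hxy : x = y
  · subst hxy
    obtain ⟨o, ho⟩ := hOne
    simp at ho
    exact h.sep1 B x hx hBne ⟨o, by tauto, by tauto⟩ (fun u hu v huv => by
      have := hN u hu v huv; tauto) hw
  have two : ∀ x y, x ∉ B → y ∉ B → x ≠ y → 2 ≤ #(insert x (insert y B))ᶜ →
      (∀ u ∈ B, ∀ v, G.Adj u v → v ∈ B ∨ v = x ∨ v = y) → D2 G B x := by
    intro x y hx hy hxy hO hN
    by_contra hD
    by_cases h0 : ∃ x' ∈ B, G.Adj x x'
    swap
    · push Not at h0
      refine h.sep1 B y hy hBne ⟨x, hx, hxy⟩ (fun u hu v huv => ?_) hw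
      rcases hN u hu v huv with h | rfl | h
      · exact .inl h
      · exact absurd huv.symm (h0 u hu)
      · exact .inr h
    obtain ⟨x', hx', hxx'⟩ := h0
    have huniq : ∀ v ∈ B, G.Adj x v → v = x' := by
      intro v hv hxv
      by_contra hne
      exact hD ⟨v, x', hne, hv, hx', hxv, hxx'⟩
    have hN' : ∀ u ∈ B.erase x', ∀ v, G.Adj u v → v ∈ B.erase x' ∨ v = x' ∨ v = y := by
      intro u hu v huv
      have hu' := mem_erase.1 hu
      rcases hN u hu'.2 v huv with h | rfl | h
      · by_cases hv : v = x' <;> simp [hv, h]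
      · exact absurd (huniq u hu'.2 huv.symm) hu'.1
      · simp [h]
    have hcB : #(B.erase x') = #B - 1 := card_erase_of_mem hx'
    by_cases h3 : 3 ≤ #B
    · refine ih #(B.erase x') (by omega) (B.erase x') x' y (by simp) (by simp [hy]) (by omega)
        ?_ hN' ?_ rfl
      · refine hO.trans (card_le_card ?_)
        intro v
        simp
        grind
      · exact (card_le_card (inter_subset_inter_right (erase_subset _ _))).trans hw
    · obtain ⟨b, hb⟩ := card_eq_one.1 (show #(B.erase x') = 1 by omega)
      have hbB : b ∈ B.erase x' := by simp [hb]
      have hbB' := mem_erase.1 hbB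
      have hNb : ∀ v, G.Adj b v → v = x' ∨ v = y := by
        intro v hv
        rcases hN' b hbB v hv with h | h
        · rw [hb, mem_singleton] at h
          exact absurd h hv.ne.symm
        · exact h
      have hbW : b ∈ W := by
        by_contra hW
        obtain ⟨p, q, hpq, hp, hq, h1, h2⟩ := h.two_more hW x'
        have := hNb p h1; have := hNb q h2
        grind
      obtain ⟨p, q, hpq, -, -, h1, h2⟩ := h.d2 b
      have hbx' : G.Adj b x' := by have := hNb p h1; have := hNb q h2; grind
      have hby : G.Adj b y := by have := hNb p h1; have := hNb q h2; grind
      refine h.no_triangle hbW hbx' hby ?_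
      have hx'W : x' ∉ W := fun hh => h.not_adj hbW hh hbx'
      obtain ⟨p, q, hpq, hp, hq, h1, h2⟩ := h.two_more hx'W b
      have hNx' : ∀ v, v ≠ b → G.Adj x' v → v = x ∨ v = y := by
        intro v hvb hv
        rcases hN x' hx' v hv with h | h
        · have : v ∈ B.erase x' := mem_erase.2 ⟨hv.ne.symm, h⟩
          rw [hb, mem_singleton] at this
          exact absurd this hvb
        · exact h
      have := hNx' p hp h1; have := hNx' q hq h2
      grind
  have hDx := two x y hx hy hxy hO hN
  have hDy := two y x hy hx (Ne.symm hxy) (by rwa [insert_comm]) fun u hu v huv => by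
    have := hN u hu v huv; tauto
  have hS : insert x (insert y B) ≠ univ := by
    intro hu
    rw [hu] at hOne
    simp at hOne
  by_cases hw0 : B ∩ W = ∅
  · refine h.delete (insert x (insert y B)) {x, y} hS (by simp) ?_ ?_
      (by have := card_le_two (a := x) (b := y); omega) (.inl card_le_two)
    · intro v hv
      simp only [mem_insert] at hv
      rcases hv with rfl | rfl | hv
      · exact hDx.mono fun u hu hvu => ⟨hvu, by simp [hu]⟩
      · exact hDy.mono fun u hu hvu => ⟨hvu, by simp [hu]⟩
      · exact (h.d2 v).mono fun u _ hvu => ⟨hvu, by have := hN v hv u hvu; simp; tauto⟩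
    · intro v hv hv'
      simp only [mem_insert, mem_singleton] at hv hv'
      have hvB : v ∈ B := by tauto
      refine (h.d3 v fun hvW => ?_).mono fun u _ hvu =>
        ⟨hvu, by have := hN v hvB u hvu; simp; tauto⟩
      have : v ∈ B ∩ W := mem_inter.2 ⟨hvB, hvW⟩
      simp [hw0] at this
  obtain ⟨w, hwBW⟩ := nonempty_iff_ne_empty.2 hw0
  have hw1 : ∀ v ∈ B, v ∈ W → v = w := fun v hv hvW =>
    card_le_one.1 hw v (mem_inter.2 ⟨hv, hvW⟩) w hwBW
  obtain ⟨hwB, hwW⟩ := mem_inter.1 hwBW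
  have hcomm : ∀ u v, u ≠ v → G.Adj x u → G.Adj y u → G.Adj x v → G.Adj y v → False :=
    fun u v huv h1 h2 h3 h4 => h.free.no_square h1.symm h3 h4.symm h2 huv hxy
  -- a path of length two modulo four
  obtain ⟨M₁, h1, h1n, h1l, h1S⟩ : ∃ l, Seg G x l y ∧ l.Nodup ∧ l.length % 4 = 1 ∧
      ∀ u ∈ l, u ∈ B := by
    obtain ⟨z, hz⟩ := hOne
    have hz' : z ≠ x ∧ z ≠ y ∧ z ∉ B := by simpa using hz
    have hz2 : z ∉ insert x (insert y B) := mem_compl.1 hz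
    have hadj : ∀ u v, u ≠ z → v ≠ z → G.Adj u v → (handle G x y z).Adj u v :=
      fun u v hu hv huv => ⟨huv.ne, .inl ⟨hu, hv, huv⟩⟩
    have hne : ∀ u ∈ B, u ≠ z := by rintro u hu rfl; exact hz'.2.2 hu
    have hc := h.red (handle G x y z) (insert z (insert x (insert y B))) {w, z} ?_ (by simp) ?_ ?_
      (by have := card_le_two (a := w) (b := z); omega) (.inl card_le_two)
    · obtain ⟨l, hl, hln, hll, hlS⟩ := h.free.exists_path_of_handle hc
      exact ⟨l, hl, hln, hll, fun u hu => by have := hlS u hu; simp at this; tauto⟩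
    · rw [card_insert_of_notMem hz2]
      rw [card_compl] at hO
      omega
    · intro v hv
      simp only [mem_insert] at hv
      rcases hv with rfl | rfl | rfl | hv
      · exact ⟨x, y, hxy, by simp, by simp, ⟨hz'.1, .inr (.inl ⟨rfl, by simp⟩)⟩,
          ⟨hz'.2.1, .inr (.inl ⟨rfl, by simp⟩)⟩⟩
      · exact hDx.mono fun u hu hvu => ⟨hadj _ _ hz'.1.symm (hne u hu) hvu, by simp [hu]⟩
      · exact hDy.mono fun u hu hvu => ⟨hadj _ _ hz'.2.1.symm (hne u hu) hvu, by simp [hu]⟩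
      · refine (h.d2 v).mono fun u _ hvu => ?_
        have := hN v hv u hvu
        exact ⟨hadj _ _ (hne v hv) (by rintro rfl; tauto) hvu, by simp; tauto⟩
    · intro v hv hv'
      simp only [mem_insert, mem_singleton, not_or] at hv hv'
      rcases hv with rfl | rfl | rfl | hv
      · tauto
      · obtain ⟨a, b, hab, ha, hb, h1, h2⟩ := hDx
        exact ⟨a, b, z, hab, hne a ha, hne b hb, by simp [ha], by simp [hb], by simp,
          hadj _ _ hz'.1.symm (hne a ha) h1, hadj _ _ hz'.1.symm (hne b hb) h2,
          ⟨hz'.1.symm, .inr (.inr ⟨rfl, by simp⟩)⟩⟩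
      · obtain ⟨a, b, hab, ha, hb, h1, h2⟩ := hDy
        exact ⟨a, b, z, hab, hne a ha, hne b hb, by simp [ha], by simp [hb], by simp,
          hadj _ _ hz'.2.1.symm (hne a ha) h1, hadj _ _ hz'.2.1.symm (hne b hb) h2,
          ⟨hz'.2.1.symm, .inr (.inr ⟨rfl, by simp⟩)⟩⟩
      · refine (h.d3 v fun hvW => hv'.1 (hw1 v hv hvW)).mono fun u _ hvu => ?_
        have := hN v hv u hvu
        exact ⟨hadj _ _ (hne v hv) (by rintro rfl; tauto) hvu, by simp; tauto⟩
  -- a path of length zero modulo four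
  have hwc : ¬ (G.Adj x w ∧ G.Adj y w) := by
    rintro ⟨hxw, hyw⟩
    have hNw := h.adj_iff hwW hxw.symm hyw.symm hxy
    obtain ⟨p, hp, hpw, hxp⟩ : ∃ p ∈ B, p ≠ w ∧ G.Adj x p := by
      obtain ⟨a, b, hab, ha, hb, h1, h2⟩ := hDx
      by_cases haw : a = w
      · exact ⟨b, hb, fun h => hab (haw.trans h.symm), h2⟩
      · exact ⟨a, ha, haw, h1⟩
    obtain ⟨q, hq, hqw, hyq⟩ : ∃ p ∈ B, p ≠ w ∧ G.Adj y p := by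
      obtain ⟨a, b, hab, ha, hb, h1, h2⟩ := hDy
      by_cases haw : a = w
      · exact ⟨b, hb, fun h => hab (haw.trans h.symm), h2⟩
      · exact ⟨a, ha, haw, h1⟩
    have hpq : p ≠ q := by
      rintro rfl
      exact hcomm p w hpw hxp hyq hxw hyw
    have hcB : #(B.erase w) = #B - 1 := card_erase_of_mem hwB
    refine ih _ ?_ (B.erase w) x y (by simp [hx]) (by simp [hy]) ?_ ?_ ?_ ?_ rfl
    · have := card_pos.2 hBne
      omega
    · exact one_lt_card.2 ⟨p, by simp [hp, hpw], q, by simp [hq, hqw], hpq⟩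
    · refine hO.trans (card_le_card ?_)
      intro v
      simp
      tauto
    · intro u hu v huv
      have hu' := mem_erase.1 hu
      rcases hN u hu'.2 v huv with h | h
      · left
        refine mem_erase.2 ⟨?_, h⟩
        rintro rfl
        rcases (hNw u).1 huv.symm with rfl | rfl
        · exact hx hu'.2
        · exact hy hu'.2
      · exact .inr h
    · exact (card_le_card (inter_subset_inter_right (erase_subset _ _))).trans hw
  obtain ⟨M₃, h3, h3n, h3l, h3S⟩ : ∃ l, Seg G x l y ∧ l.Nodup ∧ l.length % 4 = 3 ∧
      ∀ u ∈ l, u ∈ B := by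
    have hxD : D3 (ident G x y) (insert x B) x := by
      obtain ⟨a, b, hab, ha, hb, h1, h2⟩ := hDx
      obtain ⟨c, hc, hca, hcb, h3⟩ : ∃ c ∈ B, c ≠ a ∧ c ≠ b ∧ G.Adj y c := by
        obtain ⟨c, d, hcd, hc, hd, h3, h4⟩ := hDy
        by_cases hc1 : c = a ∨ c = b
        · refine ⟨d, hd, ?_, ?_, h4⟩
          · rintro rfl
            rcases hc1 with rfl | rfl
            · exact hcd rfl
            · exact hcomm _ _ hcd h2 h3 h1 h4
          · rintro rfl
            rcases hc1 with rfl | rfl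
            · exact hcomm _ _ hcd h1 h3 h2 h4
            · exact hcd rfl
        · exact ⟨c, hc, by tauto, by tauto, h3⟩
      exact ⟨a, b, c, hab, hca.symm, hcb.symm, by simp [ha], by simp [hb], by simp [hc],
        ident_adj h1, ident_adj h2, ident_adj' h3 (by rintro rfl; exact hx hc)⟩
    obtain ⟨c, hcc⟩ : ∃ c, ∀ v ∈ B, G.Adj v x → G.Adj v y → v = c ∧ v ∉ W := by
      by_cases hex : ∃ c ∈ B, G.Adj c x ∧ G.Adj c y
      · obtain ⟨c, hc, hcx, hcy⟩ := hex
        refine ⟨c, fun v hv hvx hvy => ⟨?_, ?_⟩⟩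
        · by_contra hne
          exact hcomm v c hne hvx.symm hvy.symm hcx.symm hcy.symm
        · intro hvW
          obtain rfl := hw1 v hv hvW
          exact hwc ⟨hvx.symm, hvy.symm⟩
      · exact ⟨x, fun v hv hvx hvy => absurd ⟨v, hv, hvx, hvy⟩ hex⟩
    have hN' : ∀ v ∈ B, ∀ u, G.Adj v u → u ∈ insert x B ∨ u = y := by
      intro v hv u huv
      have := hN v hv u huv
      simp
      tauto
    obtain ⟨l, hl, hln, hll, hlS⟩ := h.ident_path (a := x) (b := y) (insert x B) {w, c} (by simp)
      (by simp [hy, Ne.symm hxy]) (fun v hv => by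
        by_cases hvx : v = x
        · exact hvx ▸ hxD.d2
        · have hvB := (mem_insert.1 hv).resolve_left hvx
          by_cases hv2 : G.Adj v x ∧ G.Adj v y
          · exact (h.d3 v (hcc v hvB hv2.1 hv2.2).2).ident_d2 (hN' v hvB)
          · exact (h.d2 v).ident (by simp) hvx (hN' v hvB) hv2)
      (fun v hv hv' => by
        by_cases hvx : v = x
        · exact hvx ▸ hxD
        · have hvB := (mem_insert.1 hv).resolve_left hvx
          simp only [mem_insert, mem_singleton, not_or] at hv'
          exact (h.d3 v (fun h => hv'.1 (hw1 v hvB h))).ident (by simp) hvx (hN' v hvB)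
            fun hh => hv'.2 (hcc v hvB hh.1 hh.2).1)
      (by have := card_le_two (a := w) (b := c); omega) (.inl card_le_two)
    refine ⟨l, hl, ?_, hll, fun u hu => (mem_insert.1 (hlS u hu).1).resolve_left (hlS u hu).2⟩
    rw [List.nodup_cons, List.nodup_append] at hln
    exact hln.2.1
  refine h.no_even_paths B x y hx hy hxy hN M₁ M₃ h1 h1n h1S h1l h3 h3n h3S h3l hOne ?_
  have hsub : (insert x (insert y B))ᶜ ∩ W ⊆ W.erase w := by
    intro v hv
    simp at hv ⊢
    refine ⟨?_, by tauto⟩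
    rintro rfl
    tauto
  have := card_le_card hsub
  rw [card_erase_of_mem hwW] at this
  have := h.card_le
  omega

end

section

variable {V : Type*} [Fintype V] [DecidableEq V] {G : SimpleGraph V} {W : Finset V}

/-- Merging the ends of the path `p w x w' q`. -/
theorem Crit.path_reduce (h : Crit G W) {x w w' p q r : V} (hwx : G.Adj w x) (hwp : G.Adj w p)
    (hw'x : G.Adj w' x) (hw'q : G.Adj w' q) (hww : w ≠ w') (hqw : q ≠ w) (hqx : q ≠ x)
    (hNx : ∀ u, G.Adj x u ↔ u = w ∨ u = w' ∨ u = r) (hrW : r ∉ W) (hrq : ¬ G.Adj r q)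
    (S W' C : Finset V) (hS : S ⊆ {w, x, w', q}ᶜ) (hp : p ∈ S) (hN : ∀ v ∈ S, v ≠ p →
      ∀ u, G.Adj v u → u ∈ S ∨ u = q ∨ u = x)
    (hC : ∀ v ∈ S, G.Adj v p → G.Adj v q → v ∈ C ∧ v ∉ W) (h2 : D2 (ident G p q) S p)
    (h3 : p ∉ W' → D3 (ident G p q) S p)
    (hW : S ∩ insert r (C ∪ (W.erase w).erase w') ⊆ W') (hc : #W' ≤ 3) (hbig : #W' ≤ 2 ∨ 9 ≤ #S) :
    False := by
  have hS' : ∀ v ∈ S, v ≠ w ∧ v ≠ x ∧ v ≠ w' ∧ v ≠ q := fun v hv => by simpa using hS hv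
  have hrC : ∀ v ∈ S, (v = r → v ∈ W') ∧ (v ∈ C → v ∈ W') ∧ (v ≠ w' → v ≠ w → v ∈ W → v ∈ W') :=
    fun v hv => ⟨fun h => hW (by simp [← h, hv]), fun h => hW (by simp [h, hv]),
      fun h1 h2 h3 => hW (by simp [h1, h2, h3, hv])⟩
  have hN' : ∀ v ∈ S, v ≠ p → v ≠ r → ∀ u, G.Adj v u → u ∈ S ∨ u = q := by
    intro v hv hvp hvr u hvu
    rcases hN v hv hvp u hvu with h | h | rfl
    · exact .inl h
    · exact .inr h
    · have := (hNx v).1 hvu.symm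
      have := hS' v hv
      tauto
  refine h.ident_false S W' hp (fun hq => (hS' q hq).2.2.2 rfl) (p := w) (q := x) (r := w')
    (by simp [hwp.symm, hwx, hw'x.symm, hw'q])
    (by have := hwx.ne; have := hw'x.ne; simp; grind) ?_ ?_ ?_ hc hbig
  · intro u hu
    have := hS' u
    have := hw'q.ne
    simp at hu
    grind
  · intro v hv
    by_cases hvp : v = p
    · exact hvp ▸ h2
    by_cases hvr : v = r
    · subst hvr
      refine (h.d3 v hrW).erase x fun u _ hu hux => ⟨⟨hu.ne, .inl hu⟩, ?_⟩
      rcases hN v hv hvp u hu with h | rfl | h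
      · exact h
      · exact absurd hu hrq
      · exact absurd h hux
    by_cases hvC : G.Adj v p ∧ G.Adj v q
    · exact (h.d3 v (hC v hv hvC.1 hvC.2).2).ident_d2 (hN' v hv hvp hvr)
    · exact (h.d2 v).ident hp hvp (hN' v hv hvp hvr) hvC
  · intro v hv hv'
    by_cases hvp : v = p
    · subst hvp
      exact h3 hv'
    have h1 := hrC v hv
    have h2 := hS' v hv
    have hvr : v ≠ r := by tauto
    exact (h.d3 v (by tauto)).ident hp hvp (hN' v hv hvp hvr) fun hh =>
      hv' (h1.2.1 (hC v hv hh.1 hh.2).1)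

end

section

variable {V : Type*} [Fintype V] [DecidableEq V] {G : SimpleGraph V} {W : Finset V}

theorem Crit.no_star (h : Crit G W) {x w₁ w₂ w₃ : V} (hw₁ : w₁ ∈ W) (hw₂ : w₂ ∈ W) (hw₃ : w₃ ∈ W)
    (hC : Cubic G x w₁ w₂ w₃) : False := by
  obtain ⟨n12, n13, n23, hNx⟩ := id hC
  obtain ⟨a1, a2, a3⟩ := hC.adj
  obtain ⟨p₁, p1, hN1⟩ := h.nbr_of_mem hw₁ a1.symm
  obtain ⟨p₂, p2, hN2⟩ := h.nbr_of_mem hw₂ a2.symm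
  obtain ⟨p₃, p3, hN3⟩ := h.nbr_of_mem hw₃ a3.symm
  have b1 : G.Adj w₁ p₁ := (hN1 _).2 (by simp)
  have b2 : G.Adj w₂ p₂ := (hN2 _).2 (by simp)
  have b3 : G.Adj w₃ p₃ := (hN3 _).2 (by simp)
  have nW : ∀ {w p}, w ∈ W → G.Adj w p → p ∉ W := fun hw ha hp => h.not_adj hw hp ha
  have q12 : p₁ ≠ p₂ := by rintro rfl; exact h.free.no_square a1 b1 b2.symm a2.symm p1.symm n12
  have q13 : p₁ ≠ p₃ := by rintro rfl; exact h.free.no_square a1 b1 b3.symm a3.symm p1.symm n13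
  have q23 : p₂ ≠ p₃ := by rintro rfl; exact h.free.no_square a2 b2 b3.symm a3.symm p2.symm n23
  have hx : x ∉ W := nW hw₁ a1.symm
  have c1 := nW hw₁ b1; have c2 := nW hw₂ b2; have c3 := nW hw₃ b3
  have nex : ∀ w ∈ W, w ≠ x := by rintro w hw rfl; exact hx hw
  have ne1 : ∀ w ∈ W, w ≠ p₁ := by rintro w hw rfl; exact c1 hw
  have ne2 : ∀ w ∈ W, w ≠ p₂ := by rintro w hw rfl; exact c2 hw
  have ne3 : ∀ w ∈ W, w ≠ p₃ := by rintro w hw rfl; exact c3 hw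
  have h3 : #({w₁, w₂, w₃} : Finset V) = 3 := card_eq_three.2 ⟨_, _, _, n12, n13, n23, rfl⟩
  have hWeq : {w₁, w₂, w₃} = W := eq_of_subset_of_card_le (by intro v; simp; grind) (by
    rw [h3]; exact h.card_le)
  have hn : 9 ≤ Fintype.card V := by have := h.big; rw [← hWeq, h3] at this; omega
  obtain ⟨S, hS⟩ : ∃ S : Finset V, S = {x, w₁, w₂, w₃}ᶜ := ⟨_, rfl⟩
  have mem : ∀ v, v ∈ S ↔ v ≠ x ∧ v ≠ w₁ ∧ v ≠ w₂ ∧ v ≠ w₃ := by intro v; simp [hS]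
  have hSW : ∀ v ∈ S, v ∉ W := by
    intro v hv
    have := (mem v).1 hv
    rw [← hWeq]
    simp
    tauto
  have hcS : #S = Fintype.card V - 4 := by
    rw [hS, card_compl, card_insert_of_notMem (by
      have := nex _ hw₁; have := nex _ hw₂; have := nex _ hw₃; simp; grind), h3]
  have nb : ∀ v ∈ S, ∀ u, G.Adj v u → u ∉ S →
      (v = p₁ ∧ u = w₁) ∨ (v = p₂ ∧ u = w₂) ∨ (v = p₃ ∧ u = w₃) := by
    intro v hv u hvu hu
    have hv' := (mem v).1 hv
    have hu' : u = x ∨ u = w₁ ∨ u = w₂ ∨ u = w₃ := by rw [mem] at hu; tauto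
    have hs := hvu.symm
    rcases hu' with rfl | rfl | rfl | rfl
    · have := (hNx v).1 hs; tauto
    · have := (hN1 v).1 hs; tauto
    · have := (hN2 v).1 hs; tauto
    · have := (hN3 v).1 hs; tauto
  by_cases hN : Fintype.card V ≤ 12
  · have d1 := nex _ hw₁; have d2 := nex _ hw₂; have d3 := nex _ hw₃
    have e1 := ne1 _ hw₁; have e2 := ne1 _ hw₂; have e3 := ne1 _ hw₃
    have f1 := ne2 _ hw₁; have f2 := ne2 _ hw₂; have f3 := ne2 _ hw₃
    have g1 := ne3 _ hw₁; have g2 := ne3 _ hw₂; have g3 := ne3 _ hw₃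
    refine h.not_refute hn hN x [x, w₁, w₂, w₃, p₁, p₂, p₃] (m := 7) rfl
      (E := [(0, 1), (0, 2), (0, 3), (1, 4), (2, 5), (3, 6)]) (op := [6, 5, 4])
      (cl := [(0, [1, 2, 3]), (1, [0, 4]), (2, [0, 5]), (3, [0, 6])]) (tw := [1, 2, 3])
      refute_star (by decide +kernel) ?_ ?_ ?_ ?_
    · clear nb ne1 ne2 ne3 nex mem hSW hNx hN1 hN2 hN3
      simp
      grind
    · simp [a1, a2, a3, b1, b2, b3]
    · simp [hNx, hN1, hN2, hN3]
    · simp [hw₁, hw₂, hw₃]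
  · refine h.delete S {p₁, p₂, p₃} (fun hu => by have := mem_univ x; rw [← hu, hS] at this; simp at this)
      (card_pos.1 (by omega)) ?_ ?_ card_le_three (.inr (by omega))
    · intro v hv
      obtain ⟨r, hr⟩ : ∃ r, ∀ u, G.Adj v u → u ∉ S → u = r := by
        by_cases h1 : v = p₁
        · exact ⟨w₁, fun u hu huS => by have := nb v hv u hu huS; grind⟩
        by_cases h2 : v = p₂
        · exact ⟨w₂, fun u hu huS => by have := nb v hv u hu huS; grind⟩
        · exact ⟨w₃, fun u hu huS => by have := nb v hv u hu huS; grind⟩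
      refine (h.d3 v (hSW v hv)).erase r fun u _ hu hur => ⟨hu, ?_⟩
      by_contra huS
      exact hur (hr u hu huS)
    · intro v hv hv'
      refine (h.d3 v (hSW v hv)).mono fun u _ hu => ⟨hu, ?_⟩
      by_contra huS
      have := nb v hv u hu huS
      simp at hv'
      tauto

end

section

variable {V : Type*} [Fintype V] [DecidableEq V] {G : SimpleGraph V} {W : Finset V}

/-- The path `p w x w' q` through two vertices `w`, `w'` of degree two, where `r` is the third
neighbour of `x`. -/
structure Fork (G : SimpleGraph V) (W : Finset V) (p w x w' q r p₁ p₂ q₁ q₂ : V) : Prop where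
  hw : w ∈ W
  hw' : w' ∈ W
  hww : w ≠ w'
  hwx : G.Adj w x
  hw'x : G.Adj w' x
  hwp : G.Adj w p
  hw'q : G.Adj w' q
  hCx : Cubic G x w w' r
  hrW : r ∉ W
  hNw : ∀ u, G.Adj w u ↔ u = x ∨ u = p
  hNw' : ∀ u, G.Adj w' u ↔ u = x ∨ u = q
  hpx : p ≠ x
  hqx : q ≠ x
  hpq : p ≠ q
  hpx' : ¬ G.Adj x p
  hqx' : ¬ G.Adj x q
  hrp : r ≠ p
  hrq : r ≠ q
  hrp' : ¬ G.Adj r p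
  hrq' : ¬ G.Adj r q
  hpW : p ∉ W
  hqW : q ∉ W
  hwne : w ≠ x ∧ w ≠ p ∧ w ≠ q ∧ w ≠ r
  hw'ne : w' ≠ x ∧ w' ≠ p ∧ w' ≠ q ∧ w' ≠ r
  hCp : Cubic G p w p₁ p₂
  hCq : Cubic G q w' q₁ q₂

variable {p w x w' q r p₁ p₂ q₁ q₂ : V}

theorem Fork.swapP (f : Fork G W p w x w' q r p₁ p₂ q₁ q₂) : Fork G W p w x w' q r p₂ p₁ q₁ q₂ :=
  { f with hCp := f.hCp.swap }

theorem Fork.swapQ (f : Fork G W p w x w' q r p₁ p₂ q₁ q₂) : Fork G W p w x w' q r p₁ p₂ q₂ q₁ :=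
  { f with hCq := f.hCq.swap }

theorem Crit.exists_fork (h : Crit G W) (hw : w ∈ W) (hw' : w' ∈ W) (hww : w ≠ w')
    (hwx : G.Adj w x) (hw'x : G.Adj w' x) : ∃ p q r p₁ p₂ q₁ q₂,
      Fork G W p w x w' q r p₁ p₂ q₁ q₂ := by
  obtain ⟨r, hCx⟩ : ∃ r, Cubic G x w w' r := by
    obtain ⟨a, b, hC⟩ := h.cubic_of_adj_mem hw hwx
    rcases (hC.2.2.2 w').1 hw'x.symm with rfl | rfl | rfl
    · exact absurd rfl hww
    · exact ⟨b, hC⟩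
    · exact ⟨a, hC.swap⟩
  have hrW : r ∉ W := fun hr => h.no_star hw hw' hr hCx
  obtain ⟨p, hpx, hNw⟩ := h.nbr_of_mem hw hwx
  obtain ⟨q, hqx, hNw'⟩ := h.nbr_of_mem hw' hw'x
  have hwp : G.Adj w p := (hNw _).2 (by simp)
  have hw'q : G.Adj w' q := (hNw' _).2 (by simp)
  have hxr := hCx.adj.2.2
  have hpq : p ≠ q := by
    rintro rfl
    exact h.free.no_square hwx hw'x.symm hw'q hwp.symm hww hpx.symm
  have hpx' : ¬ G.Adj x p := fun ha => h.no_triangle hw hwx hwp ha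
  have hqx' : ¬ G.Adj x q := fun ha => h.no_triangle hw' hw'x hw'q ha
  have hpW : p ∉ W := fun hp => h.not_adj hw hp hwp
  have hqW : q ∉ W := fun hq => h.not_adj hw' hq hw'q
  have hxW : x ∉ W := fun hx => h.not_adj hw hx hwx
  obtain ⟨p₁, p₂, hCp⟩ := h.cubic_of_adj_mem hw hwp
  obtain ⟨q₁, q₂, hCq⟩ := h.cubic_of_adj_mem hw' hw'q
  refine ⟨p, q, r, p₁, p₂, q₁, q₂, hw, hw', hww, hwx, hw'x, hwp, hw'q, hCx, hrW, hNw, hNw', hpx,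
    hqx, hpq, hpx', hqx', ?_, ?_, ?_, ?_, hpW, hqW, ?_, ?_, hCp, hCq⟩
  · rintro rfl; exact hpx' hxr
  · rintro rfl; exact hqx' hxr
  · exact fun ha => h.free.no_square hxr ha hwp.symm hwx hpx.symm hCx.2.1.symm
  · exact fun ha => h.free.no_square hxr ha hw'q.symm hw'x hqx.symm hCx.2.2.1.symm
  · refine ⟨?_, ?_, ?_, ?_⟩ <;> rintro rfl <;> contradiction
  · refine ⟨?_, ?_, ?_, ?_⟩ <;> rintro rfl <;> contradiction

theorem Fork.hN (f : Fork G W p w x w' q r p₁ p₂ q₁ q₂) :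
    ∀ v ∈ ({w, x, w', q}ᶜ : Finset V), v ≠ p → ∀ u, G.Adj v u →
      u ∈ ({w, x, w', q}ᶜ : Finset V) ∨ u = q ∨ u = x := by
  intro v hv hvp u hvu
  simp only [mem_compl, mem_insert, mem_singleton, not_or] at hv ⊢
  by_contra hcon
  have hu : u = w ∨ u = w' := by tauto
  rcases hu with rfl | rfl
  · have := (f.hNw v).1 hvu.symm; tauto
  · have := (f.hNw' v).1 hvu.symm; tauto

theorem Fork.card (f : Fork G W p w x w' q r p₁ p₂ q₁ q₂) :
    #({w, x, w', q}ᶜ : Finset V) = Fintype.card V - 4 := by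
  have h1 := f.hwne; have h2 := f.hw'ne; have := f.hww; have := f.hqx
  rw [card_compl, card_insert_of_notMem (by simp; tauto), card_insert_of_notMem (by
    simp; grind), card_insert_of_notMem (by simp; tauto), card_singleton]

theorem Fork.card_W (f : Fork G W p w x w' q r p₁ p₂ q₁ q₂) :
    #((W.erase w).erase w') = #W - 2 ∧ 2 ≤ #W := by
  refine ⟨?_, one_lt_card.2 ⟨w, f.hw, w', f.hw', f.hww⟩⟩
  rw [card_erase_of_mem (by simp [f.hw', f.hww.symm]), card_erase_of_mem f.hw]
  omega

theorem Fork.memP (f : Fork G W p w x w' q r p₁ p₂ q₁ q₂) {u : V} (hu : G.Adj p u) (huw : u ≠ w)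
    (huq : u ≠ q) : u ∈ ({w, x, w', q}ᶜ : Finset V) := by
  simp only [mem_compl, mem_insert, mem_singleton, not_or]
  refine ⟨huw, ?_, ?_, huq⟩
  · rintro rfl; exact f.hpx' hu.symm
  · rintro rfl
    rcases (f.hNw' p).1 hu.symm with h | h
    · exact f.hpx h
    · exact f.hpq h

theorem Fork.memQ (f : Fork G W p w x w' q r p₁ p₂ q₁ q₂) {u : V} (hu : G.Adj q u) (huw : u ≠ w') :
    u ∈ ({w, x, w', q}ᶜ : Finset V) := by
  simp only [mem_compl, mem_insert, mem_singleton, not_or]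
  refine ⟨?_, ?_, huw, hu.ne.symm⟩
  · rintro rfl
    rcases (f.hNw q).1 hu.symm with h | h
    · exact f.hqx h
    · exact f.hpq h.symm
  · rintro rfl; exact f.hqx' hu.symm

theorem Fork.reduce (h : Crit G W) (f : Fork G W p w x w' q r p₁ p₂ q₁ q₂) (S W' C : Finset V)
    (hS : S ⊆ {w, x, w', q}ᶜ) (hp : p ∈ S)
    (hcl : ∀ v ∈ S, v ≠ p → ∀ u, G.Adj v u → u ∈ ({w, x, w', q}ᶜ : Finset V) → u ∈ S)
    (hC : ∀ v ∈ S, G.Adj v p → G.Adj v q → v ∈ C ∧ v ∉ W) (h2 : D2 (ident G p q) S p)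
    (h3 : p ∉ W' → D3 (ident G p q) S p)
    (hW : S ∩ insert r (C ∪ (W.erase w).erase w') ⊆ W') (hc : #W' ≤ 3) (hbig : #W' ≤ 2 ∨ 9 ≤ #S) :
    False :=
  h.path_reduce f.hwx f.hwp f.hw'x f.hw'q f.hww f.hwne.2.2.1.symm f.hqx f.hCx.2.2.2 f.hrW f.hrq' S W' C hS
    hp (fun v hv hvp u hvu => (f.hN v (hS hv) hvp u hvu).imp_left (hcl v hv hvp u hvu)) hC h2 h3 hW
    hc hbig

theorem Fork.p_mem (f : Fork G W p w x w' q r p₁ p₂ q₁ q₂) :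
    p ∈ ({w, x, w', q}ᶜ : Finset V) := by
  have h1 := f.hwne; have h2 := f.hw'ne; have := f.hpx; have := f.hpq
  simp; grind

theorem Fork.uniq (h : Crit G W) (f : Fork G W p w x w' q r p₁ p₂ q₁ q₂) {u v : V} (h1 : G.Adj p u)
    (h2 : G.Adj q u) (h3 : G.Adj p v) (h4 : G.Adj q v) : u = v := by
  by_contra huv
  exact h.free.no_square h1 h2.symm h4 h3.symm f.hpq huv

theorem Fork.common (h : Crit G W) (f : Fork G W p w x w' q r p₁ p₂ q₁ q₂) (hpq : ¬ G.Adj p q) :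
    ∃ c, G.Adj p c ∧ G.Adj q c := by
  by_contra hno
  push Not at hno
  have hc := f.card
  have hW := f.card_W
  have hc3 := h.card_le
  have hbig := h.big
  obtain ⟨-, a1, a2⟩ := f.hCp.adj
  obtain ⟨-, b1, -⟩ := f.hCq.adj
  have hp1 := hno _ a1
  have hp2 := hno _ a2
  have h3 : D3 (ident G p q) {w, x, w', q}ᶜ p := by
    refine ⟨p₁, p₂, q₁, f.hCp.2.2.1, ?_, ?_, f.memP a1 f.hCp.1.symm ?_, f.memP a2 f.hCp.2.1.symm ?_,
      f.memQ b1 f.hCq.1.symm, ident_adj a1, ident_adj a2, ident_adj' b1 ?_⟩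
    · rintro rfl; exact hp1 b1
    · rintro rfl; exact hp2 b1
    · rintro rfl; exact hpq a1
    · rintro rfl; exact hpq a2
    · rintro rfl; exact hpq b1.symm
  have := card_insert_le r ((W.erase w).erase w')
  exact f.reduce h _ (insert r ((W.erase w).erase w')) ∅ subset_rfl f.p_mem (by simp)
    (fun v _ h1 h2 => absurd h2.symm (hno _ h1.symm)) h3.d2 (fun _ => h3)
    (by rw [empty_union]; exact inter_subset_right) (by omega) (by omega)

theorem Fork.not_mem_common (h : Crit G W) (f : Fork G W p w x w' q r p₁ p₂ q₁ q₂) {c : V}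
    (hpc : G.Adj p c) (hqc : G.Adj q c) : c ∉ W := by
  intro hc
  have hpq : ¬ G.Adj p q := fun ha => h.no_triangle hc hpc.symm hqc.symm ha
  have hNc := h.adj_iff hc hpc.symm hqc.symm f.hpq
  have hcw : c ≠ w := by
    rintro rfl
    rcases (f.hNw q).1 hqc.symm with h | h
    · exact f.hqx h
    · exact f.hpq h.symm
  have hcw' : c ≠ w' := by
    rintro rfl
    rcases (f.hNw' p).1 hpc.symm with h | h
    · exact f.hpx h
    · exact f.hpq h
  obtain ⟨p', hp', hpp'⟩ : ∃ p', p' ≠ c ∧ p' ≠ w ∧ G.Adj p p' := by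
    obtain ⟨-, a1, a2⟩ := f.hCp.adj
    by_cases h1 : p₁ = c
    · exact ⟨p₂, h1 ▸ f.hCp.2.2.1.symm, f.hCp.2.1.symm, a2⟩
    · exact ⟨p₁, h1, f.hCp.1.symm, a1⟩
  obtain ⟨q', hq', hqq'⟩ : ∃ p', p' ≠ c ∧ p' ≠ w' ∧ G.Adj q p' := by
    obtain ⟨-, a1, a2⟩ := f.hCq.adj
    by_cases h1 : q₁ = c
    · exact ⟨q₂, h1 ▸ f.hCq.2.2.1.symm, f.hCq.2.1.symm, a2⟩
    · exact ⟨q₁, h1, f.hCq.1.symm, a1⟩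
  have hWeq : {w, w', c} = W := eq_of_subset_of_card_le
    (by simp [insert_subset_iff, f.hw, f.hw', hc]) (by
      rw [card_eq_three.2 ⟨_, _, _, f.hww, hcw.symm, hcw'.symm, rfl⟩]; exact h.card_le)
  refine f.reduce h (({w, x, w', q}ᶜ : Finset V).erase c) {r, p} ∅ (erase_subset _ _) ?_ ?_ ?_ ?_ ?_
    ?_ (card_le_two.trans (by simp)) (.inl card_le_two)
  · exact mem_erase.2 ⟨hpc.ne, f.p_mem⟩
  · intro v hv hvp u hvu hu
    refine mem_erase.2 ⟨?_, hu⟩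
    rintro rfl
    rcases (hNc v).1 hvu.symm with h | h
    · exact hvp h
    · subst h
      simp at hv
  · intro v hv h1 h2
    exact absurd (f.uniq h h1.symm h2.symm hpc hqc) (mem_erase.1 hv).1
  · refine ⟨p', q', ?_, mem_erase.2 ⟨hp', f.memP hpp'.2 hpp'.1 ?_⟩,
      mem_erase.2 ⟨hq', f.memQ hqq'.2 hqq'.1⟩, ident_adj hpp'.2, ident_adj' hqq'.2 ?_⟩
    · rintro rfl
      exact hp' (f.uniq h hpp'.2 hqq'.2 hpc hqc)
    · rintro rfl; exact hpq hpp'.2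
    · rintro rfl; exact hpq hqq'.2.symm
  · intro hp; simp at hp
  · rw [← hWeq]
    intro v hv
    simp at hv ⊢
    tauto

theorem Fork.not_common (h : Crit G W) (f : Fork G W p w x w' q r p₁ p₂ p₁ q₂)
    (hpq : ¬ G.Adj p q) : False := by
  have hc := f.card
  have hW := f.card_W
  have hc3 := h.card_le
  have hbig := h.big
  obtain ⟨-, a1, a2⟩ := f.hCp.adj
  obtain ⟨-, b1, b2⟩ := f.hCq.adj
  have hcW := f.not_mem_common h a1 b1
  have hpq2 : p₂ ≠ q₂ := by
    rintro rfl
    exact f.hCp.2.2.1 (f.uniq h a1 b1 a2 b2)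
  by_cases hbig' : #W ≤ 2 ∨ 13 ≤ Fintype.card V
  · have h3 : D3 (ident G p q) {w, x, w', q}ᶜ p := by
      refine ⟨p₁, p₂, q₂, f.hCp.2.2.1, f.hCq.2.2.1, hpq2,
        f.memP a1 f.hCp.1.symm ?_, f.memP a2 f.hCp.2.1.symm ?_,
        f.memQ b2 f.hCq.2.1.symm, ident_adj a1, ident_adj a2, ident_adj' b2 ?_⟩
      · rintro rfl; exact hpq a1
      · rintro rfl; exact hpq a2
      · rintro rfl; exact hpq b2.symm
    have := card_insert_le r (insert p₁ ((W.erase w).erase w'))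
    have := card_insert_le p₁ ((W.erase w).erase w')
    exact f.reduce h _ (insert r (insert p₁ ((W.erase w).erase w'))) {p₁} subset_rfl f.p_mem
      (by simp) (fun v _ h1 h2 => by
        obtain rfl := f.uniq h a1 b1 h1.symm h2.symm; simp [hcW]) h3.d2 (fun _ => h3)
      inter_subset_right (by omega) (by omega)
  · have hn : 9 ≤ Fintype.card V := by omega
    have hN : Fintype.card V ≤ 12 := by omega
    refine h.not_refute hn hN x [p, w, x, w', q, r, p₁, p₂, q₂] (m := 9) rfl
      (E := [(0, 1), (1, 2), (2, 3), (3, 4), (2, 5), (0, 6), (4, 6), (0, 7), (4, 8)])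
      (op := [8, 7, 6, 5])
      (cl := [(0, [1, 6, 7]), (1, [2, 0]), (2, [1, 3, 5]), (3, [2, 4]), (4, [3, 6, 8])])
      (tw := [1, 3]) refute_path_common (by decide +kernel) ?_ ?_ ?_ ?_
    · have m1 := f.memP a1 f.hCp.1.symm (by rintro rfl; exact hpq a1)
      have m2 := f.memP a2 f.hCp.2.1.symm (by rintro rfl; exact hpq a2)
      have m3 := f.memQ b2 f.hCq.2.1.symm
      have k1 : r ≠ p₁ := by rintro rfl; exact f.hrp' a1.symm
      have k2 : r ≠ p₂ := by rintro rfl; exact f.hrp' a2.symm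
      have k3 : r ≠ q₂ := by rintro rfl; exact f.hrq' b2.symm
      have k4 : q₂ ≠ p := by rintro rfl; exact hpq b2.symm
      have h1 := f.hwne; have h2 := f.hw'ne; have := f.hpx; have := f.hpq; have := f.hww
      have := f.hqx; have := f.hrp; have := f.hrq; have := f.hCx.adj.2.2.ne
      have := a1.ne; have := a2.ne; have := f.hCp.2.2.1; have := f.hCq.2.2.1
      clear hbig hbig' f h
      simp at m1 m2 m3 ⊢
      grind
    · simp [f.hwp.symm, f.hwx, f.hw'x.symm, f.hw'q, f.hCx.adj.2.2, a1, a2, b1, b2]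
    · simp [f.hCp.2.2.2, f.hCq.2.2.2, f.hCx.2.2.2, f.hNw, f.hNw']
    · simp [f.hw, f.hw']

theorem Fork.adj (h : Crit G W) (f : Fork G W p w x w' q r p₁ p₂ q₁ q₂) : G.Adj p q := by
  by_contra hpq
  obtain ⟨c, h1, h2⟩ := f.common h hpq
  have hcw : c ≠ w := by
    rintro rfl
    rcases (f.hNw q).1 h2.symm with h | h
    · exact f.hqx h
    · exact f.hpq h.symm
  have hcw' : c ≠ w' := by
    rintro rfl
    rcases (f.hNw' p).1 h1.symm with h | h
    · exact f.hpx h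
    · exact f.hpq h
  have g1 := (f.hCp.2.2.2 c).1 h1
  have g2 := (f.hCq.2.2.2 c).1 h2
  rcases g1.resolve_left hcw with rfl | rfl <;> rcases g2.resolve_left hcw' with h3 | h3
  · exact (h3 ▸ f).not_common h hpq
  · exact (h3 ▸ f.swapQ).not_common h hpq
  · exact (h3 ▸ f.swapP).not_common h hpq
  · exact (h3 ▸ f.swapP.swapQ).not_common h hpq

theorem Fork.common_of_adj (h : Crit G W) (f : Fork G W p w x w' q r q p₂ p q₂) : p₂ = q₂ := by
  have hc := f.card
  have hW := f.card_W
  have hc3 := h.card_le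
  have hbig := h.big
  obtain ⟨-, a1, a2⟩ := f.hCp.adj
  obtain ⟨-, b1, b2⟩ := f.hCq.adj
  by_contra hpq2
  by_cases hbig' : #W ≤ 2 ∨ 13 ≤ Fintype.card V
  · have := card_insert_le r (insert p ((W.erase w).erase w'))
    have := card_insert_le p ((W.erase w).erase w')
    refine f.reduce h _ (insert r (insert p ((W.erase w).erase w'))) ∅ subset_rfl f.p_mem
      (by simp) (fun v hv h1 h2 => ?_) ?_ (by simp)
      (inter_subset_right.trans (by rw [empty_union]; exact insert_subset_insert _ (subset_insert _ _)))
      (by omega) (by omega)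
    · exfalso
      have g1 := (f.hCp.2.2.2 v).1 h1.symm
      have g2 := (f.hCq.2.2.2 v).1 h2.symm
      have g3 := f.hw'ne
      have := h1.ne; have := h2.ne
      simp at hv
      grind
    · exact ⟨p₂, q₂, hpq2, f.memP a2 f.hCp.2.1.symm f.hCp.2.2.1.symm, f.memQ b2 f.hCq.2.1.symm,
        ident_adj a2, ident_adj' b2 f.hCq.2.2.1.symm⟩
  · have hn : 9 ≤ Fintype.card V := by omega
    have hN : Fintype.card V ≤ 12 := by omega
    refine h.not_refute hn hN x [p, w, x, w', q, r, p₂, q₂] (m := 8) rfl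
      (E := [(0, 1), (1, 2), (2, 3), (3, 4), (2, 5), (0, 4), (0, 6), (4, 7)])
      (op := [7, 6, 5])
      (cl := [(0, [1, 4, 6]), (1, [2, 0]), (2, [1, 3, 5]), (3, [2, 4]), (4, [3, 0, 7])])
      (tw := [1, 3]) refute_path_adj (by decide +kernel) ?_ ?_ ?_ ?_
    · have m2 := f.memP a2 f.hCp.2.1.symm f.hCp.2.2.1.symm
      have m3 := f.memQ b2 f.hCq.2.1.symm
      have k2 : r ≠ p₂ := by rintro rfl; exact f.hrp' a2.symm
      have k3 : r ≠ q₂ := by rintro rfl; exact f.hrq' b2.symm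
      have h1 := f.hwne; have h2 := f.hw'ne; have := f.hpx; have := f.hpq; have := f.hww
      have := f.hqx; have := f.hrp; have := f.hrq; have := f.hCx.adj.2.2.ne
      have := a2.ne; have := f.hCp.2.2.1; have := f.hCq.2.2.1
      clear hbig hbig' f h
      simp at m2 m3 ⊢
      grind
    · simp [f.hwp.symm, f.hwx, f.hw'x.symm, f.hw'q, f.hCx.adj.2.2, a1, a2, b2]
    · simp [f.hCp.2.2.2, f.hCq.2.2.2, f.hCx.2.2.2, f.hNw, f.hNw']
    · simp [f.hw, f.hw']

end

section

variable {V : Type*} [Fintype V] [DecidableEq V] {G : SimpleGraph V} {W : Finset V}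

variable {p w x w' q r c : V}

theorem Fork.false_of_common (h : Crit G W) (f : Fork G W p w x w' q r q c p c) : False := by
  obtain ⟨B, hB⟩ : ∃ B : Finset V, B = {w, x, w', p, q, r, c}ᶜ := ⟨_, rfl⟩
  have mem : ∀ v, v ∈ B ↔ v ≠ w ∧ v ≠ x ∧ v ≠ w' ∧ v ≠ p ∧ v ≠ q ∧ v ≠ r ∧ v ≠ c := by simp [hB]
  have hN : ∀ u ∈ B, ∀ v, G.Adj u v → v ∈ B ∨ v = r ∨ v = c := by
    intro u hu v huv
    have hu' := (mem u).1 hu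
    by_contra hv
    have hv' : v = w ∨ v = x ∨ v = w' ∨ v = p ∨ v = q := by rw [mem] at hv; tauto
    rcases hv' with rfl | rfl | rfl | rfl | rfl
    · have := (f.hNw u).1 huv.symm; tauto
    · have := (f.hCx.2.2.2 u).1 huv.symm; tauto
    · have := (f.hNw' u).1 huv.symm; tauto
    · have := (f.hCp.2.2.2 u).1 huv.symm; tauto
    · have := (f.hCq.2.2.2 u).1 huv.symm; tauto
  have hrc : r ≠ c := by rintro rfl; exact f.hrp' f.hCp.adj.2.2.symm
  have hW := f.card_W
  have hc3 := h.card_le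
  refine h.sep2 B r c (by simp [mem]) (by simp [mem]) ?_ ?_ hN ?_
  · by_cases ht : #W = 3
    · have h1 : 9 ≤ Fintype.card V := by have := h.big; omega
      have h2 : #({w, x, w', p, q, r, c} : Finset V) ≤ 7 :=
        (card_insert_le _ _).trans (Nat.succ_le_succ card_le_six)
      rw [hB, card_compl]
      omega
    · have hWeq : {w, w'} = W := eq_of_subset_of_card_le
        (by simp [insert_subset_iff, f.hw, f.hw']) (by rw [card_pair f.hww]; omega)
      have key : ∀ v ∉ W, ∀ y z, ∃ u, u ≠ y ∧ u ≠ z ∧ G.Adj v u := by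
        intro v hv y z
        obtain ⟨a, b, hab, ha, hb, h1, h2⟩ := h.two_more hv y
        by_cases haz : a = z
        · exact ⟨b, hb, by rintro rfl; exact hab haz, h2⟩
        · exact ⟨a, ha, haz, h1⟩
      obtain ⟨a, hax, hac, hra⟩ := key r f.hrW x c
      have haB : a ∈ B := by
        rw [mem]
        refine ⟨?_, hax, ?_, ?_, ?_, hra.ne.symm, hac⟩
        · rintro rfl
          rcases (f.hNw r).1 hra.symm with h | h
          · exact f.hCx.adj.2.2.ne h.symm
          · exact f.hrp h
        · rintro rfl
          rcases (f.hNw' r).1 hra.symm with h | h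
          · exact f.hCx.adj.2.2.ne h.symm
          · exact f.hrq h
        · rintro rfl; exact f.hrp' hra
        · rintro rfl; exact f.hrq' hra
      have haW : a ∉ W := by
        have := (mem a).1 haB
        rw [← hWeq]
        simp
        tauto
      obtain ⟨e, her, hec, hae⟩ := key a haW r c
      exact one_lt_card.2 ⟨a, haB, e, ((hN a haB e hae).resolve_right (by tauto)), hae.ne⟩
  · refine one_lt_card.2 ⟨w, ?_, x, ?_, f.hwne.1⟩
    · have := f.hwne
      have : w ≠ c := f.hCp.2.1
      simp [mem]
      tauto
    · have := f.hCx.adj.2.2.ne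
      have : x ≠ c := by rintro rfl; exact f.hpx' f.hCp.adj.2.2.symm
      simp [mem]
      tauto
  · refine (card_le_card (t := (W.erase w).erase w') ?_).trans (by omega)
    intro v hv
    obtain ⟨h1, h2⟩ := mem_inter.1 hv
    have := (mem v).1 h1
    simp only [mem_erase]
    tauto

/-- Two vertices of degree two have no common neighbour. -/
theorem Crit.no_common_nbr (h : Crit G W) (hw : w ∈ W) (hw' : w' ∈ W) (hww : w ≠ w')
    (hwx : G.Adj w x) (hw'x : G.Adj w' x) : False := by
  obtain ⟨p, q, r, p₁, p₂, q₁, q₂, f⟩ := h.exists_fork hw hw' hww hwx hw'x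
  have hpq := f.adj h
  obtain ⟨p₂, hp⟩ : ∃ p₂, Fork G W p w x w' q r q p₂ q₁ q₂ := by
    rcases (f.hCp.2.2.2 q).1 hpq with h1 | h1 | h1
    · exact absurd h1.symm f.hwne.2.2.1
    · exact ⟨p₂, h1 ▸ f⟩
    · exact ⟨p₁, h1 ▸ f.swapP⟩
  obtain ⟨q₂, hq⟩ : ∃ q₂, Fork G W p w x w' q r q p₂ p q₂ := by
    rcases (f.hCq.2.2.2 p).1 hpq.symm with h1 | h1 | h1
    · exact absurd h1.symm f.hw'ne.2.1
    · exact ⟨q₂, h1 ▸ hp⟩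
    · exact ⟨q₁, h1 ▸ hp.swapQ⟩
  obtain rfl := hq.common_of_adj h
  exact hq.false_of_common h

end

section

variable {V : Type*} {G : SimpleGraph V}

/-- An even cycle; in the graphs considered its length is `2` modulo `4`. -/
structure EvenCyc (G : SimpleGraph V) (x : V) (L : List V) : Prop where
  seg : Seg G x L x
  nodup : (x :: L).Nodup
  mod : L.length % 4 = 1
  five : 5 ≤ L.length

theorem Free.evenCyc (hf : Free G) {x : V} {L : List V} (hL : Seg G x L x) (hn : (x :: L).Nodup)
    (h2 : L.length % 2 = 1) (h3 : 2 ≤ L.length) : EvenCyc G x L := by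
  have := hf x L hL hn
  exact ⟨hL, hn, by omega, by omega⟩

theorem isChain_iff_seg {a b : V} {P : List V} :
    List.IsChain G.Adj (a :: (P ++ [b])) ↔ Seg G a P b := by
  induction P generalizing a with
  | nil => simp
  | cons p P ih => simp [← ih]

theorem isChain_of_append_eq {α : Type*} {r : α → α → Prop} {l m A B : List α}
    (h : List.IsChain r l) (he : A ++ m ++ B = l) : List.IsChain r m := by
  subst he
  exact (List.isChain_append.1 (List.isChain_append.1 h).1).2.1

theorem Free.exists_evenCyc_of_chain (hf : Free G) {v a b c : V} {A B C D : List V}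
    (hP : List.IsChain G.Adj (A ++ a :: (B ++ b :: (C ++ c :: D))))
    (hn : (v :: (A ++ a :: (B ++ b :: (C ++ c :: D)))).Nodup)
    (ha : G.Adj v a) (hb : G.Adj v b) (hc : G.Adj v c) : ∃ x L, EvenCyc G x L := by
  have h1 : Seg G a B b :=
    isChain_iff_seg.1 (isChain_of_append_eq (A := A) (B := C ++ c :: D) hP (by simp))
  have h2 : Seg G b C c :=
    isChain_iff_seg.1 (isChain_of_append_eq (A := A ++ a :: B) (B := D) hP (by simp))
  have n1 : (v :: a :: (B ++ [b])).Nodup := by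
    simp only [List.nodup_cons, List.nodup_append, List.mem_append, List.mem_cons] at hn ⊢; grind
  have n2 : (v :: b :: (C ++ [c])).Nodup := by
    simp only [List.nodup_cons, List.nodup_append, List.mem_append, List.mem_cons] at hn ⊢; grind
  have n3 : (v :: a :: (B ++ b :: (C ++ [c]))).Nodup := by
    simp only [List.nodup_cons, List.nodup_append, List.mem_append, List.mem_cons] at hn ⊢; grind
  by_cases hB : B.length % 2 = 1
  · exact ⟨_, _, hf.evenCyc (L := a :: (B ++ [b])) (by simp [ha, h1, hb.symm]) n1
      (by simp; omega) (by simp)⟩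
  by_cases hC : C.length % 2 = 1
  · exact ⟨_, _, hf.evenCyc (L := b :: (C ++ [c])) (by simp [hb, h2, hc.symm]) n2
      (by simp; omega) (by simp)⟩
  · exact ⟨_, _, hf.evenCyc (L := a :: (B ++ b :: (C ++ [c])))
      (by simp [ha, h1, h2, hc.symm]) n3 (by simp; omega) (by simp; omega)⟩

theorem Free.exists_evenCyc_of_d3 [Fintype V] [DecidableEq V] (hf : Free G) {v : V} {P : List V}
    (hP : List.IsChain G.Adj P) (hn : (v :: P).Nodup) (hv : D3 G univ v)
    (hN : ∀ u, G.Adj v u → u ∈ P) : ∃ x L, EvenCyc G x L := by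
  classical
  obtain ⟨a, b, c, hab, hac, hbc, -, -, -, ha, hb, hc⟩ := hv
  have h3 : 3 ≤ (P.filter (G.Adj v ·)).length := by
    have h : {a, b, c} ⊆ (P.filter (G.Adj v ·)).toFinset := by
      simp [insert_subset_iff, ha, hb, hc, hN]
    have := (card_le_card h).trans (List.toFinset_card_le _)
    rwa [card_eq_three.2 ⟨_, _, _, hab, hac, hbc, rfl⟩] at this
  obtain ⟨a', b', c', R, hR⟩ : ∃ a b c R, P.filter (G.Adj v ·) = a :: b :: c :: R := by
    rcases hF : P.filter (G.Adj v ·) with _ | ⟨a, _ | ⟨b, _ | ⟨c, R⟩⟩⟩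
    · simp [hF] at h3
    · simp [hF] at h3
    · simp [hF] at h3
    · exact ⟨a, b, c, R, rfl⟩
  have hadj : ∀ u ∈ a' :: b' :: c' :: R, G.Adj v u := by
    rw [← hR]; intro u hu; simpa using (List.mem_filter.1 hu).2
  have hs : List.Sublist [a', b', c'] P := by
    have : List.Sublist [a', b', c'] (P.filter (G.Adj v ·)) := by rw [hR]; simp
    exact this.trans List.filter_sublist
  obtain ⟨r1, r2, rfl, m1, hs1⟩ := List.cons_sublist_iff.1 hs
  obtain ⟨r3, r4, rfl, m2, hs2⟩ := List.cons_sublist_iff.1 hs1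
  obtain ⟨A, A', rfl⟩ := List.append_of_mem m1
  obtain ⟨B, B', rfl⟩ := List.append_of_mem m2
  obtain ⟨C, C', rfl⟩ := List.append_of_mem (List.singleton_sublist.1 hs2)
  exact hf.exists_evenCyc_of_chain (A := A) (B := A' ++ B) (C := B' ++ C) (D := C') (a := a')
    (b := b') (c := c') (by simpa using hP) (by simpa using hn) (hadj _ (by simp))
    (hadj _ (by simp)) (hadj _ (by simp))

variable [Fintype V] [DecidableEq V] {W : Finset V}

theorem Crit.exists_evenCyc (h : Crit G W) (v₀ : V) : ∃ x L, EvenCyc G x L := by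
  obtain ⟨n, ⟨l, hl, hn, rfl⟩, hmax⟩ : ∃ n, (∃ l : List V, List.IsChain G.Adj l ∧ l.Nodup ∧
      l.length = n) ∧ ∀ l : List V, List.IsChain G.Adj l → l.Nodup → l.length ≤ n := by
    have hne : ({n | ∃ l : List V, List.IsChain G.Adj l ∧ l.Nodup ∧ l.length = n}).Nonempty :=
      ⟨0, [], by simp⟩
    have hb : BddAbove {n | ∃ l : List V, List.IsChain G.Adj l ∧ l.Nodup ∧ l.length = n} :=
      ⟨Fintype.card V, by rintro _ ⟨l, -, hl, rfl⟩; exact hl.length_le_card⟩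
    exact ⟨_, Nat.sSup_mem hne hb, fun l h1 h2 => le_csSup hb ⟨l, h1, h2, rfl⟩⟩
  have key : ∀ v P, List.IsChain G.Adj (v :: P) → (v :: P).Nodup → (v :: P).length = l.length →
      ∀ u, G.Adj v u → u ∈ P := by
    intro v P h1 h2 h3 u hu
    by_contra hP
    have := hmax (u :: v :: P) (List.isChain_cons_cons.2 ⟨hu.symm, h1⟩)
      (List.nodup_cons.2 ⟨by simp [hP, hu.ne.symm], h2⟩)
    simp at this h3
    omega
  have hpos : l ≠ [] := by
    rintro rfl
    have := hmax [v₀] (by simp) (by simp)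
    simp at this
  obtain ⟨v, P, rfl⟩ := List.exists_cons_of_ne_nil hpos
  have hN := key v P hl hn rfl
  by_cases hv : v ∈ W
  · obtain ⟨u, z, A, B, rfl, hu⟩ : ∃ u z A B, P = A ++ z :: u :: B ∧ G.Adj v u := by
      obtain ⟨s, hsv⟩ : ∃ s, P.head? = some s := by
        cases P with
        | nil =>
          obtain ⟨a, -, ha⟩ := h.one_more v v
          exact absurd (hN a ha) (by simp)
        | cons s P => exact ⟨s, rfl⟩
      obtain ⟨P, rfl⟩ : ∃ P', P = s :: P' := by
        cases P <;> simp_all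
      obtain ⟨u, hus, hu⟩ := h.one_more v s
      obtain ⟨A, B, hAB⟩ := List.append_of_mem (hN u hu)
      rcases List.eq_nil_or_concat A with rfl | ⟨A, z, rfl⟩
      · simp at hAB
        exact absurd hAB.1.symm hus
      · exact ⟨u, z, A, B, by simpa using hAB, hu⟩
    have hzu : G.Adj z u := by
      have := isChain_of_append_eq (m := [z, u]) (A := v :: A) (B := B) hl (by simp)
      simpa using this
    have hz : z ∉ W := fun hz => h.no_common_nbr hv hz (by rintro rfl; simp at hn) hu hzu
    have hch : List.IsChain G.Adj (z :: (A.reverse ++ v :: u :: B)) := by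
      have h1 : List.IsChain G.Adj (v :: (A ++ [z])) :=
        isChain_of_append_eq (A := []) (B := u :: B) hl (by simp)
      have h2 : List.IsChain G.Adj (u :: B) :=
        isChain_of_append_eq (A := v :: (A ++ [z])) (B := []) hl (by simp)
      have h3 : List.IsChain G.Adj (z :: (A.reverse ++ [v])) :=
        isChain_iff_seg.2 (isChain_iff_seg.1 h1).reverse
      have := List.IsChain.append h3 h2 (by
        intro a ha b hb
        simp only [← List.cons_append, List.getLast?_append, List.getLast?_singleton] at ha
        simp at ha hb
        exact ha ▸ hb ▸ hu)
      simpa using this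
    have hperm : (z :: (A.reverse ++ v :: u :: B)).Perm (v :: (A ++ z :: u :: B)) := by
      have : (A.reverse ++ v :: u :: B).Perm (v :: (A ++ u :: B)) :=
        ((List.reverse_perm A).append_right _).trans List.perm_middle
      exact (this.cons z).trans ((List.Perm.swap _ _ _).trans ((List.perm_middle.symm).cons v))
    have hn' := hperm.nodup_iff.2 hn
    exact h.free.exists_evenCyc_of_d3 hch.tail hn' (h.d3 z hz)
      (key z _ hch hn' hperm.length_eq)
  · exact h.free.exists_evenCyc_of_d3 hl.tail hn (h.d3 v hv) hN

end

section

variable {V : Type*} {G : SimpleGraph V}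

theorem EvenCyc.rotate {x y : V} {P Q : List V} (h : EvenCyc G x (P ++ y :: Q)) :
    EvenCyc G y (Q ++ x :: P) := by
  obtain ⟨h1, h2, h3, h4⟩ := h
  refine ⟨?_, ?_, ?_, ?_⟩
  · simp only [seg_append] at h1 ⊢; exact h1.symm
  · simp only [List.nodup_cons, List.nodup_append, List.mem_append, List.mem_cons] at h2 ⊢; grind
  · simp at h3 ⊢; omega
  · simp at h4 ⊢; omega

theorem EvenCyc.reverse {x y : V} {P Q : List V} (h : EvenCyc G x (P ++ y :: Q)) :
    EvenCyc G x (Q.reverse ++ y :: P.reverse) := by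
  obtain ⟨h1, h2, h3, h4⟩ := h
  refine ⟨?_, ?_, ?_, ?_⟩
  · simp only [seg_append, seg_reverse] at h1 ⊢; exact h1.symm
  · simp only [List.nodup_cons, List.nodup_append, List.mem_append, List.mem_cons,
      List.nodup_reverse, List.mem_reverse] at h2 ⊢
    grind
  · simp at h3 ⊢; omega
  · simp at h4 ⊢; omega

/-- An even cycle is rerouted along a path of the right parity. -/
theorem Free.reroute (hf : Free G) {x y : V} {P Q : List V} (hP : Seg G x P y) (hQ : Seg G y Q x)
    (hn : (x :: (P ++ y :: Q)).Nodup) (h2 : (P.length + Q.length) % 2 = 0)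
    (h3 : P ≠ [] ∨ Q ≠ []) : EvenCyc G x (P ++ y :: Q) := by
  refine hf.evenCyc (by simp [hP, hQ]) hn (by simp; omega) ?_
  have : 0 < P.length ∨ 0 < Q.length := by simpa [List.length_pos_iff] using h3
  simp
  omega

section

variable [DecidableEq V] {D M : Finset V}

theorem Free.bridge_parity (hf : Free G)
    (hM : ∀ x L, EvenCyc G x L → (∀ v ∈ x :: L, v ∉ D) → ∀ m ∈ M, m ∈ x :: L) (hM3 : 3 ≤ #M)
    {x y : V} {R₁ R₂ b : List V} (hC : EvenCyc G x (R₁ ++ y :: R₂))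
    (hD : ∀ v ∈ x :: (R₁ ++ y :: R₂), v ∉ D) (hb : Seg G x b y) (hbn : b.Nodup)
    (hbC : ∀ v ∈ b, v ∉ x :: (R₁ ++ y :: R₂)) (hbD : ∀ v ∈ b, v ∉ D)
    (hnt : b = [] → R₁ ≠ [] ∧ R₂ ≠ []) : (R₁.length + b.length) % 2 = 1 := by
  by_contra hpar
  have hmod := hC.mod
  obtain ⟨s1, s2⟩ := seg_append.1 hC.seg
  have hn := hC.nodup
  simp only [List.length_append, List.length_cons] at hmod
  have e1 : EvenCyc G x (R₁ ++ y :: b.reverse) := by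
    refine hf.reroute s1 hb.reverse ?_ (by simp; omega) (by by_cases b = [] <;> simp_all)
    clear hM hD hC hbD s1 s2 hb hnt
    simp only [List.nodup_cons, List.nodup_append, List.mem_append, List.mem_cons,
      List.nodup_reverse, List.mem_reverse] at hn hbC ⊢
    grind
  have e2 : EvenCyc G x (b ++ y :: R₂) := by
    refine hf.reroute hb s2 ?_ (by omega) (by by_cases b = [] <;> simp_all)
    clear hM hD hC hbD s1 s2 hb hnt
    simp only [List.nodup_cons, List.nodup_append, List.mem_append, List.mem_cons] at hn hbC ⊢
    grind
  have h0 := hM _ _ hC hD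
  have h1 := hM _ _ e1 (by intro v hv; simp at hv; grind)
  have h2 := hM _ _ e2 (by intro v hv; simp at hv; grind)
  have hsub : M ⊆ {x, y} := by
    intro m hm
    have g0 := h0 m hm
    have g1 := h1 m hm
    have g2 := h2 m hm
    clear hM hD hC hbD s1 s2 hb hnt h0 h1 h2 e1 e2
    simp only [List.nodup_cons, List.nodup_append, List.mem_append, List.mem_cons, List.mem_reverse,
      mem_insert, mem_singleton] at hn hbC g0 g1 g2 ⊢
    grind
  have := (card_le_card hsub).trans card_le_two
  omega

end

end

section

variable {V : Type*} [Fintype V] [DecidableEq V] {G : SimpleGraph V} {W D M K : Finset V}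

/-- Every even cycle outside `D` contains `M`, and what lies outside `D` and an even cycle
consists of vertices of degree two. -/
structure Ctx (G : SimpleGraph V) (W D M : Finset V) : Prop where
  cyc : ∀ x L, EvenCyc G x L → (∀ v ∈ x :: L, v ∉ D) → ∀ m ∈ M, m ∈ x :: L
  card : 3 ≤ #M
  off : ∀ x L, EvenCyc G x L → (∀ v ∈ x :: L, v ∉ D) → ∀ c ∈ x :: L, ∀ e, e ∉ x :: L → e ∉ D →
    G.Adj c e → e ∈ W ∧ ∀ u, G.Adj e u → u ∈ x :: L
  cov : ∀ v ∉ D, ∀ u ∈ D, G.Adj v u → v ∈ M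
  ends : ∀ x L, EvenCyc G x L → (∀ v ∈ x :: L, v ∉ D) → ∀ w ∈ W, w ∉ x :: L → w ∉ D →
    5 ≤ #M ∨ ∀ m ∈ M, ¬ G.Adj m w

/-- An even cycle on `K` with a chord, or a path of length two through a vertex of degree two,
joining the vertices `x` and `y`. -/
structure Arc (G : SimpleGraph V) (W D K : Finset V) (x : V) (R₁ : List V) (y : V) (R₂ b : List V) :
    Prop where
  cyc : EvenCyc G x (R₁ ++ y :: R₂)
  mem : ∀ v, v ∈ x :: (R₁ ++ y :: R₂) ↔ v ∈ K
  seg : Seg G x b y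
  type : b = [] ∨ ∃ w ∈ W, b = [w] ∧ w ∉ K ∧ w ∉ D
  nt : b = [] → R₁ ≠ [] ∧ R₂ ≠ []

variable {x y : V} {R₁ R₂ b : List V}

theorem Arc.nodup (a : Arc G W D K x R₁ y R₂ b) : b.Nodup := by
  obtain h | ⟨w, -, h, -⟩ := a.type <;> simp [h]

theorem Arc.notMem (a : Arc G W D K x R₁ y R₂ b) : ∀ v ∈ b, v ∈ W ∧ v ∉ K ∧ v ∉ D := by
  obtain h | ⟨w, h1, h, h2⟩ := a.type <;> simp [h]
  exact ⟨h1, h2⟩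

theorem Arc.parity (h : Crit G W) (c : Ctx G W D M) (hK : ∀ v ∈ K, v ∉ D)
    (a : Arc G W D K x R₁ y R₂ b) : (R₁.length + b.length) % 2 = 1 :=
  h.free.bridge_parity c.cyc c.card a.cyc (fun v hv => hK v ((a.mem v).1 hv)) a.seg a.nodup
    (fun v hv => by rw [a.mem]; exact (a.notMem v hv).2.1) (fun v hv => (a.notMem v hv).2.2) a.nt

theorem Arc.rotate (a : Arc G W D K x R₁ y R₂ b) : Arc G W D K y R₂ x R₁ b.reverse where
  cyc := a.cyc.rotate
  mem v := by rw [← a.mem]; simp; tauto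
  seg := a.seg.reverse
  type := by obtain h | ⟨w, h1, h, h2⟩ := a.type <;> simp [h]; exact ⟨h1, h2⟩
  nt hb := by have := a.nt (by simpa using hb); exact this.symm

theorem Arc.no_crossing (h : Crit G W) (c : Ctx G W D M) (hK : ∀ v ∈ K, v ∉ D) {v z : V}
    {P Q S T b' : List V} (a : Arc G W D K x (P ++ v :: Q) y (S ++ z :: T) b)
    (hb' : Seg G v b' z) (ht : b' = [] ∨ ∃ w ∈ W, b' = [w] ∧ w ∉ K ∧ w ∉ D)
    (hbb : ∀ u ∈ b, u ∉ b') : False := by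
  have hcyc := a.cyc
  have hn := a.cyc.nodup
  have a' : Arc G W D K v (Q ++ y :: S) z (T ++ x :: P) b' := by
    refine ⟨?_, fun u => ?_, hb', ht, by simp⟩
    · have : EvenCyc G x (P ++ v :: (Q ++ y :: (S ++ z :: T))) := by simpa using hcyc
      simpa using this.rotate
    · rw [← a.mem]; simp; tauto
  have p1 := a.parity h c hK
  have p2 := a'.parity h c hK
  have hmod := hcyc.mod
  have hseg := hcyc.seg
  simp only [seg_append] at hseg
  obtain ⟨⟨sP, sQ⟩, sS, sT⟩ := hseg
  have nb := a.notMem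
  have nb' := a'.notMem
  have hbb' : ∀ u ∈ b', u ∉ b := fun u h1 h2 => hbb u h2 h1
  simp only [← a.mem] at nb nb'
  have n1 : (x :: (b ++ y :: (Q.reverse ++ v :: (b' ++ z :: T)))).Nodup := by
    have := a.nodup; have := a'.nodup
    clear p1 p2 hmod sP sQ sS sT hcyc a a' hb' ht h c hK
    simp only [List.nodup_cons, List.nodup_append, List.mem_append, List.mem_cons,
      List.nodup_reverse, List.mem_reverse] at hn nb nb' ⊢
    grind
  have n2 : (x :: (P ++ v :: (b' ++ z :: (S.reverse ++ y :: b.reverse)))).Nodup := by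
    have := a.nodup; have := a'.nodup
    clear p1 p2 hmod sP sQ sS sT hcyc a a' hb' ht h c hK n1
    simp only [List.nodup_cons, List.nodup_append, List.mem_append, List.mem_cons,
      List.nodup_reverse, List.mem_reverse] at hn nb nb' ⊢
    grind
  have s1 : Seg G x (b ++ y :: (Q.reverse ++ v :: (b' ++ z :: T))) x := by
    simp [a.seg, seg_reverse, sQ, hb', sT]
  have s2 : Seg G x (P ++ v :: (b' ++ z :: (S.reverse ++ y :: b.reverse))) x := by
    simp [a.seg, seg_reverse, sP, hb', sS]
  have f1 := h.free _ _ s1 n1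
  have f2 := h.free _ _ s2 n2
  have l1 : b.length ≤ 1 := by obtain h | ⟨w, -, h, -⟩ := a.type <;> simp [h]
  have l2 : b'.length ≤ 1 := by obtain h | ⟨w, -, h, -⟩ := ht <;> simp [h]
  have hKx : ∀ u ∈ x :: (P ++ v :: Q ++ y :: (S ++ z :: T)), u ∉ D :=
    fun u hu => hK u ((a.mem u).1 hu)
  have hsub : M ⊆ {x, y, v, z} := by
    have e1 := h.free.evenCyc s1 n1 (by simp at *; omega) (by simp; omega)
    have e2 := h.free.evenCyc s2 n2 (by simp at *; omega) (by simp; omega)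
    have g1 := c.cyc _ _ e1 (by
      clear p1 p2 hmod sP sQ sS sT hcyc a a' hb' ht n1 n2 s1 s2 f1 f2 e1 e2 hn
      intro u hu; simp at hu hKx; grind)
    have g2 := c.cyc _ _ e2 (by
      clear p1 p2 hmod sP sQ sS sT hcyc a a' hb' ht n1 n2 s1 s2 f1 f2 e1 e2 hn
      intro u hu; simp at hu hKx; grind)
    have g3 := c.cyc _ _ hcyc hKx
    intro m hm
    replace g1 := g1 m hm
    replace g2 := g2 m hm
    replace g3 := g3 m hm
    clear p1 p2 hmod sP sQ sS sT hcyc a a' hb' ht n1 n2 s1 s2 f1 f2 e1 e2 hKx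
    simp only [List.nodup_cons, List.nodup_append, List.mem_append, List.mem_cons, List.mem_reverse,
      mem_insert, mem_singleton] at hn nb nb' g1 g2 g3 ⊢
    grind
  have h4 := card_le_card hsub
  have four : #({x, y, v, z} : Finset V) ≤ 4 := card_le_four
  have key : ∀ w ∈ W, w ∉ K → w ∉ D → ∀ m ∈ M, ¬ G.Adj m w := by
    intro w hw hwK hwD
    rcases c.ends _ _ hcyc hKx w hw (by rwa [a.mem]) hwD with h | h
    · omega
    · exact h
  have h3 := c.card
  simp only [List.length_append, List.length_cons, List.length_reverse] at *
  rcases a.type with rfl | ⟨w, hw, rfl, hwK, hwD⟩ <;> rcases ht with rfl | ⟨w', hw', rfl, hwK', hwD'⟩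
  · simp at *; omega
  · have k := key w' hw' hwK' hwD'
    obtain ⟨k1, k2⟩ := hb'
    have : M ⊆ {x, y} := fun m hm => by
      have := hsub hm
      simp only [mem_insert, mem_singleton] at this ⊢
      rcases this with h | h | rfl | rfl
      · exact .inl h
      · exact .inr h
      · exact absurd k1 (k _ hm)
      · exact absurd (seg_nil.1 k2).symm (k _ hm)
    have := (card_le_card this).trans card_le_two
    omega
  · have k := key w hw hwK hwD
    obtain ⟨k1, k2⟩ := a.seg
    have : M ⊆ {v, z} := fun m hm => by
      have := hsub hm
      simp only [mem_insert, mem_singleton] at this ⊢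
      rcases this with rfl | rfl | h | h
      · exact absurd k1 (k _ hm)
      · exact absurd (seg_nil.1 k2).symm (k _ hm)
      · exact .inl h
      · exact .inr h
    have := (card_le_card this).trans card_le_two
    omega
  · simp at *; omega

end

section

variable {V : Type*} [Fintype V] [DecidableEq V] {G : SimpleGraph V} {W D M K : Finset V}

variable {x y v z : V} {R₁ R₂ b b' : List V}

theorem Crit.third (h : Crit G W) (hv : v ∉ W) (y z : V) : ∃ u, u ≠ y ∧ u ≠ z ∧ G.Adj v u := by
  obtain ⟨a, b, hab, ha, hb, h1, h2⟩ := h.two_more hv y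
  by_cases haz : a = z
  · exact ⟨b, hb, by rintro rfl; exact hab haz, h2⟩
  · exact ⟨a, ha, haz, h1⟩

theorem Ctx.exists_bridge (h : Crit G W) (c : Ctx G W D M) (hK : ∀ v ∈ K, v ∉ D) {L : List V}
    (hC : EvenCyc G v L) (hm : ∀ u, u ∈ v :: L ↔ u ∈ K) (hv : v ∉ W) (hvD : ∀ u ∈ D, ¬ G.Adj v u) :
    ∃ b z, z ∈ L ∧ Seg G v b z ∧ (b = [] ∨ ∃ w ∈ W, b = [w] ∧ w ∉ K ∧ w ∉ D) ∧
      (b = [] → L.head? ≠ some z ∧ L.getLast? ≠ some z) := by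
  have hL : L ≠ [] := by rintro rfl; have := hC.five; simp at this
  obtain ⟨e, hes, het, hve⟩ := h.third hv (L.head hL) (L.getLast hL)
  by_cases heK : e ∈ K
  · refine ⟨[], e, ?_, hve, .inl rfl, fun _ => ⟨?_, ?_⟩⟩
    · exact (List.mem_cons.1 ((hm e).2 heK)).resolve_left hve.ne.symm
    · rw [List.head?_eq_some_head hL]; simpa using hes.symm
    · rw [List.getLast?_eq_some_getLast hL]; simpa using het.symm
  · have heD : e ∉ D := fun he => hvD e he hve
    obtain ⟨heW, he⟩ := c.off v L hC (fun u hu => hK u ((hm u).1 hu)) v (by simp) e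
      (by rwa [hm]) heD hve
    obtain ⟨y, hyv, hey⟩ := h.one_more e v
    exact ⟨[e], y, (List.mem_cons.1 (he y hey)).resolve_left hyv, ⟨hve, hey⟩,
      .inr ⟨e, heW, rfl, heK, heD⟩, by simp⟩

theorem Arc.of_bridge {T U : List V} (hC : EvenCyc G v (T ++ z :: U))
    (hm : ∀ u, u ∈ v :: (T ++ z :: U) ↔ u ∈ K) (hb : Seg G v b z)
    (ht : b = [] ∨ ∃ w ∈ W, b = [w] ∧ w ∉ K ∧ w ∉ D)
    (hn : b = [] → (T ++ z :: U).head? ≠ some z ∧ (T ++ z :: U).getLast? ≠ some z) :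
    Arc G W D K v T z U b := by
  refine ⟨hC, hm, hb, ht, fun h => ⟨?_, ?_⟩⟩
  · rintro rfl; exact (hn h).1 (by simp)
  · rintro rfl; exact (hn h).2 (by simp)

theorem Arc.disjoint (h : Crit G W) (a : Arc G W D K x R₁ y R₂ b) (hb : Seg G v b' z)
    (ht : b' = [] ∨ ∃ w ∈ W, b' = [w] ∧ w ∉ K ∧ w ∉ D) (hvx : v ≠ x) (hvy : v ≠ y) :
    ∀ u ∈ b, u ∉ b' := by
  have hn := a.cyc.nodup
  have hs := a.seg
  have hxy : x ≠ y := by rintro rfl; simp at hn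
  obtain h1 | ⟨w, hw, rfl, -⟩ := a.type
  · simp [h1]
  obtain h1 | ⟨w', hw', rfl, -⟩ := ht
  · simp [h1]
  rintro u hu hu'
  obtain rfl : u = w := by simpa using hu
  obtain rfl : u = w' := by simpa using hu'
  rcases (h.adj_iff hw hs.1.symm hs.2 hxy v).1 hb.1.symm with h | h
  · exact hvx h
  · exact hvy h

theorem Arc.mem_of_minimal (h : Crit G W) (c : Ctx G W D M) (hK : ∀ v ∈ K, v ∉ D)
    (a : Arc G W D K x R₁ y R₂ b)
    (hmin : ∀ x T y U b, Arc G W D K x T y U b → R₁.length ≤ T.length) (hv : v ∈ R₁) (hvW : v ∉ W)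
    (hvD : ∀ u ∈ D, ¬ G.Adj v u) : False := by
  obtain ⟨P, Q, rfl⟩ := List.append_of_mem hv
  have hc : EvenCyc G v ((Q ++ y :: R₂) ++ x :: P) := by
    have : EvenCyc G x (P ++ v :: (Q ++ y :: R₂)) := by simpa using a.cyc
    exact this.rotate
  have hm : ∀ u, u ∈ v :: ((Q ++ y :: R₂) ++ x :: P) ↔ u ∈ K := by
    intro u; rw [← a.mem]; simp; tauto
  obtain ⟨b', z, hz, hs, ht, hn⟩ := c.exists_bridge h hK hc hm hvW hvD
  have arc : ∀ T U, (Q ++ y :: R₂) ++ x :: P = T ++ z :: U → Arc G W D K v T z U b' := by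
    intro T U hTU
    rw [hTU] at hc hm hn
    exact .of_bridge hc hm hs ht hn
  simp only [List.mem_append, List.mem_cons] at hz
  rcases hz with (hz | rfl | hz) | rfl | hz
  · obtain ⟨T, U, rfl⟩ := List.append_of_mem hz
    have := hmin _ _ _ _ _ (arc T (U ++ y :: R₂ ++ x :: P) (by simp))
    simp at this
    omega
  · have := hmin _ _ _ _ _ (arc Q (R₂ ++ x :: P) (by simp))
    simp at this
    omega
  · obtain ⟨T, U, rfl⟩ := List.append_of_mem hz
    have hnod := a.cyc.nodup
    refine a.no_crossing h c hK hs ht (a.disjoint h hs ht ?_ ?_)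
    · rintro rfl; simp at hnod
    · rintro rfl; simp [List.nodup_append] at hnod
  · have := hmin _ _ _ _ _ (arc _ P rfl).rotate
    simp at this
  · obtain ⟨T, U, rfl⟩ := List.append_of_mem hz
    have := hmin _ _ _ _ _ (arc (Q ++ y :: R₂ ++ x :: T) U (by simp)).rotate
    simp at this
    omega

theorem Arc.exists_notMem (h : Crit G W) (a : Arc G W D K x R₁ y R₂ b) : ∃ v ∈ R₁, v ∉ W := by
  by_contra hW
  push Not at hW
  have hs := (seg_append.1 a.cyc.seg).1
  have hn := a.cyc.nodup
  have hb := a.seg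
  rcases R₁ with _ | ⟨u, _ | ⟨u', R⟩⟩
  · obtain h1 | ⟨w, hw, rfl, -⟩ := a.type
    · exact (a.nt h1).1 rfl
    · exact h.no_triangle hw hb.1.symm hb.2 hs
  · have hu := hW u (by simp)
    obtain rfl | ⟨w, hw, rfl, hwK, -⟩ := a.type
    · exact h.no_triangle hu hs.1.symm hs.2 hb
    · refine h.free.no_square hs.1 hs.2 (seg_nil.1 hb.2).symm hb.1.symm (by rintro rfl; simp at hn) ?_
      rintro rfl
      exact hwK ((a.mem _).1 (by simp))
  · exact h.not_adj (hW u (by simp)) (hW u' (by simp)) hs.2.1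

theorem Arc.reroute (h : Crit G W) (c : Ctx G W D M) (hK : ∀ v ∈ K, v ∉ D)
    (a : Arc G W D K x R₁ y R₂ b) {m : V} (hm : m ∈ R₁) (hmM : m ∈ M) {R : List V}
    (hR : Seg G y R x) (hRn : R.Nodup) (hRR : ∀ u ∈ R, u ∈ R₂ ∨ u ∉ b ∧ u ∉ K ∧ u ∉ D)
    (hl : (R.length + R₂.length) % 2 = 1) (hne : R ≠ []) : False := by
  have hp := a.parity h c hK
  have hmod := a.cyc.mod
  have hn := a.cyc.nodup
  have nb := a.notMem
  have nbn := a.nodup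
  have hKm := a.mem
  have e : EvenCyc G x (b ++ y :: R) := by
    refine h.free.reroute a.seg hR ?_ (by simp at hmod; omega) (.inr hne)
    simp only [← hKm] at nb hRR
    clear hp hmod h c hK a hKm hR hl
    simp only [List.nodup_cons, List.nodup_append, List.mem_append, List.mem_cons] at hn nb hRR ⊢
    grind
  have hmK : m ∈ K := (hKm m).1 (by simp [hm])
  have := c.cyc _ _ e (by
    intro u hu
    simp only [List.mem_cons, List.mem_append] at hu
    rcases hu with rfl | hu | rfl | hu
    · exact hK _ ((hKm _).1 (by simp))
    · exact (nb u hu).2.2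
    · exact hK _ ((hKm _).1 (by simp))
    · rcases hRR u hu with h | h
      · exact hK _ ((hKm _).1 (by simp [h]))
      · exact h.2.2) m hmM
  simp only [List.nodup_cons, List.nodup_append, List.mem_append, List.mem_cons] at hn this
  clear hp hmod h c hK a hKm hR hl e
  grind

theorem Arc.mem_of_mem_right (h : Crit G W) (c : Ctx G W D M) (hK : ∀ v ∈ K, v ∉ D)
    (a : Arc G W D K x R₁ y R₂ b) {m : V} (hm : m ∈ R₁) (hmM : m ∈ M) (hv : v ∈ R₂) (hvW : v ∉ W)
    (hvD : ∀ u ∈ D, ¬ G.Adj v u) : False := by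
  obtain ⟨P, Q, rfl⟩ := List.append_of_mem hv
  have hc : EvenCyc G v (Q ++ x :: (R₁ ++ y :: P)) := by
    have : EvenCyc G x ((R₁ ++ y :: P) ++ v :: Q) := by simpa using a.cyc
    exact this.rotate
  have hmem : ∀ u, u ∈ v :: (Q ++ x :: (R₁ ++ y :: P)) ↔ u ∈ K := by
    intro u; rw [← a.mem]; simp; tauto
  obtain ⟨b', z, hz, hs, ht, hn⟩ := c.exists_bridge h hK hc hmem hvW hvD
  have arc : ∀ T U, Q ++ x :: (R₁ ++ y :: P) = T ++ z :: U → Arc G W D K v T z U b' := by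
    intro T U hTU
    rw [hTU] at hc hmem hn
    exact .of_bridge hc hmem hs ht hn
  have hnod := a.cyc.nodup
  have hseg := a.cyc.seg
  have dis := a.disjoint h hs ht (by rintro rfl; simp at hnod)
    (by rintro rfl; simp [List.nodup_append] at hnod)
  have dis' : ∀ u ∈ b', u ∉ b ∧ u ∉ K ∧ u ∉ D := by
    intro u hu
    refine ⟨fun hub => dis u hub hu, ?_⟩
    obtain h1 | ⟨w, -, rfl, h1⟩ := ht
    · simp [h1] at hu
    · obtain rfl : u = w := by simpa using hu
      exact h1
  have disK : ∀ u ∈ b', u ∉ x :: (R₁ ++ y :: (P ++ v :: Q)) := by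
    intro u hu; rw [a.mem]; exact (dis' u hu).2.1
  have bn : b'.Nodup := by obtain h | ⟨w, -, h, -⟩ := ht <;> simp [h]
  simp only [seg_append] at hseg
  obtain ⟨s1, s2, s3⟩ := hseg
  have reroute := fun R => a.reroute h c hK hm hmM (R := R)
  have par := fun T U hTU => (arc T U hTU).parity h c hK
  have par' := fun T U hTU => (arc T U hTU).rotate.parity h c hK
  have cross := fun (T U : List V) (hTU : R₁ = T ++ z :: U) => Arc.no_crossing h c hK (v := z) (z := v) (P := T) (Q := U) (S := P)
    (T := Q) (b' := b'.reverse) (x := x) (y := y) (b := b) (by rw [← hTU]; exact a) hs.reverse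
    (by obtain h | ⟨w, h1, h, h2⟩ := ht <;> simp [h]; exact ⟨h1, h2⟩) (by simpa using dis)
  clear h c hK a hmM hvD hvW arc hn ht hmem hc dis
  simp only [List.nodup_cons, List.nodup_append, List.mem_append, List.mem_cons] at hnod disK
  simp only [List.mem_append, List.mem_cons] at hz
  rcases hz with hz | rfl | hz | rfl | hz
  · obtain ⟨T, U, rfl⟩ := List.append_of_mem hz
    have p := par T (U ++ x :: (R₁ ++ y :: P)) (by simp)
    clear par par' cross
    refine reroute (P ++ v :: (b' ++ z :: U)) ?_ ?_ ?_ ?_ (by simp)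
    · rw [seg_append] at s3
      simp [s2, s3, hs]
    · clear reroute
      simp only [List.nodup_cons, List.nodup_append, List.mem_append, List.mem_cons] at hnod disK ⊢
      grind
    · intro u hu; simp at hu ⊢; grind
    · simp; omega
  · have p := par Q _ rfl
    clear par par' cross
    refine reroute (P ++ v :: b') ?_ ?_ ?_ ?_ (by simp)
    · simp [s2, hs]
    · clear reroute
      simp only [List.nodup_cons, List.nodup_append, List.mem_append, List.mem_cons] at hnod disK ⊢
      grind
    · intro u hu; simp at hu ⊢; grind
    · simp; omega
  · obtain ⟨T, U, rfl⟩ := List.append_of_mem hz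
    exact cross T U rfl
  · have p := par' (Q ++ x :: R₁) P (by simp)
    clear par par' cross
    refine reroute (b'.reverse ++ v :: Q) ?_ ?_ ?_ ?_ (by simp)
    · simp [s3, hs.reverse]
    · clear reroute
      simp only [List.nodup_cons, List.nodup_append, List.mem_append, List.mem_cons,
        List.nodup_reverse, List.mem_reverse] at hnod disK ⊢
      grind
    · intro u hu; simp at hu ⊢; grind
    · simp at p ⊢; omega
  · obtain ⟨S, T, rfl⟩ := List.append_of_mem hz
    have p := par' (Q ++ x :: (R₁ ++ y :: S)) T (by simp)
    clear par par' cross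
    refine reroute (S ++ z :: (b'.reverse ++ v :: Q)) ?_ ?_ ?_ ?_ (by simp)
    · rw [seg_append] at s2
      simp [s2, s3, hs.reverse]
    · clear reroute
      simp only [List.nodup_cons, List.nodup_append, List.mem_append, List.mem_cons,
        List.nodup_reverse, List.mem_reverse] at hnod disK ⊢
      grind
    · intro u hu; simp at hu ⊢; grind
    · simp at p ⊢; omega

/-- An even cycle outside `D` has at most one chord. -/
theorem Ctx.exists_arc (h : Crit G W) (c : Ctx G W D M) (hK : ∀ v ∈ K, v ∉ D) {x₀ : V} {L : List V}
    (hC : EvenCyc G x₀ L) (hm : ∀ u, u ∈ x₀ :: L ↔ u ∈ K) :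
    (∀ v ∈ K, v ∈ W ∨ ∃ u ∈ D, G.Adj v u) ∨ ∃ x R₁ y R₂ b, Arc G W D K x R₁ y R₂ b ∧
      ∀ v ∈ K, v = x ∨ v = y ∨ v ∈ W ∨ ∃ u ∈ D, G.Adj v u := by
  by_cases hall : ∀ v ∈ K, v ∈ W ∨ ∃ u ∈ D, G.Adj v u
  · exact .inl hall
  right
  push Not at hall
  obtain ⟨v, hvK, hvW, hvD⟩ := hall
  have hex : ∃ n x R₁ y R₂ b, Arc G W D K x R₁ y R₂ b ∧ R₁.length = n := by
    obtain ⟨L', h1, h2, h3⟩ := hC.seg.exists_rotate hC.nodup ((hm v).2 hvK)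
    have hC' : EvenCyc G v L' := ⟨h1, h2.nodup_iff.2 hC.nodup, h3 ▸ hC.mod, h3 ▸ hC.five⟩
    have hm' : ∀ u, u ∈ v :: L' ↔ u ∈ K := fun u => by rw [h2.mem_iff, hm]
    obtain ⟨b, z, hz, hs, ht, hn⟩ := c.exists_bridge h hK hC' hm' hvW hvD
    obtain ⟨T, U, rfl⟩ := List.append_of_mem hz
    exact ⟨_, _, _, _, _, _, .of_bridge hC' hm' hs ht hn, rfl⟩
  classical
  obtain ⟨x, R₁, y, R₂, b, a, hl⟩ := Nat.find_spec hex
  have hmin : ∀ x T y U b, Arc G W D K x T y U b → R₁.length ≤ T.length := fun x T y U b a => by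
    rw [hl]; exact Nat.find_min' hex ⟨x, T, y, U, b, a, rfl⟩
  have h1 : ∀ v ∈ R₁, v ∈ W ∨ ∃ u ∈ D, G.Adj v u := by
    intro v hv
    by_contra hcon
    push Not at hcon
    exact a.mem_of_minimal h c hK hmin hv hcon.1 hcon.2
  obtain ⟨m, hmR, hmW⟩ := a.exists_notMem h
  obtain ⟨u, hu, hmu⟩ := (h1 m hmR).resolve_left hmW
  have hmM : m ∈ M := c.cov m (hK m ((a.mem m).1 (by simp [hmR]))) u hu hmu
  refine ⟨x, R₁, y, R₂, b, a, fun v hv => ?_⟩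
  have := (a.mem v).2 hv
  simp only [List.mem_cons, List.mem_append] at this
  rcases this with h' | h' | h' | h'
  · exact .inl h'
  · exact .inr (.inr (h1 v h'))
  · exact .inr (.inl h')
  · right; right
    by_contra hcon
    push Not at hcon
    exact a.mem_of_mem_right h c hK hmR hmM h' hcon.1 hcon.2

end

section

variable {V : Type*} [DecidableEq V] {G : SimpleGraph V} {D : Finset V}

/-- The subgraph induced on `D` is connected. -/
def Conn (G : SimpleGraph V) (D : Finset V) : Prop :=
  ∀ T ⊆ D, T.Nonempty → (∀ u ∈ T, ∀ v ∈ D, G.Adj u v → v ∈ T) → T = D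

theorem conn_singleton (v : V) : Conn G {v} := fun _ hT hne _ =>
  (subset_singleton_iff.1 hT).resolve_left hne.ne_empty

theorem Conn.insert (h : Conn G D) {u v : V} (hu : u ∈ D) (huv : G.Adj u v) :
    Conn G (insert v D) := by
  intro T hT hne hcl
  by_cases hTD : (T ∩ D).Nonempty
  · have hD : T ∩ D = D := by
      refine h _ inter_subset_right hTD fun x hx y hy hxy => ?_
      exact mem_inter.2 ⟨hcl x (mem_inter.1 hx).1 y (mem_insert_of_mem hy) hxy, hy⟩
    rw [inter_eq_right] at hD
    refine hT.antisymm (insert_subset (hcl u (hD hu) v (mem_insert_self _ _) huv) hD)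
  · rw [not_nonempty_iff_eq_empty] at hTD
    obtain ⟨t, ht⟩ := hne
    have htD : t ∉ D := fun h' => by simpa [hTD] using mem_inter.2 ⟨ht, h'⟩
    obtain rfl : t = v := (mem_insert.1 (hT ht)).resolve_right htD
    have := mem_inter.2 ⟨hcl t ht u (mem_insert_of_mem hu) huv.symm, hu⟩
    simp [hTD] at this

theorem Conn.exists_path_to (h : Conn G D) {T : Finset V} (hT : T ⊆ D) (hne : T.Nonempty) {a u : V}
    (hu : u ∈ D) (hau : G.Adj a u) :
    ∃ P t, Seg G a P t ∧ P.Nodup ∧ (∀ v ∈ P, v ∈ D ∧ v ∉ T) ∧ t ∈ T := by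
  classical
  have key : D.filter (fun u => u ∈ T ∨ ∃ P t, Seg G u P t ∧ (u :: P).Nodup ∧
      (∀ v ∈ u :: P, v ∈ D ∧ v ∉ T) ∧ t ∈ T) = D := by
    refine h _ (filter_subset _ _) ?_ ?_
    · obtain ⟨t, ht⟩ := hne
      exact ⟨t, by simp [ht, hT ht]⟩
    · intro u hu v hv huv
      simp only [mem_filter] at hu ⊢
      refine ⟨hv, ?_⟩
      by_cases hvT : v ∈ T
      · exact .inl hvT
      right
      obtain ⟨huD, hu | ⟨P, t, hs, hn, hm, ht⟩⟩ := hu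
      · exact ⟨[], u, huv.symm, by simp, by simp [hv, hvT], hu⟩
      by_cases hvP : v ∈ u :: P
      · rcases List.mem_cons.1 hvP with rfl | hvP
        · exact ⟨P, t, hs, hn, hm, ht⟩
        · obtain ⟨A, B, rfl⟩ := List.append_of_mem hvP
          refine ⟨B, t, (seg_append.1 hs).2, ?_, fun x hx => hm x ?_, ht⟩
          · exact ((List.nodup_append.1 (List.nodup_cons.1 hn).2).2.1)
          · simp only [List.mem_cons, List.mem_append] at hx ⊢; tauto
      · exact ⟨u :: P, t, ⟨huv.symm, hs⟩, List.nodup_cons.2 ⟨hvP, hn⟩, by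
          simpa [hv, hvT] using hm, ht⟩
  have := key ▸ hu
  rcases (mem_filter.1 this).2 with h | ⟨P, t, hs, hn, hm, ht⟩
  · exact ⟨[], u, hau, by simp, by simp, h⟩
  · exact ⟨u :: P, t, ⟨hau, hs⟩, hn, hm, ht⟩

theorem Conn.exists_path (h : Conn G D) {a b u v : V} (hu : u ∈ D) (hau : G.Adj a u) (hv : v ∈ D)
    (hbv : G.Adj b v) : ∃ P, Seg G a P b ∧ P.Nodup ∧ (∀ v ∈ P, v ∈ D) ∧ P ≠ [] := by
  classical
  obtain ⟨P, t, hs, hn, hm, ht⟩ := h.exists_path_to (filter_subset (G.Adj b ·) D)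
    ⟨v, by simp [hv, hbv]⟩ hu hau
  rw [mem_filter] at ht
  refine ⟨P ++ [t], by simp [hs, ht.2.symm], ?_, ?_, by simp⟩
  · have : t ∉ P := fun h' => (hm t h').2 (mem_filter.2 ht)
    simp only [List.nodup_append, hn]
    grind
  · intro x hx
    rcases List.mem_append.1 hx with h | h
    · exact (hm x h).1
    · rw [List.mem_singleton.1 h]; exact ht.1

theorem Conn.exists_tripod (h : Conn G D) {a b c u v w : V} (hu : u ∈ D) (hau : G.Adj a u)
    (hv : v ∈ D) (hbv : G.Adj b v) (hw : w ∈ D) (hcw : G.Adj c w) :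
    ∃ z A B Q, Seg G a A z ∧ Seg G b B z ∧ Seg G c Q z ∧ (∀ x ∈ z :: (A ++ (B ++ Q)), x ∈ D) ∧
      (z :: (A ++ (B ++ Q))).Nodup := by
  obtain ⟨P, hs, hn, hm, hne⟩ := h.exists_path hu hau hv hbv
  obtain ⟨Q, z, hq, hqn, hqm, hz⟩ := h.exists_path_to (T := P.toFinset)
    (fun x hx => hm x (by simpa using hx)) (by simpa using hne) hw hcw
  simp only [List.mem_toFinset] at hz hqm
  obtain ⟨A, B, rfl⟩ := List.append_of_mem hz
  obtain ⟨h1, h2⟩ := seg_append.1 hs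
  refine ⟨z, A, B.reverse, Q, h1, h2.reverse, hq, ?_, ?_⟩
  · intro x hx; simp at hx hm hqm; grind
  · clear h1 h2 hs hq hm hz hne
    simp only [List.nodup_cons, List.nodup_append, List.mem_append, List.mem_cons,
      List.nodup_reverse, List.mem_reverse] at hn hqm ⊢
    grind

end

section

variable {V : Type*} [Fintype V] [DecidableEq V] {G : SimpleGraph V} {W D E : Finset V}

section Cycle

omit [Fintype V]

theorem EvenCyc.rotate_to {x a : V} {L : List V} (h : EvenCyc G x L) (ha : a ∈ x :: L) :
    ∃ L', EvenCyc G a L' ∧ ∀ u, u ∈ a :: L' ↔ u ∈ x :: L := by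
  obtain ⟨L', h1, h2, h3⟩ := h.seg.exists_rotate h.nodup ha
  exact ⟨L', ⟨h1, h2.nodup_iff.2 h.nodup, h3 ▸ h.mod, h3 ▸ h.five⟩, fun u => h2.mem_iff⟩

theorem EvenCyc.split {x p q r : V} {L : List V} (h : EvenCyc G x L) (hp : p ∈ x :: L)
    (hq : q ∈ x :: L) (hr : r ∈ x :: L) (hpq : p ≠ q) (hpr : p ≠ r) (hqr : q ≠ r) :
    ∃ R₁ R₂ R₃, EvenCyc G p (R₁ ++ q :: (R₂ ++ r :: R₃)) ∧
      ∀ u, u ∈ p :: (R₁ ++ q :: (R₂ ++ r :: R₃)) ↔ u ∈ x :: L := by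
  obtain ⟨L', h', hm⟩ := h.rotate_to hp
  have hq' := (List.mem_cons.1 ((hm q).2 hq)).resolve_left hpq.symm
  obtain ⟨A, B, rfl⟩ := List.append_of_mem hq'
  have hr' := (List.mem_cons.1 ((hm r).2 hr)).resolve_left hpr.symm
  rcases List.mem_append.1 hr' with hr' | hr'
  · obtain ⟨S, T, rfl⟩ := List.append_of_mem hr'
    refine ⟨B.reverse, T.reverse, S.reverse, by simpa using h'.reverse, fun u => ?_⟩
    rw [← hm]
    simp
    tauto
  · obtain ⟨S, T, rfl⟩ := List.append_of_mem ((List.mem_cons.1 hr').resolve_left hqr.symm)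
    exact ⟨A, S, T, h', hm⟩

theorem EvenCyc.nbrs {x v : V} {L : List V} (h : EvenCyc G x L) (hv : v ∈ x :: L) :
    ∃ s t, s ≠ t ∧ s ∈ x :: L ∧ t ∈ x :: L ∧ G.Adj v s ∧ G.Adj v t := by
  obtain ⟨L', h', hm⟩ := h.rotate_to hv
  obtain ⟨h1, h2, -, h4⟩ := h'
  rcases L' with _ | ⟨s, T⟩
  · simp at h4
  rcases List.eq_nil_or_concat' T with rfl | ⟨T, t, rfl⟩
  · simp at h4
  · refine ⟨s, t, ?_, (hm s).1 (by simp), (hm t).1 (by simp), h1.1, ?_⟩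
    · rintro rfl; simp at h2
    · exact (seg_append.1 h1.2).2.symm

theorem EvenCyc.six_le {x : V} {L : List V} (h : EvenCyc G x L) : 6 ≤ #(x :: L).toFinset := by
  rw [List.toFinset_card_of_nodup h.nodup]
  have := h.five
  simp
  omega

end Cycle

open scoped Classical in
/-- The vertices outside `D` with a neighbour in `D`. -/
noncomputable def nbhd (G : SimpleGraph V) (D : Finset V) : Finset V :=
  univ.filter fun v => v ∉ D ∧ ∃ u ∈ D, G.Adj v u

theorem mem_nbhd {v : V} : v ∈ nbhd G D ↔ v ∉ D ∧ ∃ u ∈ D, G.Adj v u := by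
  simp [nbhd]

theorem exists_component (G : SimpleGraph V) (S : Finset V) {e : V} (he : e ∈ S) :
    ∃ E ⊆ S, e ∈ E ∧ Conn G E ∧ ∀ u ∈ E, ∀ v ∈ S, G.Adj u v → v ∈ E := by
  classical
  obtain ⟨E, hE, hmax⟩ := exists_max_image
    (S.powerset.filter fun E => e ∈ E ∧ Conn G E) card
    ⟨{e}, by simp [he, conn_singleton]⟩
  simp only [mem_filter, mem_powerset] at hE hmax
  refine ⟨E, hE.1, hE.2.1, hE.2.2, fun u hu v hv huv => ?_⟩
  by_contra hvE
  have := hmax (insert v E) ⟨insert_subset hv hE.1, mem_insert_of_mem hE.2.1, hE.2.2.insert hu huv⟩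
  rw [card_insert_of_notMem hvE] at this
  omega

theorem Crit.card_le_one (h : Crit G W) {x y : V} (hx : x ∉ E) (hy : y ∉ E)
    (hN : nbhd G E ⊆ {x, y}) (hO : 2 ≤ #(insert x (insert y E))ᶜ) : #E ≤ 1 := by
  by_contra hE
  have hN' : ∀ u ∈ E, ∀ v, G.Adj u v → v ∈ E ∨ v = x ∨ v = y := by
    intro u hu v huv
    by_cases hv : v ∈ E
    · exact .inl hv
    · simpa using Or.inr (hN (mem_nbhd.2 ⟨hv, u, hu, huv.symm⟩))
  by_cases hw : #(E ∩ W) ≤ 1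
  · exact h.sep2 E x y hx hy (by omega) hO hN' hw
  refine h.sep2 (insert x (insert y E))ᶜ x y (by simp) (by simp) hO ?_ ?_ ?_
  · refine le_trans (by omega : 2 ≤ #E) (card_le_card fun v hv => ?_)
    have h1 : v ≠ x := by rintro rfl; exact hx hv
    have h2 : v ≠ y := by rintro rfl; exact hy hv
    simp [h1, h2, hv]
  · intro u hu v huv
    simp only [mem_compl, mem_insert, not_or] at hu ⊢
    by_contra hcon
    push Not at hcon
    rcases hN' v (by tauto) u huv.symm with h | h | h <;> tauto
  · have h3 := h.card_le
    have : #(E ∩ W) + #((insert x (insert y E))ᶜ ∩ W) ≤ #W := by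
      rw [← card_union_of_disjoint]
      · exact card_le_card (union_subset inter_subset_right inter_subset_right)
      · rw [disjoint_left]
        intro v h1 h2
        simp at h1 h2
        tauto
    omega

theorem exists_subset_pair {N S : Finset V} (hN : #N ≤ 2) (hNS : N ⊆ S) (hS : S.Nonempty) :
    ∃ x ∈ S, ∃ y ∈ S, N ⊆ {x, y} := by
  obtain ⟨s, hs⟩ := hS
  interval_cases hc : #N
  · exact ⟨s, hs, s, hs, by simp [card_eq_zero.1 hc]⟩
  · obtain ⟨x, rfl⟩ := card_eq_one.1 hc
    have := hNS (mem_singleton_self x)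
    exact ⟨x, this, x, this, by simp⟩
  · obtain ⟨x, y, -, rfl⟩ := card_eq_two.1 hc
    exact ⟨x, hNS (by simp), y, hNS (by simp), Subset.rfl⟩

theorem Crit.card_le_one_of_evenCyc (h : Crit G W) {x : V} {L : List V} (hC : EvenCyc G x L)
    (hE : ∀ v ∈ x :: L, v ∉ E) (hN : #(nbhd G E) ≤ 2) (hNC : ∀ v ∈ nbhd G E, v ∈ x :: L) :
    #E ≤ 1 := by
  obtain ⟨p, hp, q, hq, hpq⟩ := exists_subset_pair (S := (x :: L).toFinset) hN
    (fun v hv => by simpa using hNC v hv) ⟨x, by simp⟩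
  rw [List.mem_toFinset] at hp hq
  refine h.card_le_one (hE p hp) (hE q hq) hpq ?_
  have h6 := hC.six_le
  have : (x :: L).toFinset ⊆ (insert p (insert q E))ᶜ ∪ {p, q} := by
    intro v hv
    have := hE v (by simpa using hv)
    simp only [mem_union, mem_compl, mem_insert, mem_singleton]
    tauto
  have := card_le_card this
  have h1 := card_union_le (insert p (insert q E))ᶜ {p, q}
  have : #({p, q} : Finset V) ≤ 2 := card_le_two
  omega

end

section

variable {V : Type*} [Fintype V] [DecidableEq V] {G : SimpleGraph V} {W D : Finset V}

/-- A connected set of vertices avoiding an even cycle. -/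
structure Side (G : SimpleGraph V) (D : Finset V) : Prop where
  conn : Conn G D
  nonempty : D.Nonempty
  cyc : ∃ x L, EvenCyc G x L ∧ ∀ v ∈ x :: L, v ∉ D

/-- A largest connected set of vertices avoiding an even cycle, with at least three neighbours. -/
structure MaxSide (G : SimpleGraph V) (D : Finset V) : Prop extends Side G D where
  max : ∀ D', Side G D' → #D' ≤ #D
  three : 3 ≤ #(nbhd G D)

theorem Side.nbhd_subset (h : Side G D) (hmax : ∀ D', Side G D' → #D' ≤ #D) {x : V} {L : List V}
    (hC : EvenCyc G x L) (hD : ∀ v ∈ x :: L, v ∉ D) : ∀ v ∈ nbhd G D, v ∈ x :: L := by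
  intro v hv
  obtain ⟨hvD, u, hu, hvu⟩ := mem_nbhd.1 hv
  by_contra hvC
  have := hmax (insert v D) ⟨h.conn.insert hu hvu.symm, insert_nonempty _ _, x, L, hC, fun y hy => by
    rw [mem_insert, not_or]
    exact ⟨by rintro rfl; exact hvC hy, hD y hy⟩⟩
  rw [card_insert_of_notMem hvD] at this
  omega

theorem Crit.exists_maxSide (h : Crit G W) {x v : V} {L : List V} (hC : EvenCyc G x L)
    (hv : v ∉ x :: L) (hvW : v ∉ W) : ∃ D, MaxSide G D := by
  classical
  have hs : Side G {v} := ⟨conn_singleton v, singleton_nonempty v, x, L, hC, fun y hy => by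
    rw [mem_singleton]; rintro rfl; exact hv hy⟩
  obtain ⟨D, hD, hmax⟩ := exists_max_image (univ.filter fun D => Side G D) card ⟨{v}, by simp [hs]⟩
  simp only [mem_filter, mem_univ, true_and] at hD hmax
  by_cases h3 : 3 ≤ #(nbhd G D)
  · exact ⟨D, hD, hmax, h3⟩
  obtain ⟨x', L', hC', hD'⟩ := hD.cyc
  have := h.card_le_one_of_evenCyc hC' hD' (by omega) (hD.nbhd_subset hmax hC' hD')
  refine ⟨{v}, hs, fun D' hD' => by simpa using (hmax D' hD').trans this, ?_⟩
  obtain ⟨a, b, c, hab, hac, hbc, -, -, -, ha, hb, hc⟩ := h.d3 v hvW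
  have : ({a, b, c} : Finset V) ⊆ nbhd G {v} := by
    intro u hu
    simp only [mem_insert, mem_singleton] at hu
    simp only [mem_nbhd, mem_singleton, exists_eq_left]
    rcases hu with rfl | rfl | rfl
    · exact ⟨ha.ne.symm, ha.symm⟩
    · exact ⟨hb.ne.symm, hb.symm⟩
    · exact ⟨hc.ne.symm, hc.symm⟩
  exact (card_eq_three.2 ⟨a, b, c, hab, hac, hbc, rfl⟩).symm.le.trans (card_le_card this)

omit [Fintype V] in
theorem Free.no_tripod_parity {M E : Finset V} (hf : Free G)
    (hM : ∀ x L, EvenCyc G x L → (∀ v ∈ x :: L, v ∉ D) → ∀ m ∈ M, m ∈ x :: L) (hM3 : 3 ≤ #M)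
    {p q r z : V} {R₁ R₂ R₃ A B Q : List V} (hC : EvenCyc G p (R₁ ++ q :: (R₂ ++ r :: R₃)))
    (hD : ∀ v ∈ p :: (R₁ ++ q :: (R₂ ++ r :: R₃)), v ∉ D)
    (hE : ∀ v ∈ E, v ∉ D ∧ v ∉ p :: (R₁ ++ q :: (R₂ ++ r :: R₃))) (hA : Seg G p A z)
    (hB : Seg G q B z) (hQ : Seg G r Q z) (hm : ∀ x ∈ z :: (A ++ (B ++ Q)), x ∈ E)
    (hn : (z :: (A ++ (B ++ Q))).Nodup) : False := by
  have key : ∀ {p q R S A B}, EvenCyc G p (R ++ q :: S) → (∀ v ∈ p :: (R ++ q :: S), v ∉ D) →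
      Seg G p A z → Seg G q B z → (z :: (A ++ B)).Nodup →
      (∀ x ∈ z :: (A ++ B), x ∉ D ∧ x ∉ p :: (R ++ q :: S)) →
      (R.length + (A.length + B.length + 1)) % 2 = 1 := by
    intro p q R S A B hC hD hA hB hn hm
    have := hf.bridge_parity (b := A ++ z :: B.reverse) hM hM3 hC hD (by simp [hA, hB.reverse]) (by
      clear hm hM hD hC hE
      simp only [List.nodup_cons, List.nodup_append, List.mem_append, List.mem_cons,
        List.nodup_reverse, List.mem_reverse] at hn ⊢
      grind) (fun v hv => (hm v (by simp at hv ⊢; tauto)).2)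
      (fun v hv => (hm v (by simp at hv ⊢; tauto)).1) (by simp)
    simp at this
    omega
  have hmod := hC.mod
  simp only [List.nodup_cons, List.nodup_append, List.mem_append, List.mem_cons] at hn
  have hC2 : EvenCyc G q (R₂ ++ r :: (R₃ ++ p :: R₁)) := by simpa using hC.rotate
  have hC3 : EvenCyc G r (R₃ ++ p :: (R₁ ++ q :: R₂)) := by
    have : EvenCyc G p ((R₁ ++ q :: R₂) ++ r :: R₃) := by simpa using hC
    exact this.rotate
  have k1 := key hC hD hA hB (by
    clear hM hE key
    simp only [List.nodup_cons, List.nodup_append, List.mem_append, List.mem_cons]; grind)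
    (fun x hx => hE x (hm x (by simp at hx ⊢; tauto)))
  have k2 := key hC2 (fun x hx => hD x (by simp at hx ⊢; tauto)) hB hQ (by
    clear hM hE key
    simp only [List.nodup_cons, List.nodup_append, List.mem_append, List.mem_cons]; grind)
    (fun x hx => by
      have := hE x (hm x (by simp at hx ⊢; tauto))
      simp at this ⊢; tauto)
  have k3 := key hC3 (fun x hx => hD x (by simp at hx ⊢; tauto)) hQ hA (by
    clear hM hE key
    simp only [List.nodup_cons, List.nodup_append, List.mem_append, List.mem_cons]; grind)
    (fun x hx => by
      have := hE x (hm x (by simp at hx ⊢; tauto))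
      simp at this ⊢; tauto)
  simp at hmod
  omega

theorem MaxSide.off (hD : MaxSide G D) (h : Crit G W) {x : V} {L : List V} (hC : EvenCyc G x L)
    (hCD : ∀ v ∈ x :: L, v ∉ D) {e : V} (he : e ∉ x :: L) (heD : e ∉ D) :
    e ∈ W ∧ ∀ u, G.Adj e u → u ∈ x :: L := by
  have hsub := fun x L => hD.nbhd_subset hD.max (x := x) (L := L)
  obtain ⟨E, hES, heE, hconn, hcl⟩ := exists_component G (x :: L).toFinsetᶜ (e := e)
    (by rw [mem_compl, List.mem_toFinset]; exact he)
  have hEC : ∀ v ∈ E, v ∉ x :: L := fun v hv => by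
    have := hES hv
    rwa [mem_compl, List.mem_toFinset] at this
  have hEN : ∀ u ∈ E, ∀ v, G.Adj u v → v ∈ E ∨ v ∈ x :: L := by
    intro u hu v huv
    by_cases hv : v ∈ x :: L
    · exact .inr hv
    · exact .inl (hcl u hu v (by rw [mem_compl, List.mem_toFinset]; exact hv) huv)
  have hED : ∀ v ∈ E, v ∉ D := by
    intro v hv hvD
    have := hconn (E ∩ D) inter_subset_left ⟨v, mem_inter.2 ⟨hv, hvD⟩⟩ fun a ha b hb hab => by
      refine mem_inter.2 ⟨hb, ?_⟩
      by_contra hbD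
      exact hEC b hb (hsub x L hC hCD b (mem_nbhd.2 ⟨hbD, a, (mem_inter.1 ha).2, hab.symm⟩))
    rw [inter_eq_left] at this
    exact heD (this heE)
  have hNC : ∀ v ∈ nbhd G E, v ∈ x :: L := by
    intro v hv
    obtain ⟨hvE, u, hu, hvu⟩ := mem_nbhd.1 hv
    exact (hEN u hu v hvu.symm).resolve_left hvE
  have h2 : #(nbhd G E) ≤ 2 := by
    by_contra h3
    obtain ⟨p, q, r, hp, hq, hr, hpq, hpr, hqr⟩ := two_lt_card_iff.1 (not_le.1 h3)
    obtain ⟨R₁, R₂, R₃, hC', hm⟩ := hC.split (hNC p hp) (hNC q hq) (hNC r hr) hpq hpr hqr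
    obtain ⟨-, u, hu, hpu⟩ := mem_nbhd.1 hp
    obtain ⟨-, v, hv, hqv⟩ := mem_nbhd.1 hq
    obtain ⟨-, w, hw, hrw⟩ := mem_nbhd.1 hr
    obtain ⟨z, A, B, Q, hA, hB, hQ, hz, hn⟩ := hconn.exists_tripod hu hpu hv hqv hw hrw
    exact h.free.no_tripod_parity (fun x L => hsub x L) hD.three hC'
      (fun v hv => hCD v ((hm v).1 hv)) (fun v hv => ⟨hED v hv, by rw [hm]; exact hEC v hv⟩)
      hA hB hQ hz hn
  have h1 := h.card_le_one_of_evenCyc hC (fun v hv hvE => hEC v hvE hv) h2 hNC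
  have hE : ∀ v ∈ E, v = e := fun v hv => card_le_one.1 h1 v hv e heE
  have hN : ∀ u, G.Adj e u → u ∈ nbhd G E := fun u hu =>
    mem_nbhd.2 ⟨fun huE => hu.ne (hE u huE).symm, e, heE, hu.symm⟩
  refine ⟨?_, fun u hu => hNC u (hN u hu)⟩
  by_contra heW
  obtain ⟨a, b, c, hab, hac, hbc, -, -, -, ha, hb, hc⟩ := h.d3 e heW
  have := two_lt_card_iff.2 ⟨a, b, c, hN a ha, hN b hb, hN c hc, hab, hac, hbc⟩
  omega

theorem MaxSide.ctx (hD : MaxSide G D) (h : Crit G W) : Ctx G W D (nbhd G D) where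
  cyc _ _ := hD.nbhd_subset hD.max
  card := hD.three
  off _ _ hC hCD _ _ _ he heD _ := hD.off h hC hCD he heD
  cov _ hv u hu hvu := mem_nbhd.2 ⟨hv, u, hu, hvu⟩
  ends x L hC hCD w hw hwC hwD := by
    right
    intro m hm hmw
    obtain ⟨s, t, hst, hs, ht, hms, hmt⟩ := hC.nbrs (hD.nbhd_subset hD.max hC hCD m hm)
    obtain ⟨-, d, hd, hmd⟩ := mem_nbhd.1 hm
    obtain ⟨p, q, -, -, -, hN⟩ := h.cubic_of_adj_mem hw hmw.symm
    have h1 := (hN s).1 hms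
    have h2 := (hN t).1 hmt
    have h3 := (hN d).1 hmd
    have h4 : s ≠ w := by rintro rfl; exact hwC hs
    have h5 : t ≠ w := by rintro rfl; exact hwC ht
    have h6 : d ≠ w := by rintro rfl; exact hwD hd
    have h7 : s ≠ d := by rintro rfl; exact hCD _ hs hd
    have h8 : t ≠ d := by rintro rfl; exact hCD _ ht hd
    clear hN
    grind

theorem Crit.maxSide (h : Crit G W) (v₀ : V) : ∃ D, MaxSide G D := by
  by_contra hno
  have hspan : ∀ x L, EvenCyc G x L → ∀ v, v ∉ x :: L → v ∈ W := by
    intro x L hC v hv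
    by_contra hvW
    exact hno (h.exists_maxSide hC hv hvW)
  obtain ⟨x, L, hC⟩ := h.exists_evenCyc v₀
  have h6 := hC.six_le
  have h3 := h.card_le
  have hcompl := card_compl W
  have hu := card_le_univ (x :: L).toFinset
  have c : Ctx G W ∅ Wᶜ := by
    refine ⟨fun x L hC _ m hm => ?_, by omega, fun x L hC _ c hc e he _ hce => ?_, by simp,
      fun x L hC _ w hw hwC _ => .inl ?_⟩
    · by_contra hmC
      exact mem_compl.1 hm (hspan x L hC m hmC)
    · have heW := hspan x L hC e he
      refine ⟨heW, fun u hu => ?_⟩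
      by_contra huC
      exact h.not_adj heW (hspan x L hC u huC) hu
    · have h6 := hC.six_le
      have := card_lt_univ_of_notMem (s := (x :: L).toFinset) (x := w)
        (by rw [List.mem_toFinset]; exact hwC)
      have := h.big
      omega
  rcases c.exists_arc h (K := (x :: L).toFinset) (by simp) hC (by simp) with h' | h'
  · have : (x :: L).toFinset ⊆ W := fun v hv => by simpa using h' v hv
    have := card_le_card this
    omega
  · obtain ⟨p, -, q, -, -, -, h'⟩ := h'
    have : (x :: L).toFinset ⊆ {p, q} ∪ W := fun v hv => by
      have := h' v hv
      simp only [mem_union, mem_insert, mem_singleton]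
      simpa [or_assoc] using this
    have := card_le_card this
    have h1 := card_union_le {p, q} W
    have : #({p, q} : Finset V) ≤ 2 := card_le_two
    omega

end

section

variable {V : Type*} {G : SimpleGraph V}

/-- The edges of `G` whose ends have different colours. -/
def bip (G : SimpleGraph V) (f : V → Bool) : SimpleGraph V where
  Adj u v := G.Adj u v ∧ f u ≠ f v
  symm := ⟨fun _ _ h => ⟨h.1.symm, h.2.symm⟩⟩
  loopless := ⟨fun _ h => h.2 rfl⟩

theorem Seg.of_bip {f : V → Bool} {a b : V} {P : List V} (h : Seg (bip G f) a P b) : Seg G a P b := by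
  induction P generalizing a with
  | nil => exact h.1
  | cons c P ih => exact ⟨h.1.1, ih h.2⟩

theorem Seg.bip_iff {f : V → Bool} {a b : V} {P : List V} (h : Seg (bip G f) a P b) :
    f a = f b ↔ P.length % 2 = 1 := by
  induction P generalizing a with
  | nil => simpa using h.2
  | cons c P ih =>
    have h1 := ih h.2
    have h2 := h.1.2
    rw [List.length_cons]
    cases ha : f a <;> cases hb : f b <;> cases hc : f c <;> simp_all <;> omega

variable [DecidableEq V]

theorem Seg.exists_bip {a b : V} {P : List V} (h : Seg G a P b) (hn : (a :: P).Nodup)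
    (hb : b ∉ a :: P) (c : Bool) : ∃ f, f a = c ∧ Seg (bip G f) a P b := by
  induction P generalizing a c with
  | nil =>
    have hba : b ≠ a := by simpa using hb
    exact ⟨fun v => if v = a then c else !c, by simp, h, by simp [hba]⟩
  | cons u P ih =>
    obtain ⟨f, hf, hs⟩ := ih h.2 (List.nodup_cons.1 hn).2 (by simp at hb ⊢; tauto) (!c)
    refine ⟨Function.update f a c, by simp, ⟨h.1, ?_⟩, ?_⟩
    · have : u ≠ a := by rintro rfl; simp at hn
      simp [this, hf]
    · refine hs.imp fun x hx y hy hxy => ⟨hxy.1, ?_⟩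
      have h1 : x ≠ a := by rintro rfl; simp at hn hx hb; tauto
      have h2 : y ≠ a := by rintro rfl; simp at hn hy hb; tauto
      simpa [h1, h2] using hxy.2

theorem EvenCyc.exists_bip {x : V} {L : List V} (h : EvenCyc G x L) :
    ∃ f, EvenCyc (bip G f) x L := by
  obtain ⟨h1, h2, h3, h4⟩ := h
  rcases List.eq_nil_or_concat' L with rfl | ⟨L, t, rfl⟩
  · simp at h4
  obtain ⟨s1, s2⟩ := seg_append.1 h1
  obtain ⟨f, -, hs⟩ := s1.exists_bip (by
    simp only [List.nodup_cons, List.nodup_append, List.mem_append] at h2 ⊢; tauto) (by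
    simp [List.nodup_append] at h2 ⊢; grind) true
  refine ⟨f, seg_append.2 ⟨hs, s2, ?_⟩, h2, h3, h4⟩
  have := hs.bip_iff
  rw [List.length_append, List.length_singleton] at h3
  intro heq
  have := this.1 heq.symm
  omega

theorem EvenCyc.of_bip {f : V → Bool} {x : V} {L : List V} (h : EvenCyc (bip G f) x L) :
    EvenCyc G x L := ⟨h.seg.of_bip, h.nodup, h.mod, h.five⟩

end

section

variable {V : Type*} [Fintype V] [DecidableEq V] {G : SimpleGraph V} {W D K : Finset V}

omit [Fintype V] in
theorem EvenCyc.path_even (hf : Free G) {p q : V} {R S P : List V} (hC : EvenCyc G p (R ++ q :: S))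
    (hR : R.length % 2 = 1) (hP : Seg G p P q) (hn : P.Nodup)
    (hd : ∀ v ∈ P, v ∉ p :: (R ++ q :: S)) : P.length % 2 = 0 := by
  obtain ⟨h1, h2, h3, -⟩ := hC
  obtain ⟨s1, s2⟩ := seg_append.1 h1
  have k1 := hf.two_paths hP s2 (by
    clear h1 h3 hP s1 s2
    simp only [List.nodup_cons, List.nodup_append, List.mem_append, List.mem_cons] at h2 hd ⊢
    grind)
  have k2 := hf.two_paths s1 hP.reverse (by
    clear h1 h3 hP s1 s2
    simp only [List.nodup_cons, List.nodup_append, List.mem_append, List.mem_cons,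
      List.nodup_reverse, List.mem_reverse] at h2 hd ⊢
    grind)
  simp at h3 k2
  omega

omit [Fintype V] in
theorem EvenCyc.no_tripod (hf : Free G) {p q r z : V} {R₁ R₂ R₃ A B Q : List V}
    (hC : EvenCyc G p (R₁ ++ q :: (R₂ ++ r :: R₃))) (h1 : R₁.length % 2 = 1)
    (h2 : R₂.length % 2 = 1)
    (hD : ∀ v ∈ D, v ∉ p :: (R₁ ++ q :: (R₂ ++ r :: R₃))) (hA : Seg G p A z)
    (hB : Seg G q B z) (hQ : Seg G r Q z) (hm : ∀ x ∈ z :: (A ++ (B ++ Q)), x ∈ D)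
    (hn : (z :: (A ++ (B ++ Q))).Nodup) : False := by
  have hmod := hC.mod
  have hC2 : EvenCyc G q (R₂ ++ r :: (R₃ ++ p :: R₁)) := by simpa using hC.rotate
  have hC3 : EvenCyc G p ((R₁ ++ q :: R₂) ++ r :: R₃) := by simpa using hC
  simp only [List.nodup_cons, List.nodup_append, List.mem_append, List.mem_cons] at hn
  have k1 := hC.path_even hf h1 (P := A ++ z :: B.reverse) (by simp [hA, hB.reverse]) (by
    simp only [List.nodup_cons, List.nodup_append, List.mem_append, List.mem_cons,
      List.nodup_reverse, List.mem_reverse]; grind)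
    (fun v hv => hD v (hm v (by simp at hv ⊢; tauto)))
  have k2 := hC2.path_even hf h2 (P := B ++ z :: Q.reverse) (by simp [hB, hQ.reverse]) (by
    simp only [List.nodup_cons, List.nodup_append, List.mem_append, List.mem_cons,
      List.nodup_reverse, List.mem_reverse]; grind)
    (fun v hv => by
      have := hD v (hm v (by simp at hv ⊢; tauto))
      simp at this ⊢; tauto)
  have k3 := hC3.path_even hf (by simp; omega) (P := A ++ z :: Q.reverse)
    (by simp [hA, hQ.reverse]) (by
    simp only [List.nodup_cons, List.nodup_append, List.mem_append, List.mem_cons,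
      List.nodup_reverse, List.mem_reverse]; grind)
    (fun v hv => by
      have := hD v (hm v (by simp at hv ⊢; tauto))
      simp at this ⊢; tauto)
  simp at k1 k2 k3
  omega

theorem MaxSide.color (hD : MaxSide G D) (h : Crit G W) {x : V} {L : List V} {f : V → Bool}
    (hC : EvenCyc (bip G f) x L) (hCD : ∀ v ∈ x :: L, v ∉ D) {p q r : V} (hp : p ∈ nbhd G D)
    (hq : q ∈ nbhd G D) (hr : r ∈ nbhd G D) (hpq : p ≠ q) (hpr : p ≠ r) (hqr : q ≠ r)
    (f1 : f p = f q) (f2 : f q = f r) : False := by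
  have hs := hD.nbhd_subset hD.max hC.of_bip hCD
  obtain ⟨R₁, R₂, R₃, hC', hm⟩ := hC.split (hs p hp) (hs q hq) (hs r hr) hpq hpr hqr
  have hseg := hC'.seg
  simp only [seg_append] at hseg
  obtain ⟨s1, s2, -⟩ := hseg
  obtain ⟨-, u, hu, hpu⟩ := mem_nbhd.1 hp
  obtain ⟨-, v, hv, hqv⟩ := mem_nbhd.1 hq
  obtain ⟨-, w, hw, hrw⟩ := mem_nbhd.1 hr
  obtain ⟨z, A, B, Q, hA, hB, hQ, hz, hn⟩ := hD.conn.exists_tripod hu hpu hv hqv hw hrw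
  exact hC'.of_bip.no_tripod h.free (s1.bip_iff.1 f1) (s2.bip_iff.1 f2)
    (fun v hv hv' => hCD v ((hm v).1 hv') hv) hA hB hQ hz hn

theorem MaxSide.card_nbhd_le (hD : MaxSide G D) (h : Crit G W) : #(nbhd G D) ≤ 4 := by
  obtain ⟨x, L, hC, hCD⟩ := hD.cyc
  obtain ⟨f, hf⟩ := hC.exists_bip
  have key : ∀ c, #((nbhd G D).filter fun v => f v = c) ≤ 2 := by
    intro c
    by_contra hc
    obtain ⟨p, q, r, hp, hq, hr, hpq, hpr, hqr⟩ := two_lt_card_iff.1 (not_le.1 hc)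
    rw [mem_filter] at hp hq hr
    exact hD.color h hf hCD hp.1 hq.1 hr.1 hpq hpr hqr (hp.2.trans hq.2.symm) (hq.2.trans hr.2.symm)
  have h1 := key true
  have h2 := key false
  have := card_filter_add_card_filter_not (s := nbhd G D) (fun v => f v = true)
  simp only [Bool.not_eq_true] at this
  omega

/-- The even cycle is a hexagon. -/
theorem MaxSide.exists_hexagon (hD : MaxSide G D) (h : Crit G W) :
    ∃ K : Finset V, (∀ v ∈ K, v ∉ D) ∧
      ((∃ x L, EvenCyc G x L ∧ L.length = 5 ∧ ∀ v ∈ x :: L, v ∉ D ∧ (v ∈ W ∨ v ∈ nbhd G D)) ∨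
      ∃ x R₁ y R₂ b, Arc G W D K x R₁ y R₂ b ∧ R₁.length + R₂.length = 4 ∧
        ∀ v ∈ R₁ ++ R₂, v ∈ W ∨ v ∈ nbhd G D) := by
  obtain ⟨x, L, hC, hCD⟩ := hD.cyc
  have h3 := h.card_le
  have h4 := hD.card_nbhd_le h
  have hun := card_union_le W (nbhd G D)
  have hcov : ∀ {v}, v ∉ D → (v ∈ W ∨ ∃ u ∈ D, G.Adj v u) → v ∈ W ∨ v ∈ nbhd G D := by
    intro v hv h'
    exact h'.imp_right fun hu => mem_nbhd.2 ⟨hv, hu⟩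
  refine ⟨(x :: L).toFinset, by simpa using hCD, ?_⟩
  rcases (hD.ctx h).exists_arc h (K := (x :: L).toFinset) (by simpa using hCD) hC (by simp)
    with h' | ⟨p, R₁, q, R₂, b, a, h'⟩
  · left
    simp only [List.mem_toFinset] at h'
    refine ⟨x, L, hC, ?_, fun v hv => ⟨hCD v hv, hcov (hCD v hv) (h' v hv)⟩⟩
    have : (x :: L).toFinset ⊆ W ∪ nbhd G D := fun v hv => by
      rw [List.mem_toFinset] at hv
      exact mem_union.2 (hcov (hCD v hv) (h' v hv))
    have := card_le_card this
    rw [List.toFinset_card_of_nodup hC.nodup, List.length_cons] at this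
    have := hC.mod
    have := hC.five
    omega
  · right
    have hn := a.cyc.nodup
    have hm := a.mem
    have hs : ∀ v ∈ R₁ ++ R₂, v ∈ W ∨ v ∈ nbhd G D := by
      intro v hv
      have hvK : v ∈ (x :: L).toFinset := (hm v).1 (by simp at hv ⊢; tauto)
      refine hcov (hCD v (by simpa using hvK)) ?_
      have h1 : v ≠ p := by rintro rfl; simp at hn hv; tauto
      have h2 : v ≠ q := by
        rintro rfl
        clear hm
        simp only [List.nodup_cons, List.nodup_append, List.mem_append, List.mem_cons] at hn hv
        grind
      have := h' v hvK
      tauto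
    refine ⟨p, R₁, q, R₂, b, a, ?_, hs⟩
    have hsub : (R₁ ++ R₂).toFinset ⊆ W ∪ nbhd G D := fun v hv => by
      rw [List.mem_toFinset] at hv
      exact mem_union.2 (hs v hv)
    have := card_le_card hsub
    rw [List.toFinset_card_of_nodup (by
      clear hm
      simp only [List.nodup_cons, List.nodup_append, List.mem_append, List.mem_cons] at hn ⊢
      grind), List.length_append] at this
    have h5 := a.cyc.mod
    have h6 := a.cyc.five
    simp at h5 h6
    omega

end

section

variable {V : Type*} [Fintype V] [DecidableEq V] {G : SimpleGraph V} {W D K : Finset V}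

section Hexagon

variable {c₀ c₁ c₂ c₃ c₄ c₅ : V}

omit [Fintype V] [DecidableEq V] in
theorem EvenCyc.hex_rotate (hC : EvenCyc G c₀ [c₁, c₂, c₃, c₄, c₅]) :
    EvenCyc G c₁ [c₂, c₃, c₄, c₅, c₀] := hC.rotate (P := [])

omit [Fintype V] [DecidableEq V] in
theorem EvenCyc.hex_reflect (hC : EvenCyc G c₀ [c₁, c₂, c₃, c₄, c₅]) :
    EvenCyc G c₀ [c₅, c₄, c₃, c₂, c₁] := EvenCyc.reverse (P := [c₁, c₂]) (Q := [c₄, c₅]) hC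

theorem MaxSide.no_alternate (hD : MaxSide G D) (h : Crit G W)
    (hC : EvenCyc G c₀ [c₁, c₂, c₃, c₄, c₅]) (hCD : ∀ v ∈ [c₀, c₁, c₂, c₃, c₄, c₅], v ∉ D)
    (h1 : c₁ ∈ nbhd G D) (h3 : c₃ ∈ nbhd G D) (h5 : c₅ ∈ nbhd G D) : False := by
  obtain ⟨f, hf⟩ := hC.exists_bip
  have hs := hf.seg
  have hn := hf.nodup
  simp only [seg_cons, seg_nil] at hs
  obtain ⟨-, s1, s2, s3, s4, -⟩ := hs
  refine hD.color h hf hCD h1 h3 h5 (by simp at hn; tauto) (by simp at hn; tauto)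
    (by simp at hn; tauto) ((Seg.bip_iff (P := [c₂]) ⟨s1, s2⟩).2 rfl)
    ((Seg.bip_iff (P := [c₄]) ⟨s3, s4⟩).2 rfl)

theorem MaxSide.opposite (hD : MaxSide G D) (h : Crit G W)
    (hC : EvenCyc G c₀ [c₁, c₂, c₃, c₄, c₅]) (hCD : ∀ v ∈ [c₀, c₁, c₂, c₃, c₄, c₅], v ∉ D)
    (hW : ∀ v ∈ [c₀, c₁, c₂, c₃, c₄, c₅], v ∈ W ∨ v ∈ nbhd G D) (h0 : c₀ ∈ W) :
    c₃ ∈ W ∧ c₁ ∈ nbhd G D ∧ c₂ ∈ nbhd G D ∧ c₄ ∈ nbhd G D ∧ c₅ ∈ nbhd G D := by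
  have hn := hC.nodup
  have hs := hC.seg
  simp only [seg_cons, seg_nil] at hs
  obtain ⟨s0, s1, s2, s3, s4, s5⟩ := hs
  simp only [List.mem_cons, List.not_mem_nil, or_false, forall_eq_or_imp, forall_eq] at hW
  obtain ⟨-, w1, w2, w3, w4, w5⟩ := hW
  have m1 := w1.resolve_left fun hw => h.not_adj h0 hw s0
  have m5 := w5.resolve_left fun hw => h.not_adj hw h0 s5
  have m2 := w2.resolve_left fun hw =>
    h.no_common_nbr h0 hw (by rintro rfl; simp at hn) s0 s1.symm
  have m4 := w4.resolve_left fun hw =>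
    h.no_common_nbr h0 hw (by rintro rfl; simp at hn) s5.symm s4
  exact ⟨w3.resolve_right fun m3 => hD.no_alternate h hC hCD m1 m3 m5, m1, m2, m4, m5⟩

theorem MaxSide.no_short_chord_of_mem (hD : MaxSide G D) (h : Crit G W)
    (hC : EvenCyc G c₀ [c₁, c₂, c₃, c₄, c₅]) (hCD : ∀ v ∈ [c₀, c₁, c₂, c₃, c₄, c₅], v ∉ D)
    (hW : ∀ v ∈ [c₁, c₃, c₄, c₅], v ∈ W ∨ v ∈ nbhd G D) (hc : G.Adj c₀ c₂) (h3 : c₃ ∈ W) :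
    False := by
  have hn := hC.nodup
  have hs := hC.seg
  simp only [seg_cons, seg_nil] at hs
  obtain ⟨s0, s1, s2, s3, s4, s5⟩ := hs
  simp only [List.mem_cons, List.not_mem_nil, or_false, forall_eq_or_imp, forall_eq] at hW
  obtain ⟨w1, w3, w4, w5⟩ := hW
  have m1 := w1.resolve_left fun hw => h.no_triangle hw s0.symm s1 hc
  have m5 := w5.resolve_left fun hw =>
    h.no_common_nbr h3 hw (by rintro rfl; simp at hn) s3 s4.symm
  obtain ⟨-, u, hu, h1u⟩ := mem_nbhd.1 m1
  obtain ⟨-, v, hv, h5v⟩ := mem_nbhd.1 m5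
  obtain ⟨P, hP, hPn, hPD, -⟩ := hD.conn.exists_path hu h1u hv h5v
  have hd : ∀ v ∈ P, v ∉ [c₀, c₁, c₂, c₃, c₄, c₅] := fun v hv hv' => hCD v hv' (hPD v hv)
  have key : ∀ Q, Seg G c₅ Q c₁ → (c₁ :: c₅ :: Q).Nodup →
      (∀ v ∈ Q, v ∈ [c₀, c₁, c₂, c₃, c₄, c₅]) → (P.length + Q.length) % 4 ≠ 2 := by
    intro Q hQ hQn hQC
    refine h.free.two_paths hP hQ ?_
    clear hn hCD hPD w3 w4 w5 w1 m1 m5 hC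
    simp only [List.nodup_cons, List.nodup_append, List.mem_append, List.mem_cons] at hQn hd ⊢
    grind
  have e1 : (c₁ :: c₅ :: [c₀]).Nodup ∧ (c₁ :: c₅ :: [c₀, c₂]).Nodup ∧
      (c₁ :: c₅ :: [c₄, c₃, c₂]).Nodup ∧ (c₁ :: c₅ :: [c₄, c₃, c₂, c₀]).Nodup := by
    clear key hd hCD hPD w3 w4 w5 w1 m1 m5 hC
    simp at hn ⊢
    grind
  have k1 := key [c₀] ⟨s5, s0⟩ e1.1 (by simp)
  have k2 := key [c₀, c₂] ⟨s5, hc, s1.symm⟩ e1.2.1 (by simp)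
  have k3 := key [c₄, c₃, c₂] ⟨s4.symm, s3.symm, s2.symm, s1.symm⟩ e1.2.2.1 (by simp)
  have k4 := key [c₄, c₃, c₂, c₀] ⟨s4.symm, s3.symm, s2.symm, hc.symm, s0⟩ e1.2.2.2 (by simp)
  simp at k1 k2 k3 k4
  omega

theorem MaxSide.no_short_chord (hD : MaxSide G D) (h : Crit G W)
    (hC : EvenCyc G c₀ [c₁, c₂, c₃, c₄, c₅]) (hCD : ∀ v ∈ [c₀, c₁, c₂, c₃, c₄, c₅], v ∉ D)
    (hW : ∀ v ∈ [c₁, c₃, c₄, c₅], v ∈ W ∨ v ∈ nbhd G D) (hc : G.Adj c₀ c₂) : False := by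
  by_cases h3 : c₃ ∈ W
  · exact hD.no_short_chord_of_mem h hC hCD hW hc h3
  by_cases h5 : c₅ ∈ W
  · refine hD.no_short_chord_of_mem h (c₀ := c₂) (c₁ := c₁) (c₂ := c₀) (c₃ := c₅) (c₄ := c₄)
      (c₅ := c₃) ?_ ?_ ?_ hc.symm h5
    · exact hC.hex_rotate.hex_rotate.hex_reflect
    · intro v hv; exact hCD v (by simp at hv ⊢; tauto)
    · intro v hv; exact hW v (by simp at hv ⊢; tauto)
  have hs := hC.seg
  simp only [seg_cons, seg_nil] at hs
  have m1 := (hW c₁ (by simp)).resolve_left fun hw => h.no_triangle hw hs.1.symm hs.2.1 hc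
  exact hD.no_alternate h hC hCD m1 ((hW c₃ (by simp)).resolve_left h3)
    ((hW c₅ (by simp)).resolve_left h5)

end Hexagon

end

section

variable {V : Type*} [DecidableEq V] {G : SimpleGraph V} {D : Finset V}

/-- A path from `a` to `b` with inner vertices `P` in `D`. -/
def PathIn (G : SimpleGraph V) (D : Finset V) (a : V) (P : List V) (b : V) : Prop :=
  Seg G a P b ∧ P.Nodup ∧ ∀ v ∈ P, v ∈ D

theorem Conn.no_linkage (h : Conn G D) {a b c d : V} (ha : ∃ u ∈ D, G.Adj a u)
    (hb : ∃ u ∈ D, G.Adj b u) (hc : ∃ u ∈ D, G.Adj c u) (hd : ∃ u ∈ D, G.Adj d u)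
    (hac : ∀ P, PathIn G D a P c → P.length % 4 = 2)
    (hbd : ∀ P, PathIn G D b P d → P.length % 4 = 2)
    (had : ∀ P, PathIn G D a P d → P.length % 4 = 0)
    (hbc : ∀ P, PathIn G D b P c → P.length % 4 = 0)
    (hab : ∀ P, PathIn G D a P b → P.length % 4 ≤ 1)
    (hcd : ∀ P, PathIn G D c P d → P.length % 4 ≤ 1)
    (hdis : ∀ P Q, PathIn G D a P b → PathIn G D c Q d → (∀ v ∈ P, v ∉ Q) →
      (P.length + Q.length) % 4 ≠ 2) : False := by
  obtain ⟨ua, hua, ha⟩ := ha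
  obtain ⟨ub, hub, hb⟩ := hb
  obtain ⟨uc, huc, hc⟩ := hc
  obtain ⟨ud, hud, hd⟩ := hd
  obtain ⟨Q, hQ, hQn, hQD, hQne⟩ := h.exists_path huc hc hud hd
  have q0 := hcd Q ⟨hQ, hQn, hQD⟩
  obtain ⟨A, v, hA, hAn, hAm, hv⟩ := h.exists_path_to (T := Q.toFinset)
    (fun x hx => hQD x (by simpa using hx)) (by simpa using hQne) hua ha
  simp only [List.mem_toFinset] at hAm hv
  obtain ⟨B, z, hB, hBn, hBm, hz⟩ := h.exists_path_to (T := Q.toFinset ∪ A.toFinset)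
    (fun x hx => by
      rcases mem_union.1 hx with hx | hx
      · exact hQD x (by simpa using hx)
      · exact (hAm x (by simpa using hx)).1)
    ⟨v, by simp [hv]⟩ hub hb
  simp only [List.mem_toFinset, mem_union] at hBm hz
  have hQ' : PathIn G D c Q d := ⟨hQ, hQn, hQD⟩
  obtain ⟨S, T, rfl⟩ := List.append_of_mem hv
  obtain ⟨hS, hT⟩ := seg_append.1 hQ
  have hp : ∀ {a b P}, Seg G a P b → P.Nodup → (∀ v ∈ P, v ∈ D) → PathIn G D a P b :=
    fun h1 h2 h3 => ⟨h1, h2, h3⟩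
  simp only [List.nodup_cons, List.nodup_append, List.mem_append, List.mem_cons] at hQn hQD hAm hBm
  have k1 := hac (A ++ v :: S.reverse) (hp (by simp [hA, hS.reverse])
    (by clear hac hbd had hbc hab hcd hdis hp h
        simp only [List.nodup_cons, List.nodup_append, List.mem_append, List.mem_cons,
          List.nodup_reverse, List.mem_reverse]; grind)
    (by intro x hx; simp only [List.mem_append, List.mem_cons, List.mem_reverse] at hx; grind))
  have k2 := had (A ++ v :: T) (hp (by simp [hA, hT])
    (by clear hac hbd had hbc hab hcd hdis hp h
        simp only [List.nodup_cons, List.nodup_append, List.mem_append, List.mem_cons]; grind)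
    (by intro x hx; simp only [List.mem_append, List.mem_cons] at hx; grind))
  clear hac had hcd
  simp only [List.mem_append, List.mem_cons] at hz
  rcases hz with (hz | rfl | hz) | hz
  · clear hdis
    obtain ⟨S, S', rfl⟩ := List.append_of_mem hz
    obtain ⟨hS1, hS2⟩ := seg_append.1 hS
    simp only [List.nodup_cons, List.nodup_append, List.mem_append, List.mem_cons] at hQn hQD hAm hBm
    have k3 := hab (A ++ v :: (S'.reverse ++ z :: B.reverse))
      (hp (by simp [hA, hS2.reverse, hB.reverse])
      (by clear hbd hbc hab hp h
          simp only [List.nodup_cons, List.nodup_append, List.mem_append, List.mem_cons,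
            List.nodup_reverse, List.mem_reverse]; grind)
      (by intro x hx; simp only [List.mem_append, List.mem_cons, List.mem_reverse] at hx; grind))
    have k4 := hbc (B ++ z :: S.reverse) (hp (by simp [hB, hS1.reverse])
      (by clear hbd hbc hab hp h
          simp only [List.nodup_cons, List.nodup_append, List.mem_append, List.mem_cons,
            List.nodup_reverse, List.mem_reverse]; grind)
      (by intro x hx; simp only [List.mem_append, List.mem_cons, List.mem_reverse] at hx; grind))
    have k5 := hbd (B ++ z :: (S' ++ v :: T)) (hp (by simp [hB, hS2, hT])
      (by clear hbd hbc hab hp h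
          simp only [List.nodup_cons, List.nodup_append, List.mem_append, List.mem_cons]; grind)
      (by intro x hx; simp only [List.mem_append, List.mem_cons] at hx; grind))
    simp at q0 k1 k2 k3 k4 k5
    omega
  · clear hdis
    have k3 := hab (A ++ z :: B.reverse) (hp (by simp [hA, hB.reverse])
      (by clear hbd hbc hab hp h
          simp only [List.nodup_cons, List.nodup_append, List.mem_append, List.mem_cons,
            List.nodup_reverse, List.mem_reverse]; grind)
      (by intro x hx; simp only [List.mem_append, List.mem_cons, List.mem_reverse] at hx; grind))
    have k4 := hbc (B ++ z :: S.reverse) (hp (by simp [hB, hS.reverse])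
      (by clear hbd hbc hab hp h
          simp only [List.nodup_cons, List.nodup_append, List.mem_append, List.mem_cons,
            List.nodup_reverse, List.mem_reverse]; grind)
      (by intro x hx; simp only [List.mem_append, List.mem_cons, List.mem_reverse] at hx; grind))
    have k5 := hbd (B ++ z :: T) (hp (by simp [hB, hT])
      (by clear hbd hbc hab hp h
          simp only [List.nodup_cons, List.nodup_append, List.mem_append, List.mem_cons]; grind)
      (by intro x hx; simp only [List.mem_append, List.mem_cons] at hx; grind))
    simp at q0 k1 k2 k3 k4 k5
    omega
  · clear hdis
    obtain ⟨T, T', rfl⟩ := List.append_of_mem hz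
    obtain ⟨hT1, hT2⟩ := seg_append.1 hT
    simp only [List.nodup_cons, List.nodup_append, List.mem_append, List.mem_cons] at hQn hQD hAm hBm
    have k3 := hab (A ++ v :: (T ++ z :: B.reverse)) (hp (by simp [hA, hT1, hB.reverse])
      (by clear hbd hbc hab hp h
          simp only [List.nodup_cons, List.nodup_append, List.mem_append, List.mem_cons,
            List.nodup_reverse, List.mem_reverse]; grind)
      (by intro x hx; simp only [List.mem_append, List.mem_cons, List.mem_reverse] at hx; grind))
    have k4 := hbc (B ++ z :: (T.reverse ++ v :: S.reverse))
      (hp (by simp [hB, hT1.reverse, hS.reverse])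
      (by clear hbd hbc hab hp h
          simp only [List.nodup_cons, List.nodup_append, List.mem_append, List.mem_cons,
            List.nodup_reverse, List.mem_reverse]; grind)
      (by intro x hx; simp only [List.mem_append, List.mem_cons, List.mem_reverse] at hx; grind))
    have k5 := hbd (B ++ z :: T') (hp (by simp [hB, hT2])
      (by clear hbd hbc hab hp h
          simp only [List.nodup_cons, List.nodup_append, List.mem_append, List.mem_cons]; grind)
      (by intro x hx; simp only [List.mem_append, List.mem_cons] at hx; grind))
    simp at q0 k1 k2 k3 k4 k5
    omega
  · obtain ⟨A, A', rfl⟩ := List.append_of_mem hz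
    obtain ⟨hA1, hA2⟩ := seg_append.1 hA
    simp only [List.nodup_cons, List.nodup_append, List.mem_append, List.mem_cons] at hAn hAm hBm
    have hP : PathIn G D a (A ++ z :: B.reverse) b := hp (by simp [hA1, hB.reverse])
      (by clear hbd hbc hab hp h hdis
          simp only [List.nodup_cons, List.nodup_append, List.mem_append, List.mem_cons,
            List.nodup_reverse, List.mem_reverse]; grind)
      (by intro x hx; simp only [List.mem_append, List.mem_cons, List.mem_reverse] at hx; grind)
    have k3 := hab _ hP
    have k4 := hbc (B ++ z :: (A' ++ v :: S.reverse)) (hp (by simp [hB, hA2, hS.reverse])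
      (by clear hbd hbc hab hp h hdis
          simp only [List.nodup_cons, List.nodup_append, List.mem_append, List.mem_cons,
            List.nodup_reverse, List.mem_reverse]; grind)
      (by intro x hx; simp only [List.mem_append, List.mem_cons, List.mem_reverse] at hx; grind))
    have k5 := hbd (B ++ z :: (A' ++ v :: T)) (hp (by simp [hB, hA2, hT])
      (by clear hbd hbc hab hp h hdis
          simp only [List.nodup_cons, List.nodup_append, List.mem_append, List.mem_cons]; grind)
      (by intro x hx; simp only [List.mem_append, List.mem_cons] at hx; grind))
    have k6 := hdis _ _ hP hQ' (by
      clear hbd hbc hab hp h hdis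
      intro x hx; simp only [List.mem_append, List.mem_cons, List.mem_reverse] at hx ⊢; grind)
    simp at q0 k1 k2 k3 k4 k5 k6
    omega

end

section

variable {V : Type*} [Fintype V] [DecidableEq V] {G : SimpleGraph V} {W D K : Finset V}

variable {c₀ c₁ c₂ c₃ c₄ c₅ : V}

omit [Fintype V] in
theorem PathIn.ne (hf : Free G) {a b : V} {P Q : List V} (hP : PathIn G D a P b) (hQ : Seg G b Q a)
    (hn : (a :: b :: Q).Nodup) (hQD : ∀ v ∈ a :: b :: Q, v ∉ D) :
    (P.length + Q.length) % 4 ≠ 2 := by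
  obtain ⟨h1, h2, h3⟩ := hP
  refine hf.two_paths h1 hQ ?_
  clear h1 hQ
  simp only [List.nodup_cons, List.nodup_append, List.mem_append, List.mem_cons] at hn hQD ⊢
  grind

theorem MaxSide.no_bridge (hD : MaxSide G D) (h : Crit G W)
    (hC : EvenCyc G c₀ [c₁, c₂, c₃, c₄, c₅]) {w : V}
    (hCD : ∀ v ∈ [w, c₀, c₁, c₂, c₃, c₄, c₅], v ∉ D) (hw : w ∉ [c₀, c₁, c₂, c₃, c₄, c₅])
    (h0 : G.Adj c₀ w) (h3 : G.Adj w c₃) (m1 : c₁ ∈ nbhd G D) (m2 : c₂ ∈ nbhd G D)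
    (m4 : c₄ ∈ nbhd G D) (m5 : c₅ ∈ nbhd G D) : False := by
  have hn := hC.nodup
  have hs := hC.seg
  have hf := h.free
  simp only [seg_cons, seg_nil] at hs
  obtain ⟨s0, s1, s2, s3, s4, s5⟩ := hs
  have hn' : (w :: [c₀, c₁, c₂, c₃, c₄, c₅]).Nodup := List.nodup_cons.2 ⟨hw, hn⟩
  let f : Fin 7 → V := [w, c₀, c₁, c₂, c₃, c₄, c₅].get
  have hinj : Function.Injective f := List.nodup_iff_injective_get.1 hn'
  have key : ∀ {P} (i j : Fin 7) (Q : List (Fin 7)), PathIn G D (f i) P (f j) →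
      Seg G (f j) (Q.map f) (f i) → (i :: j :: Q).Nodup → (P.length + Q.length) % 4 ≠ 2 := by
    intro P i j Q hP hQ hQn
    have := hP.ne hf hQ (hQn.map hinj) fun v hv => by
      obtain ⟨k, -, rfl⟩ := List.mem_map.1 (show v ∈ (i :: j :: Q).map f from hv)
      exact hCD _ (List.get_mem _ _)
    simpa using this
  have r0 := s0.symm
  have r1 := s1.symm
  have r2 := s2.symm
  have r3 := s3.symm
  have r4 := s4.symm
  have r5 := s5.symm
  have q0 := h0.symm
  have q3 := h3.symm
  refine hD.conn.no_linkage (mem_nbhd.1 m1).2 (mem_nbhd.1 m2).2 (mem_nbhd.1 m4).2 (mem_nbhd.1 m5).2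
    ?_ ?_ ?_ ?_ ?_ ?_ ?_
  · intro P hP
    have k1 := key 2 5 [4, 3] hP (by simp [f, *]) (by decide)
    have k2 := key 2 5 [4, 0, 1] hP (by simp [f, *]) (by decide)
    have k3 := key 2 5 [6, 1, 0, 4, 3] hP (by simp [f, *]) (by decide)
    simp at k1 k2 k3
    omega
  · intro P hP
    have k1 := key 3 6 [5, 4] hP (by simp [f, *]) (by decide)
    have k2 := key 3 6 [1, 0, 4] hP (by simp [f, *]) (by decide)
    have k3 := key 3 6 [5, 4, 0, 1, 2] hP (by simp [f, *]) (by decide)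
    simp at k1 k2 k3
    omega
  · intro P hP
    have k1 := key 2 6 [1] hP (by simp [f, *]) (by decide)
    have k2 := key 2 6 [5, 4, 3] hP (by simp [f, *]) (by decide)
    have k3 := key 2 6 [1, 0, 4, 3] hP (by simp [f, *]) (by decide)
    simp at k1 k2 k3
    omega
  · intro P hP
    have k1 := key 3 5 [4] hP (by simp [f, *]) (by decide)
    have k2 := key 3 5 [6, 1, 2] hP (by simp [f, *]) (by decide)
    have k3 := key 3 5 [4, 0, 1, 2] hP (by simp [f, *]) (by decide)
    simp at k1 k2 k3
    omega
  · intro P hP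
    have k1 := key 2 3 [] hP (by simp [f, *]) (by decide)
    have k2 := key 2 3 [4, 0, 1] hP (by simp [f, *]) (by decide)
    simp at k1 k2
    omega
  · intro P hP
    have k1 := key 5 6 [] hP (by simp [f, *]) (by decide)
    have k2 := key 5 6 [1, 0, 4] hP (by simp [f, *]) (by decide)
    simp at k1 k2
    omega
  · rintro P Q ⟨hP, hPn, hPD⟩ ⟨hQ, hQn, hQD⟩ hPQ
    have := hf.two_paths (P := P) (Q := c₃ :: c₄ :: (Q ++ [c₅, c₀])) hP (by simp [*]) (by
      clear key hinj f
      simp only [List.nodup_cons, List.nodup_append, List.mem_append, List.mem_cons,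
        List.not_mem_nil, or_false, not_or] at hCD ⊢
      grind)
    simp at this
    omega

/-- A hexagon through two vertices of degree two and four neighbours of `D`. -/
theorem MaxSide.exists_opposite (hD : MaxSide G D) (h : Crit G W) :
    ∃ c₀ c₁ c₂ c₃ c₄ c₅, EvenCyc G c₀ [c₁, c₂, c₃, c₄, c₅] ∧
      (∀ v ∈ [c₀, c₁, c₂, c₃, c₄, c₅], v ∉ D) ∧ c₀ ∈ W ∧
      c₃ ∈ W ∧ c₁ ∈ nbhd G D ∧ c₂ ∈ nbhd G D ∧ c₄ ∈ nbhd G D ∧ c₅ ∈ nbhd G D := by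
  obtain ⟨K, hK, h' | h'⟩ := hD.exists_hexagon h
  · obtain ⟨x, L, hC, hL, hm⟩ := h'
    have hw : ∃ v ∈ x :: L, v ∈ W := by
      by_contra hno
      push Not at hno
      match L, hL with
      | [c₁, c₂, c₃, c₄, c₅], _ =>
        exact hD.no_alternate h hC (fun v hv => (hm v hv).1)
          ((hm c₁ (by simp)).2.resolve_left (hno _ (by simp)))
          ((hm c₃ (by simp)).2.resolve_left (hno _ (by simp)))
          ((hm c₅ (by simp)).2.resolve_left (hno _ (by simp)))
    obtain ⟨c₀, hc, h0⟩ := hw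
    obtain ⟨L', s', p', l'⟩ := hC.seg.exists_rotate hC.nodup hc
    have hC' : EvenCyc G c₀ L' := ⟨s', p'.nodup_iff.2 hC.nodup, l' ▸ hC.mod, l' ▸ hC.five⟩
    have hm' : ∀ v ∈ c₀ :: L', v ∉ D ∧ (v ∈ W ∨ v ∈ nbhd G D) := fun v hv => hm v (p'.mem_iff.1 hv)
    rw [hL] at l'
    match L', l' with
    | [c₁, c₂, c₃, c₄, c₅], _ =>
      exact ⟨c₀, c₁, c₂, c₃, c₄, c₅, hC', fun v hv => (hm' v hv).1, h0,
        hD.opposite h hC' (fun v hv => (hm' v hv).1) (fun v hv => (hm' v hv).2) h0⟩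
  · exfalso
    obtain ⟨x, R₁, y, R₂, b, a, hl, hm⟩ := h'
    have hp := a.parity h (hD.ctx h) hK
    have hC := a.cyc
    have hCD : ∀ v ∈ x :: (R₁ ++ y :: R₂), v ∉ D := fun v hv => hK v ((a.mem v).1 hv)
    have hn := a.cyc.nodup
    have hs := a.cyc.seg
    obtain rfl | ⟨w, hw, rfl, hwK, hwD⟩ := a.type
    · have hc := seg_nil.1 a.seg
      match R₁, R₂, hl with
      | [], _, _ => simp at hp
      | [c₁], [c₃, c₄, c₅], _ => exact hD.no_short_chord h hC hCD hm hc
      | [c₁, c₂], _, _ => simp at hp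
      | [c₃, c₄, c₅], [c₁], _ =>
        exact hD.no_short_chord h hC.rotate
          (fun v hv => hCD v (by simp at hv ⊢; tauto))
          (fun v hv => hm v (by simp at hv ⊢; tauto)) hc.symm
      | [_, _, _, _], _, _ => simp at hp
      | [_], _ :: _ :: _ :: _ :: _, hl | [_, _, _], _ :: _ :: _, hl
      | _ :: _ :: _ :: _ :: _ :: _, _, hl => simp at hl <;> omega
    · obtain ⟨hxw, hwy⟩ := a.seg
      match R₁, R₂, hl with
      | [], _, _ => exact h.no_triangle hw hxw.symm hwy hs.1
      | [_], _, _ => simp at hp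
      | [c₁, c₂], [c₄, c₅], _ =>
        have hwC : ∀ v ∈ x :: ([c₁, c₂] ++ y :: [c₄, c₅]), w ≠ v := by
          rintro v hv rfl; exact hwK ((a.mem w).1 hv)
        simp only [List.cons_append, List.nil_append, seg_cons, seg_nil] at hs
        obtain ⟨s0, s1, s2, s3, s4, s5⟩ := hs
        have m : ∀ v ∈ [c₁, c₂, c₄, c₅], v ≠ w → (G.Adj v x ∨ G.Adj v y) → v ∈ nbhd G D := by
          intro v hv hvw hx
          refine (hm v hv).resolve_left fun hvW => ?_
          rcases hx with hx | hx
          · exact h.no_common_nbr hvW hw hvw hx hxw.symm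
          · exact h.no_common_nbr hvW hw hvw hx hwy
        refine hD.no_bridge h hC (w := w) ?_ ?_ hxw hwy ?_ ?_ ?_ ?_
        · intro v hv
          rcases List.mem_cons.1 hv with rfl | hv
          · exact hwD
          · exact hCD v hv
        · intro hwm; exact hwC w hwm rfl
        · exact m _ (by simp) (hwC _ (by simp)).symm (.inl s0.symm)
        · exact m _ (by simp) (hwC _ (by simp)).symm (.inr s2)
        · exact m _ (by simp) (hwC _ (by simp)).symm (.inr s3.symm)
        · exact m _ (by simp) (hwC _ (by simp)).symm (.inl s5)
      | [_, _, _], _, _ => simp at hp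
      | [_, _, _, _], [], _ => 
        exact h.no_triangle hw hxw.symm hwy (seg_nil.1 (seg_append.1 hs).2).symm
      | [_, _], _ :: _ :: _ :: _, hl | [_, _, _, _], _ :: _, hl
      | _ :: _ :: _ :: _ :: _ :: _, _, hl => simp at hl <;> omega

end

section

/-- A hexagon with two opposite vertices of degree two and four vertices of degree three. -/
structure Hex {V : Type*} (G : SimpleGraph V) (c₀ c₁ c₂ c₃ c₄ c₅ d₁ d₂ d₄ d₅ : V) : Prop where
  nodup : [c₀, c₁, c₂, c₃, c₄, c₅].Nodup
  adj0 : ∀ u, G.Adj c₀ u ↔ u = c₁ ∨ u = c₅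
  adj1 : ∀ u, G.Adj c₁ u ↔ u = c₀ ∨ u = c₂ ∨ u = d₁
  adj2 : ∀ u, G.Adj c₂ u ↔ u = c₁ ∨ u = c₃ ∨ u = d₂
  adj3 : ∀ u, G.Adj c₃ u ↔ u = c₂ ∨ u = c₄
  adj4 : ∀ u, G.Adj c₄ u ↔ u = c₃ ∨ u = c₅ ∨ u = d₄
  adj5 : ∀ u, G.Adj c₅ u ↔ u = c₄ ∨ u = c₀ ∨ u = d₅
  notMem1 : d₁ ∉ [c₀, c₁, c₂, c₃, c₄, c₅]
  notMem2 : d₂ ∉ [c₀, c₁, c₂, c₃, c₄, c₅]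
  notMem4 : d₄ ∉ [c₀, c₁, c₂, c₃, c₄, c₅]
  notMem5 : d₅ ∉ [c₀, c₁, c₂, c₃, c₄, c₅]

section Reattach

variable {V : Type*} {G H : SimpleGraph V} {a b : V} {P : List V}

/-- The ends of a path in `H` whose inner vertices induce a subgraph of `G` can be changed. -/
theorem Seg.reattach (h : Seg H a P b) (hne : P ≠ [])
    (hGH : ∀ u ∈ P, ∀ v ∈ P, H.Adj u v → G.Adj u v) :
    ∃ p ∈ P, ∃ q ∈ P, H.Adj a p ∧ H.Adj q b ∧ (P.Nodup → p = q → P.length = 1) ∧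
      ∀ a' b', G.Adj a' p → G.Adj q b' → Seg G a' P b' := by
  induction P generalizing a with
  | nil => exact (hne rfl).elim
  | cons p P ih =>
    obtain ⟨hap, h⟩ := h
    rcases P.eq_nil_or_concat' with rfl | ⟨P', q', hP⟩
    · exact ⟨p, by simp, p, by simp, hap, h, by simp, fun _ _ h1 h2 => ⟨h1, h2⟩⟩
    · obtain ⟨p', hp', q, hq, h1, h2, -, h4⟩ := ih h (by simp [hP])
        fun u hu v hv => hGH u (by simp [hu]) v (by simp [hv])
      refine ⟨p, by simp, q, by simp [hq], hap, h2, ?_, fun a' b' ha hb =>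
        ⟨ha, h4 p b' (hGH _ (by simp) _ (by simp [hp']) h1) hb⟩⟩
      rintro hn rfl
      exact absurd hq (List.nodup_cons.1 hn).1

end Reattach

variable {V : Type*} {G : SimpleGraph V} {c₀ c₁ c₂ c₃ c₄ c₅ d₁ d₂ d₄ d₅ : V}

/-- The graph in which the hexagon is replaced by `c₁` joined to `d₁, d₅` and `c₂` joined to
`d₂, d₄`. -/
def hexReduce (G : SimpleGraph V) (c₁ c₂ d₁ d₂ d₄ d₅ : V) : SimpleGraph V :=
  .fromRel fun u v => (G.Adj u v ∧ u ≠ c₁ ∧ u ≠ c₂ ∧ v ≠ c₁ ∧ v ≠ c₂) ∨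
    (u = c₁ ∧ (v = d₁ ∨ v = d₅)) ∨ (u = c₂ ∧ (v = d₂ ∨ v = d₄))

theorem hexReduce_adj_of_ne {u v : V} (hu1 : u ≠ c₁) (hu2 : u ≠ c₂) (hv1 : v ≠ c₁) (hv2 : v ≠ c₂)
    (h : (hexReduce G c₁ c₂ d₁ d₂ d₄ d₅).Adj u v) : G.Adj u v := by
  simp only [hexReduce, SimpleGraph.fromRel_adj] at h
  obtain ⟨-, (h | h | h) | h | h | h⟩ := h
  · exact h.1
  · exact (hu1 h.1).elim
  · exact (hu2 h.1).elim
  · exact h.1.symm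
  · exact (hv1 h.1).elim
  · exact (hv2 h.1).elim

theorem hexReduce_comm : hexReduce G c₁ c₂ d₁ d₂ d₄ d₅ = hexReduce G c₂ c₁ d₂ d₁ d₅ d₄ := by
  unfold hexReduce
  congr 1
  funext u v
  exact propext ⟨fun h => h.imp (fun ⟨h, h1, h2, h3, h4⟩ => ⟨h, h2, h1, h4, h3⟩) Or.symm,
    fun h => h.imp (fun ⟨h, h1, h2, h3, h4⟩ => ⟨h, h2, h1, h4, h3⟩) Or.symm⟩

theorem Hex.swap (h : Hex G c₀ c₁ c₂ c₃ c₄ c₅ d₁ d₂ d₄ d₅) :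
    Hex G c₃ c₂ c₁ c₀ c₅ c₄ d₂ d₁ d₅ d₄ := by
  obtain ⟨h0, h1, h2, h3, h4, h5, h6, h7, h8, h9, h10⟩ := h
  refine ⟨by clear h1 h2 h3 h4 h5 h6; simp at h0 ⊢; grind, ?_, ?_, ?_, ?_, ?_, ?_, ?_, ?_, ?_, ?_⟩
  · intro u; rw [h4]
  · intro u; rw [h3]; tauto
  · intro u; rw [h2]; tauto
  · intro u; rw [h1]
  · intro u; rw [h6]; tauto
  · intro u; rw [h5]; tauto
  all_goals (clear h0 h1 h2 h3 h4 h5 h6; simp at *; tauto)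

theorem Hex.reflect (h : Hex G c₀ c₁ c₂ c₃ c₄ c₅ d₁ d₂ d₄ d₅) :
    Hex G c₀ c₅ c₄ c₃ c₂ c₁ d₅ d₄ d₂ d₁ := by
  obtain ⟨h0, h1, h2, h3, h4, h5, h6, h7, h8, h9, h10⟩ := h
  refine ⟨by clear h1 h2 h3 h4 h5 h6; simp at h0 ⊢; grind, ?_, ?_, ?_, ?_, ?_, ?_, ?_, ?_, ?_, ?_⟩
  · intro u; rw [h1]; tauto
  · intro u; rw [h6]; tauto
  · intro u; rw [h5]; tauto
  · intro u; rw [h4]; tauto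
  · intro u; rw [h3]; tauto
  · intro u; rw [h2]; tauto
  all_goals (clear h0 h1 h2 h3 h4 h5 h6; simp at *; tauto)

theorem Hex.adj_c1 (h : Hex G c₀ c₁ c₂ c₃ c₄ c₅ d₁ d₂ d₄ d₅) {v : V}
    (hv : (hexReduce G c₁ c₂ d₁ d₂ d₄ d₅).Adj c₁ v) : v = d₁ ∨ v = d₅ := by
  have h1 := h.nodup; have h2 := h.notMem2; have h4 := h.notMem4
  simp only [hexReduce, SimpleGraph.fromRel_adj] at hv
  simp only [List.nodup_cons, List.mem_cons, not_or] at h1 h2 h4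
  clear h
  grind

theorem Hex.adj (h : Hex G c₀ c₁ c₂ c₃ c₄ c₅ d₁ d₂ d₄ d₅) :
    G.Adj c₀ c₁ ∧ G.Adj c₁ c₂ ∧ G.Adj c₂ c₃ ∧ G.Adj c₃ c₄ ∧ G.Adj c₄ c₅ ∧ G.Adj c₅ c₀ ∧
      G.Adj c₁ d₁ ∧ G.Adj c₂ d₂ ∧ G.Adj c₄ d₄ ∧ G.Adj c₅ d₅ := by
  simp [h.adj0, h.adj1, h.adj2, h.adj3, h.adj4, h.adj5]

/-- A cycle through exactly one of the two new vertices. -/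
theorem Hex.lift_one (h : Hex G c₀ c₁ c₂ c₃ c₄ c₅ d₁ d₂ d₄ d₅) (hf : Free G) {L : List V}
    (hL : Seg (hexReduce G c₁ c₂ d₁ d₂ d₄ d₅) c₁ L c₁) (hn : (c₁ :: L).Nodup)
    (hlen : L.length % 4 = 3) (hS : ∀ v ∈ L, v ∉ [c₀, c₃, c₄, c₅]) (h2 : c₂ ∉ L) : False := by
  have h1 : c₁ ∉ L := (List.nodup_cons.1 hn).1
  obtain ⟨p, hp, q, hq, e1, e2, e3, e4⟩ := hL.reattach (G := G)
    (by rintro rfl; simp at hlen) fun u hu v hv => hexReduce_adj_of_ne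
      (by grind) (by grind) (by grind) (by grind)
  obtain ⟨a0, a1, a2, a3, a4, a5, b1, b2, b4, b5⟩ := h.adj
  have hpq : p ≠ q := fun hpq => by have := e3 (List.nodup_cons.1 hn).2 hpq; omega
  have hp' := h.adj_c1 e1
  have hq' := h.adj_c1 e2.symm
  have hnh := h.nodup
  clear h e1 e2 e3 hL
  have key : ∀ M : List V, Seg G c₁ M c₅ → M.length = L.length → (∀ v, v ∈ M ↔ v ∈ L) → M.Nodup →
      False := by
    intro M hM hl hm hMn
    refine hf.two_paths hM (Q := [c₄, c₃, c₂]) (by simp [*, SimpleGraph.adj_comm]) ?_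
      (by simp; omega)
    clear hM hf e4
    simp only [List.nodup_cons, List.nodup_append, List.mem_cons, List.not_mem_nil, or_false,
      not_or] at hn hnh hS ⊢
    grind
  rcases hp' with rfl | rfl
  · obtain rfl := hq'.resolve_left hpq.symm
    exact key L (e4 _ _ b1 b5.symm) rfl (fun _ => Iff.rfl) (List.nodup_cons.1 hn).2
  · obtain rfl := hq'.resolve_right hpq.symm
    exact key L.reverse (e4 _ _ b5 b1.symm).reverse (by simp) (by simp)
      (by simpa using (List.nodup_cons.1 hn).2)

/-- A cycle through both new vertices. -/
theorem Hex.lift_two (h : Hex G c₀ c₁ c₂ c₃ c₄ c₅ d₁ d₂ d₄ d₅) (hf : Free G) {A B : List V}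
    (hA : Seg (hexReduce G c₁ c₂ d₁ d₂ d₄ d₅) c₁ A c₂)
    (hB : Seg (hexReduce G c₁ c₂ d₁ d₂ d₄ d₅) c₂ B c₁) (hn : (c₁ :: (A ++ c₂ :: B)).Nodup)
    (hlen : (A.length + B.length) % 4 = 2)
    (hS : ∀ v ∈ A ++ B, v ∉ [c₀, c₃, c₄, c₅]) : False := by
  have hnh := h.nodup
  have hsw : ∀ {v}, (hexReduce G c₁ c₂ d₁ d₂ d₄ d₅).Adj c₂ v → v = d₂ ∨ v = d₄ := fun hv =>
    h.swap.adj_c1 (hexReduce_comm ▸ hv)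
  have n1 := h.notMem1
  have n2 := h.notMem5
  simp only [List.nodup_cons, List.nodup_append, List.mem_cons, List.mem_append, List.not_mem_nil,
    or_false, not_or] at hn hnh hS n1 n2
  have hn12 : ¬ (hexReduce G c₁ c₂ d₁ d₂ d₄ d₅).Adj c₁ c₂ := fun h' => by
    have := h.adj_c1 h'
    grind
  obtain ⟨p, hp, q, hq, e1, e2, -, e4⟩ := hA.reattach (G := G)
    (by rintro rfl; exact hn12 hA) fun u hu v hv => hexReduce_adj_of_ne
      (by grind) (by grind) (by grind) (by grind)
  obtain ⟨r, hr, s, hs, g1, g2, -, g4⟩ := hB.reattach (G := G)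
    (by rintro rfl; exact hn12 hB.symm) fun u hu v hv => hexReduce_adj_of_ne
      (by grind) (by grind) (by grind) (by grind)
  obtain ⟨a0, a1, a2, a3, a4, a5, b1, b2, b4, b5⟩ := h.adj
  have hp' := h.adj_c1 e1
  have hs' := h.adj_c1 g2.symm
  have hq' := hsw e2.symm
  have hr' := hsw g1
  have hps : p ≠ s := by grind
  have hqr : q ≠ r := by grind
  clear h e1 e2 g1 g2 hA hB hsw hn12 n1 n2
  have key : ∀ x y x' y' : V, G.Adj x p → G.Adj q y → G.Adj y' r → G.Adj s x' →
      G.Adj x c₀ → G.Adj x' c₀ → G.Adj y c₃ → G.Adj y' c₃ →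
      [c₀, x, y, c₃, y', x'].Nodup → (∀ v ∈ A ++ B, v ∉ [c₀, x, y, c₃, y', x']) → False := by
    intro x y x' y' h1 h2 h3 h4 h5 h6 h7 h8 h9 h10
    have k1 := e4 _ _ h1 h2
    have k2 := g4 _ _ h3 h4
    refine hf.two_paths k1 (Q := c₃ :: y' :: (B ++ [x', c₀])) (by simp [*, h8.symm, h5.symm]) ?_
      (by simp; omega)
    clear k1 k2 hf e4 g4
    simp only [List.nodup_cons, List.nodup_append, List.mem_cons, List.mem_append,
      List.not_mem_nil, or_false, not_or] at h9 h10 ⊢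
    grind
  clear e4 g4
  have hx : (G.Adj c₁ p ∧ G.Adj s c₅) ∨ (G.Adj c₅ p ∧ G.Adj s c₁) := by
    have := b1.symm; have := b5.symm; grind
  have hy : (G.Adj q c₂ ∧ G.Adj c₄ r) ∨ (G.Adj q c₄ ∧ G.Adj c₂ r) := by
    have := b2.symm; have := b4.symm; grind
  rcases hx with ⟨x1, x2⟩ | ⟨x1, x2⟩ <;> rcases hy with ⟨y1, y2⟩ | ⟨y1, y2⟩
  · refine key c₁ c₂ c₅ c₄ x1 y1 y2 x2 a0.symm a5 a2 a3.symm ?_ ?_ <;>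
      simp only [List.nodup_cons, List.mem_append, List.mem_cons, List.not_mem_nil, or_false,
        not_or] <;> grind
  · refine key c₁ c₄ c₅ c₂ x1 y1 y2 x2 a0.symm a5 a3.symm a2 ?_ ?_ <;>
      simp only [List.nodup_cons, List.mem_append, List.mem_cons, List.not_mem_nil, or_false,
        not_or] <;> grind
  · refine key c₅ c₂ c₁ c₄ x1 y1 y2 x2 a5 a0.symm a2 a3.symm ?_ ?_ <;>
      simp only [List.nodup_cons, List.mem_append, List.mem_cons, List.not_mem_nil, or_false,
        not_or] <;> grind
  · refine key c₅ c₄ c₁ c₂ x1 y1 y2 x2 a5 a0.symm a3.symm a2 ?_ ?_ <;>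
      simp only [List.nodup_cons, List.mem_append, List.mem_cons, List.not_mem_nil, or_false,
        not_or] <;> grind

theorem Hex.not_hasCycleIn (h : Hex G c₀ c₁ c₂ c₃ c₄ c₅ d₁ d₂ d₄ d₅) (hf : Free G) {S : Finset V}
    (hS : ∀ v ∈ S, v ∉ [c₀, c₃, c₄, c₅]) :
    ¬ HasCycleIn (hexReduce G c₁ c₂ d₁ d₂ d₄ d₅) S := by
  rintro ⟨x, L, hL, hn, hlen, hm⟩
  replace hm := fun v hv => hS v (hm v hv)
  by_cases h1 : c₁ ∈ x :: L
  · obtain ⟨L', s', p', l'⟩ := hL.exists_rotate hn h1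
    replace hn := p'.nodup_iff.2 hn
    replace hm := fun v hv => hm v (p'.mem_iff.1 hv)
    rw [← l'] at hlen
    by_cases h2 : c₂ ∈ L'
    · obtain ⟨A, B, rfl⟩ := List.append_of_mem h2
      obtain ⟨sA, sB⟩ := seg_append.1 s'
      exact h.lift_two hf sA sB hn (by simp at hlen; omega) fun v hv => hm v (by
        simp at hv ⊢; tauto)
    · exact h.lift_one hf s' hn hlen (fun v hv => hm v (by simp [hv])) h2
  by_cases h2 : c₂ ∈ x :: L
  · obtain ⟨L', s', p', l'⟩ := hL.exists_rotate hn h2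
    rw [hexReduce_comm] at s'
    exact h.swap.lift_one hf s' (p'.nodup_iff.2 hn) (l' ▸ hlen)
      (fun v hv => by
        have := hm v (p'.mem_iff.1 (by simp [hv]))
        simp at this ⊢; tauto)
      fun h' => h1 (p'.mem_iff.1 (by simp [h']))
  · refine hf x L (hL.imp fun u hu v hv => ?_) hn hlen
    have mem : ∀ u ∈ x :: (L ++ [x]), u ∈ x :: L := by intro u hu; simp at hu ⊢; tauto
    replace hu := mem u hu
    replace hv := mem v hv
    exact hexReduce_adj_of_ne (by grind) (by grind) (by grind) (by grind)

end

section

variable {V : Type*} {G : SimpleGraph V} {W : Finset V} {c₀ c₁ c₂ c₃ c₄ c₅ d₁ d₂ d₄ d₅ : V}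

theorem Hex.ne_of_free (h : Hex G c₀ c₁ c₂ c₃ c₄ c₅ d₁ d₂ d₄ d₅) (hf : Free G) : d₁ ≠ d₅ := by
  rintro rfl
  obtain ⟨a0, -, -, -, -, a5, b1, -, -, b5⟩ := h.adj
  have h1 := h.nodup
  have h2 := h.notMem1
  simp only [List.nodup_cons, List.mem_cons, not_or] at h1 h2
  exact hf.no_square a0 b1 b5.symm a5 (Ne.symm h2.1) h1.2.1.2.2.2.1

theorem Hex.adj_hexReduce_c1 (h : Hex G c₀ c₁ c₂ c₃ c₄ c₅ d₁ d₂ d₄ d₅) :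
    (hexReduce G c₁ c₂ d₁ d₂ d₄ d₅).Adj c₁ d₁ ∧ (hexReduce G c₁ c₂ d₁ d₂ d₄ d₅).Adj c₁ d₅ := by
  have h1 := h.notMem1
  have h2 := h.notMem5
  simp only [List.mem_cons, not_or] at h1 h2
  simp [hexReduce, Ne.symm h1.2.1, Ne.symm h2.2.1]

variable [DecidableEq V]

theorem Hex.map_adj (h : Hex G c₀ c₁ c₂ c₃ c₄ c₅ d₁ d₂ d₄ d₅) {u v : V}
    (hv : v ∉ [c₀, c₁, c₂, c₃, c₄, c₅]) (hu : G.Adj v u) :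
    (hexReduce G c₁ c₂ d₁ d₂ d₄ d₅).Adj v (if u = c₄ then c₂ else if u = c₅ then c₁ else u) ∧
      (if u = c₄ then c₂ else if u = c₅ then c₁ else u) ∉ [c₀, c₃, c₄, c₅] := by
  have hn := h.nodup
  have h1 := h.adj_hexReduce_c1
  have h2 := h.swap.adj_hexReduce_c1
  rw [← hexReduce_comm] at h2
  simp only [List.nodup_cons, List.mem_cons, List.not_mem_nil, or_false, not_or] at hn hv ⊢
  obtain ⟨v0, v1, v2, v3, v4, v5⟩ := hv
  have hs := hu.symm
  split_ifs with e4 e5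
  · subst e4
    obtain rfl := (((h.adj4 v).1 hs).resolve_left v3).resolve_left v5
    exact ⟨h2.2.symm, by clear h; grind⟩
  · subst e5
    obtain rfl := (((h.adj5 v).1 hs).resolve_left v4).resolve_left v0
    exact ⟨h1.2.symm, by clear h; grind⟩
  · have e0 : u ≠ c₀ := by rintro rfl; exact ((h.adj0 v).1 hs).elim v1 v5
    have e3 : u ≠ c₃ := by rintro rfl; exact ((h.adj3 v).1 hs).elim v2 v4
    refine ⟨?_, e0, e3, e4, e5⟩
    by_cases e1 : u = c₁
    · subst e1
      obtain rfl := (((h.adj1 v).1 hs).resolve_left v0).resolve_left v2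
      exact h1.1.symm
    by_cases e2 : u = c₂
    · subst e2
      obtain rfl := (((h.adj2 v).1 hs).resolve_left v1).resolve_left v3
      exact h2.1.symm
    simp only [hexReduce, SimpleGraph.fromRel_adj]
    exact ⟨hu.ne, .inl (.inl ⟨hu, v1, v2, e1, e2⟩)⟩

theorem Hex.map_inj (h : Hex G c₀ c₁ c₂ c₃ c₄ c₅ d₁ d₂ d₄ d₅) (hf : Free G) {v : V}
    (hv : v ∉ [c₀, c₁, c₂, c₃, c₄, c₅]) (u u' : V) (hu : G.Adj v u) (hu' : G.Adj v u')
    (he : (if u = c₄ then c₂ else if u = c₅ then c₁ else u) =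
      if u' = c₄ then c₂ else if u' = c₅ then c₁ else u') : u = u' := by
  have h15 := h.ne_of_free hf
  have h24 := h.swap.ne_of_free hf
  have hn := h.nodup
  simp only [List.nodup_cons, List.mem_cons, List.not_mem_nil, or_false, not_or] at hn hv
  have h1 : ¬ (G.Adj v c₁ ∧ G.Adj v c₅) := by
    rintro ⟨h1, h5⟩
    have := (h.adj1 v).1 h1.symm
    have := (h.adj5 v).1 h5.symm
    clear h
    grind
  have h2 : ¬ (G.Adj v c₂ ∧ G.Adj v c₄) := by
    rintro ⟨h1, h5⟩
    have := (h.adj2 v).1 h1.symm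
    have := (h.adj4 v).1 h5.symm
    clear h
    grind
  clear h hf
  split_ifs at he <;> subst_vars <;> grind

variable [Fintype V]

theorem Crit.hex_small (h : Crit G W) (hx : Hex G c₀ c₁ c₂ c₃ c₄ c₅ d₁ d₂ d₄ d₅) (h0 : c₀ ∈ W)
    (h3 : c₃ ∈ W) : 9 ≤ Fintype.card V ∧ Fintype.card V ≤ 12 := by
  by_contra hcon
  have hn := hx.nodup
  have h15 := hx.ne_of_free h.free
  have h24 := hx.swap.ne_of_free h.free
  have r1 := hx.adj_hexReduce_c1
  have r2 := hx.swap.adj_hexReduce_c1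
  rw [← hexReduce_comm] at r2
  have n1 := hx.notMem1
  have n2 := hx.notMem2
  have n4 := hx.notMem4
  have n5 := hx.notMem5
  set S : Finset V := univ \ [c₀, c₃, c₄, c₅].toFinset with hS
  have mem : ∀ v, v ∈ S ↔ v ∉ [c₀, c₃, c₄, c₅] := by intro v; simp [hS]
  set W' : Finset V := insert c₁ (insert c₂ ((W.erase c₀).erase c₃)) with hW'
  have hcS : #S = Fintype.card V - 4 := by
    rw [hS, card_univ_sdiff, List.toFinset_card_of_nodup]
    · simp
    · clear hx
      simp only [List.nodup_cons, List.mem_cons, List.not_mem_nil, or_false, not_or] at hn ⊢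
      grind
  have h03 : c₃ ∈ W.erase c₀ := mem_erase.2 ⟨by
    clear hx
    simp only [List.nodup_cons, List.mem_cons, List.not_mem_nil, or_false, not_or] at hn
    grind, h3⟩
  have hcW : #W' ≤ #W := by
    rw [hW']
    have e1 := card_erase_add_one h0
    have e2 := card_erase_add_one h03
    have e3 := card_insert_le c₁ (insert c₂ ((W.erase c₀).erase c₃))
    have e4 := card_insert_le c₂ ((W.erase c₀).erase c₃)
    omega
  have hpos : 0 < Fintype.card V := Fintype.card_pos_iff.2 ⟨c₀⟩
  have hoff : ∀ v ∈ S, v ≠ c₁ → v ≠ c₂ → v ∉ [c₀, c₁, c₂, c₃, c₄, c₅] := by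
    intro v hv h1 h2
    rw [mem] at hv
    simp only [List.mem_cons, List.not_mem_nil, or_false, not_or] at hv ⊢
    tauto
  have hsub : ∀ v, v ∉ [c₀, c₁, c₂, c₃, c₄, c₅] → v ∈ S := by
    intro v hv
    rw [mem]
    simp only [List.mem_cons, List.not_mem_nil, or_false, not_or] at hv ⊢
    tauto
  refine hx.not_hasCycleIn h.free (fun v hv => (mem v).1 hv) (h.red _ S W' ?_ ⟨d₁, hsub _ n1⟩ ?_ ?_
    (hcW.trans h.card_le) ?_)
  · have : S ≠ univ := fun he => by
      have := (mem c₀).1 (he ▸ mem_univ c₀)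
      simp at this
    exact (card_lt_iff_ne_univ S).2 this
  · intro v hv
    by_cases h1 : v = c₁
    · subst h1
      exact ⟨d₁, d₅, h15, hsub _ n1, hsub _ n5, r1.1, r1.2⟩
    by_cases h2 : v = c₂
    · subst h2
      exact ⟨d₂, d₄, h24, hsub _ n2, hsub _ n4, r2.1, r2.2⟩
    have hv' := hoff v hv h1 h2
    exact (h.d2 v).map _ (fun u _ hu => (hx.map_adj hv' hu).imp_right (mem _).2)
      (hx.map_inj h.free hv')
  · intro v hv hvW
    simp only [hW', mem_insert, mem_erase, not_or, not_and, mem] at hv hvW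
    have hv' := hoff v ((mem v).2 hv) hvW.1 hvW.2.1
    refine (h.d3 v ?_).map _ (fun u _ hu => (hx.map_adj hv' hu).imp_right (mem _).2)
      (hx.map_inj h.free hv')
    simp only [List.mem_cons, not_or] at hv
    exact hvW.2.2 hv.2.1 hv.1
  · have := h.big
    have := h.card_le
    omega

end

section

variable {V : Type*} [Fintype V] [DecidableEq V] {G : SimpleGraph V} {W : Finset V}
  {c₀ c₁ c₂ c₃ c₄ c₅ d₁ d₂ d₄ d₅ : V}

theorem Crit.no_hex_near_near (h : Crit G W) (hx : Hex G c₀ c₁ c₂ c₃ c₄ c₅ d₁ d₁ d₄ d₄) (h0 : c₀ ∈ W)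
    (h3 : c₃ ∈ W) : False := by
  obtain ⟨hn, hN⟩ := h.hex_small hx h0 h3
  have h15 := hx.ne_of_free h.free
  have h24 := hx.swap.ne_of_free h.free
  obtain ⟨a0, a1, a2, a3, a4, a5, b1, b2, b4, b5⟩ := hx.adj
  refine h.not_refute hn hN c₀ [c₀, c₁, c₂, c₃, c₄, c₅, d₁, d₄] (m := 8) rfl
    (E := [(0, 1), (1, 2), (2, 3), (3, 4), (4, 5), (0, 5), (1, 6), (2, 6), (4, 7), (5, 7)])
    (op := [7, 6])
    (cl := [(0, [1, 5]), (1, [0, 2, 6]), (2, [1, 3, 6]), (3, [2, 4]), (4, [3, 5, 7]),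
      (5, [4, 0, 7])])
    (tw := [0, 3]) refute_hex_near_near (by decide +kernel) ?_ ?_ ?_ ?_
  · have n0 := hx.nodup
    have n1 := hx.notMem1
    have n2 := hx.notMem2
    have n4 := hx.notMem4
    have n5 := hx.notMem5
    clear hx
    simp only [List.nodup_cons, List.mem_cons, List.not_mem_nil, or_false, not_or] at n0 n1 n2 n4 n5 ⊢
    grind
  · simp [a0, a1, a2, a3, a4, a5.symm, b1, b2, b4, b5]
  · simp [hx.adj0, hx.adj1, hx.adj2, hx.adj3, hx.adj4, hx.adj5]
  · simp [h0, h3]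

theorem Crit.no_hex_near (h : Crit G W) (hx : Hex G c₀ c₁ c₂ c₃ c₄ c₅ d₁ d₁ d₄ d₅) (h0 : c₀ ∈ W)
    (h3 : c₃ ∈ W) (h45 : d₄ ≠ d₅) : False := by
  obtain ⟨hn, hN⟩ := h.hex_small hx h0 h3
  have h15 := hx.ne_of_free h.free
  have h24 := hx.swap.ne_of_free h.free
  obtain ⟨a0, a1, a2, a3, a4, a5, b1, b2, b4, b5⟩ := hx.adj
  refine h.not_refute hn hN c₀ [c₀, c₁, c₂, c₃, c₄, c₅, d₁, d₄, d₅] (m := 9) rfl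
    (E := [(0, 1), (1, 2), (2, 3), (3, 4), (4, 5), (0, 5), (1, 6), (2, 6), (4, 7), (5, 8)])
    (op := [8, 7, 6])
    (cl := [(0, [1, 5]), (1, [0, 2, 6]), (2, [1, 3, 6]), (3, [2, 4]), (4, [3, 5, 7]),
      (5, [4, 0, 8])])
    (tw := [0, 3]) refute_hex_near (by decide +kernel) ?_ ?_ ?_ ?_
  · have n0 := hx.nodup
    have n1 := hx.notMem1
    have n2 := hx.notMem2
    have n4 := hx.notMem4
    have n5 := hx.notMem5
    clear hx
    simp only [List.nodup_cons, List.mem_cons, List.not_mem_nil, or_false, not_or] at n0 n1 n2 n4 n5 ⊢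
    grind
  · simp [a0, a1, a2, a3, a4, a5.symm, b1, b2, b4, b5]
  · simp [hx.adj0, hx.adj1, hx.adj2, hx.adj3, hx.adj4, hx.adj5]
  · simp [h0, h3]

theorem Crit.no_hex_far_far (h : Crit G W) (hx : Hex G c₀ c₁ c₂ c₃ c₄ c₅ d₁ d₂ d₁ d₂) (h0 : c₀ ∈ W)
    (h3 : c₃ ∈ W) : False := by
  obtain ⟨hn, hN⟩ := h.hex_small hx h0 h3
  have h15 := hx.ne_of_free h.free
  have h24 := hx.swap.ne_of_free h.free
  obtain ⟨a0, a1, a2, a3, a4, a5, b1, b2, b4, b5⟩ := hx.adj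
  refine h.not_refute hn hN c₀ [c₀, c₁, c₂, c₃, c₄, c₅, d₁, d₂] (m := 8) rfl
    (E := [(0, 1), (1, 2), (2, 3), (3, 4), (4, 5), (0, 5), (1, 6), (2, 7), (4, 6), (5, 7)])
    (op := [7, 6])
    (cl := [(0, [1, 5]), (1, [0, 2, 6]), (2, [1, 3, 7]), (3, [2, 4]), (4, [3, 5, 6]),
      (5, [4, 0, 7])])
    (tw := [0, 3]) refute_hex_far_far (by decide +kernel) ?_ ?_ ?_ ?_
  · have n0 := hx.nodup
    have n1 := hx.notMem1
    have n2 := hx.notMem2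
    have n4 := hx.notMem4
    have n5 := hx.notMem5
    clear hx
    simp only [List.nodup_cons, List.mem_cons, List.not_mem_nil, or_false, not_or] at n0 n1 n2 n4 n5 ⊢
    grind
  · simp [a0, a1, a2, a3, a4, a5.symm, b1, b2, b4, b5]
  · simp [hx.adj0, hx.adj1, hx.adj2, hx.adj3, hx.adj4, hx.adj5]
  · simp [h0, h3]

theorem Crit.no_hex_far (h : Crit G W) (hx : Hex G c₀ c₁ c₂ c₃ c₄ c₅ d₁ d₂ d₁ d₅) (h0 : c₀ ∈ W)
    (h3 : c₃ ∈ W) (h25 : d₂ ≠ d₅) : False := by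
  obtain ⟨hn, hN⟩ := h.hex_small hx h0 h3
  have h15 := hx.ne_of_free h.free
  have h24 := hx.swap.ne_of_free h.free
  obtain ⟨a0, a1, a2, a3, a4, a5, b1, b2, b4, b5⟩ := hx.adj
  refine h.not_refute hn hN c₀ [c₀, c₁, c₂, c₃, c₄, c₅, d₁, d₂, d₅] (m := 9) rfl
    (E := [(0, 1), (1, 2), (2, 3), (3, 4), (4, 5), (0, 5), (1, 6), (2, 7), (4, 6), (5, 8)])
    (op := [8, 7, 6])
    (cl := [(0, [1, 5]), (1, [0, 2, 6]), (2, [1, 3, 7]), (3, [2, 4]), (4, [3, 5, 6]),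
      (5, [4, 0, 8])])
    (tw := [0, 3]) refute_hex_far (by decide +kernel) ?_ ?_ ?_ ?_
  · have n0 := hx.nodup
    have n1 := hx.notMem1
    have n2 := hx.notMem2
    have n4 := hx.notMem4
    have n5 := hx.notMem5
    clear hx
    simp only [List.nodup_cons, List.mem_cons, List.not_mem_nil, or_false, not_or] at n0 n1 n2 n4 n5 ⊢
    grind
  · simp [a0, a1, a2, a3, a4, a5.symm, b1, b2, b4, b5]
  · simp [hx.adj0, hx.adj1, hx.adj2, hx.adj3, hx.adj4, hx.adj5]
  · simp [h0, h3]

theorem Crit.no_hex_of_ne (h : Crit G W) (hx : Hex G c₀ c₁ c₂ c₃ c₄ c₅ d₁ d₂ d₄ d₅) (h0 : c₀ ∈ W)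
    (h3 : c₃ ∈ W)
    (h12 : d₁ ≠ d₂) (h45 : d₄ ≠ d₅) (h14 : d₁ ≠ d₄) (h25 : d₂ ≠ d₅) : False := by
  obtain ⟨hn, hN⟩ := h.hex_small hx h0 h3
  have h15 := hx.ne_of_free h.free
  have h24 := hx.swap.ne_of_free h.free
  obtain ⟨a0, a1, a2, a3, a4, a5, b1, b2, b4, b5⟩ := hx.adj
  refine h.not_refute hn hN c₀ [c₀, c₁, c₂, c₃, c₄, c₅, d₁, d₂, d₄, d₅] (m := 10) rfl
    (E := [(0, 1), (1, 2), (2, 3), (3, 4), (4, 5), (0, 5), (1, 6), (2, 7), (4, 8), (5, 9)])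
    (op := [9, 8, 7, 6])
    (cl := [(0, [1, 5]), (1, [0, 2, 6]), (2, [1, 3, 7]), (3, [2, 4]), (4, [3, 5, 8]),
      (5, [4, 0, 9])])
    (tw := [0, 3]) refute_hex (by decide +kernel) ?_ ?_ ?_ ?_
  · have n0 := hx.nodup
    have n1 := hx.notMem1
    have n2 := hx.notMem2
    have n4 := hx.notMem4
    have n5 := hx.notMem5
    clear hx
    simp only [List.nodup_cons, List.mem_cons, List.not_mem_nil, or_false, not_or] at n0 n1 n2 n4 n5 ⊢
    grind
  · simp [a0, a1, a2, a3, a4, a5.symm, b1, b2, b4, b5]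
  · simp [hx.adj0, hx.adj1, hx.adj2, hx.adj3, hx.adj4, hx.adj5]
  · simp [h0, h3]

theorem Crit.no_hex (h : Crit G W) (hx : Hex G c₀ c₁ c₂ c₃ c₄ c₅ d₁ d₂ d₄ d₅) (h0 : c₀ ∈ W)
    (h3 : c₃ ∈ W) : False := by
  by_cases h12 : d₁ = d₂
  · subst h12
    by_cases h45 : d₄ = d₅
    · subst h45
      exact h.no_hex_near_near hx h0 h3
    · exact h.no_hex_near hx h0 h3 h45
  by_cases h45 : d₄ = d₅
  · subst h45
    exact h.no_hex_near hx.reflect h0 h3 (Ne.symm h12)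
  by_cases h14 : d₁ = d₄
  · subst h14
    by_cases h25 : d₂ = d₅
    · subst h25
      exact h.no_hex_far_far hx h0 h3
    · exact h.no_hex_far hx h0 h3 h25
  by_cases h25 : d₂ = d₅
  · subst h25
    exact h.no_hex_far hx.reflect h0 h3 (Ne.symm h14)
  exact h.no_hex_of_ne hx h0 h3 h12 h45 h14 h25

/-- A neighbour of `D` next to a vertex of degree two has one neighbour in `D`. -/
theorem Crit.exists_third (h : Crit G W) {D : Finset V} {w x y : V} (hw : w ∈ W) (hwx : G.Adj w x)
    (hxy : G.Adj x y) (hwy : w ≠ y) (hwD : w ∉ D) (hyD : y ∉ D) (hx : x ∈ nbhd G D) :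
    ∃ d ∈ D, ∀ u, G.Adj x u ↔ u = w ∨ u = y ∨ u = d := by
  obtain ⟨p, q, hN⟩ := h.cubic_of_adj_mem hw hwx
  obtain ⟨d, hd, hxd⟩ := (mem_nbhd.1 hx).2
  refine ⟨d, hd, fun u => ?_⟩
  have h1 := (hN.2.2.2 y).1 hxy
  have h2 := (hN.2.2.2 d).1 hxd
  have h3 : w ≠ d := fun e => hwD (e ▸ hd)
  have h4 : y ≠ d := fun e => hyD (e ▸ hd)
  rw [hN.2.2.2]
  clear hN hd hwD hyD
  grind

theorem Crit.false [Nonempty V] (h : Crit G W) : False := by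
  obtain ⟨v₀⟩ := ‹Nonempty V›
  obtain ⟨D, hD⟩ := h.maxSide v₀
  obtain ⟨c₀, c₁, c₂, c₃, c₄, c₅, hC, hCD, h0, h3, m1, m2, m4, m5⟩ := hD.exists_opposite h
  have hs := hC.seg
  simp only [seg_cons, seg_nil] at hs
  obtain ⟨s0, s1, s2, s3, s4, s5⟩ := hs
  have hn := hC.nodup
  have hne := hn
  simp only [List.nodup_cons, List.mem_cons, List.not_mem_nil, or_false, not_or] at hne
  have k0 := hCD c₀ (by simp)
  have k1 := hCD c₁ (by simp)
  have k2 := hCD c₂ (by simp)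
  have k3 := hCD c₃ (by simp)
  have k4 := hCD c₄ (by simp)
  have k5 := hCD c₅ (by simp)
  obtain ⟨d₁, hd1, N1⟩ := h.exists_third h0 s0 s1 (by grind) k0 k2 m1
  obtain ⟨d₂, hd2, N2⟩ := h.exists_third h3 s2.symm s1.symm (by grind) k3 k1 m2
  obtain ⟨d₄, hd4, N4⟩ := h.exists_third h3 s3 s4 (by grind) k3 k5 m4
  obtain ⟨d₅, hd5, N5⟩ := h.exists_third h0 s5.symm s4.symm (by grind) k0 k4 m5
  exact h.no_hex ⟨hn, h.adj_iff h0 s0 s5.symm (by grind), N1,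
    fun u => (N2 u).trans or_left_comm, h.adj_iff h3 s2.symm s3 (by grind), N4,
    fun u => (N5 u).trans or_left_comm, fun hm => hCD _ hm hd1, fun hm => hCD _ hm hd2,
    fun hm => hCD _ hm hd4, fun hm => hCD _ hm hd5⟩ h0 h3

end

theorem Seg.map_val {V : Type*} {H : SimpleGraph V} {p : V → Prop} {a b : {v // p v}}
    {P : List {v // p v}} (h : Seg (H.comap Subtype.val) a P b) :
    Seg H a.1 (P.map Subtype.val) b.1 := by
  induction P generalizing a with
  | nil => exact h
  | cons c P ih => exact ⟨h.1, ih h.2⟩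

theorem D2.comap {V : Type*} {H : SimpleGraph V} {S : Finset V} {v : {v // v ∈ S}}
    (h : D2 H S v.1) : D2 (H.comap Subtype.val) univ v := by
  obtain ⟨a, b, hab, ha, hb, h1, h2⟩ := h
  exact ⟨⟨a, ha⟩, ⟨b, hb⟩, by simpa using hab, mem_univ _, mem_univ _, h1, h2⟩

theorem D3.comap {V : Type*} {H : SimpleGraph V} {S : Finset V} {v : {v // v ∈ S}}
    (h : D3 H S v.1) : D3 (H.comap Subtype.val) univ v := by
  obtain ⟨a, b, c, hab, hac, hbc, ha, hb, hc, h1, h2, h3⟩ := h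
  exact ⟨⟨a, ha⟩, ⟨b, hb⟩, ⟨c, hc⟩, by simpa using hab, by simpa using hac, by simpa using hbc,
    mem_univ _, mem_univ _, mem_univ _, h1, h2, h3⟩

theorem not_free (n : ℕ) : ∀ (V : Type*) [Fintype V] [DecidableEq V] [Nonempty V]
    (G : SimpleGraph V) (W : Finset V), Fintype.card V = n → (∀ v, D2 G univ v) →
    (∀ v, v ∉ W → D3 G univ v) → #W ≤ 3 → (#W ≤ 2 ∨ 9 ≤ n) → ¬ Free G := by
  classical
  induction n using Nat.strong_induction_on with
  | _ n ih =>
  intro V _ _ _ G W hn h2 h3 hW hbig hf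
  have hsub : (univ.filter fun v => ¬ D3 G univ v) ⊆ W := fun v hv => by
    by_contra hvW
    exact (mem_filter.1 hv).2 (h3 v hvW)
  have hcard := card_le_card hsub
  refine Crit.false (G := G) (W := univ.filter fun v => ¬ D3 G univ v)
    ⟨hf, h2, fun v hv => by simpa using hv, ?_, hcard.trans hW, by omega, ?_⟩
  · intro w hw
    obtain ⟨a, b, hab, -, -, h1, h2⟩ := h2 w
    refine ⟨a, b, hab, fun x => ⟨fun hx => ?_, ?_⟩⟩
    · by_contra hne
      push Not at hne
      exact (mem_filter.1 hw).2 ⟨a, b, x, hab, hne.1.symm, hne.2.symm, mem_univ _, mem_univ _,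
        mem_univ _, h1, h2, hx⟩
    · rintro (rfl | rfl) <;> assumption
  · intro H S W' hS hne g2 g3 hW' hb
    have : Nonempty {v // v ∈ S} := hne.to_subtype
    have hc : #(W'.subtype (· ∈ S)) ≤ #W' := by
      rw [card_subtype]
      exact card_filter_le _ _
    have hnot := ih #S (hn ▸ hS) {v // v ∈ S} (H.comap Subtype.val) (W'.subtype (· ∈ S))
      (Fintype.card_coe S) (fun v => (g2 v v.2).comap)
      (fun v hv => (g3 v v.2 (by simpa using hv)).comap) (hc.trans hW') (by omega)
    unfold Free at hnot
    push Not at hnot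
    obtain ⟨x, L, hL, hnd, hlen⟩ := hnot
    refine ⟨x, L.map Subtype.val, hL.map_val, ?_, by simpa using hlen, ?_⟩
    · rw [← List.map_cons]
      exact hnd.map Subtype.val_injective
    · intro y hy
      rw [← List.map_cons] at hy
      obtain ⟨z, -, rfl⟩ := List.mem_map.1 hy
      exact z.2

theorem Seg.exists_walk {V : Type*} {G : SimpleGraph V} {a b : V} {P : List V} (h : Seg G a P b) :
    ∃ p : G.Walk a b, p.support = a :: (P ++ [b]) := by
  induction P generalizing a with
  | nil => exact ⟨.cons h .nil, rfl⟩
  | cons c P ih =>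
    obtain ⟨p, hp⟩ := ih h.2
    exact ⟨.cons h.1 p, by simp [hp]⟩

theorem exists_isCycle {V : Type*} {G : SimpleGraph V} (hf : ¬ Free G) :
    ∃ (u : V) (c : G.Walk u u), c.IsCycle ∧ 4 ∣ c.length := by
  classical
  unfold Free at hf
  push Not at hf
  obtain ⟨x, L, hL, hn, hlen⟩ := hf
  obtain ⟨y, P, rfl⟩ : ∃ y P, L = y :: P := by
    cases L with
    | nil => simp at hlen
    | cons y P => exact ⟨y, P, rfl⟩
  obtain ⟨p, hp⟩ := hL.2.exists_walk
  have hpl : p.length = P.length + 1 := by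
    have := p.length_support
    rw [hp] at this
    simpa using this.symm
  refine ⟨x, .cons hL.1 p, ?_, ?_⟩
  · rw [SimpleGraph.Walk.cons_isCycle_iff]
    have hpath : p.IsPath := by
      rw [SimpleGraph.Walk.isPath_def, hp]
      simp only [List.nodup_cons, List.nodup_append, List.mem_append, List.mem_cons] at hn ⊢
      grind
    refine ⟨hpath, fun he => ?_⟩
    have := hpath.length_eq_one_of_mem_edges (Sym2.eq_swap ▸ he)
    simp only [List.length_cons] at hlen
    omega
  · simp only [SimpleGraph.Walk.length_cons, hpl]
    simp only [List.length_cons] at hlen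
    omega

end CycleModFour

/-- Every graph on at least nine vertices with minimum degree at least 2 and at
most three vertices of degree 2 contains a cycle whose length is divisible by 4. -/
theorem stmt_12 {V : Type*} [Fintype V] [DecidableEq V] (G : SimpleGraph V)
    [DecidableRel G.Adj]
    (hcard : 9 ≤ Fintype.card V)
    (hmin : ∀ v, 2 ≤ G.degree v)
    (h2 : (Finset.univ.filter fun v => G.degree v = 2).card ≤ 3) :
    ∃ (u : V) (c : G.Walk u u), c.IsCycle ∧ 4 ∣ c.length := by
  have : Nonempty V := Fintype.card_pos_iff.1 (by omega)
  refine CycleModFour.exists_isCycle (CycleModFour.not_free _ V G _ rfl (fun v => ?_)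
    (fun v hv => ?_) h2 (.inr hcard))
  · obtain ⟨a, ha, b, hb, hab⟩ := Finset.one_lt_card.1 (hmin v)
    exact ⟨a, b, hab, by simp, by simp, by simpa using ha, by simpa using hb⟩
  · have hv' : G.degree v ≠ 2 := by simpa using hv
    obtain ⟨a, ha, b, hb, c, hc, hab, hac, hbc⟩ := Finset.two_lt_card.1
      (lt_of_le_of_ne (hmin v) hv'.symm)
    exact ⟨a, b, c, hab, hac, hbc, by simp, by simp, by simp, by simpa using ha, by simpa using hb,
      by simpa using hc⟩
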